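/- Theorem 2 (fractional lumped formulation, linear case). Let a, λ, α, γ, A > 0, 0 < β < 1/2. Define f₂(τ,z,s) = (β(z+ατ)/(a√π s^{2β+1}))·∫_0^∞ u^{-1/2} exp(−(z+ατ)²/(4a²u) − λ²u/(4a²))·M(u/s^{2β}; 2β) du for s > 0, and g₂(t,τ,z) = ∫_0^t N(τ/(t−s)^{2β}; β)·f₂(τ,z,s) ds. Set u(x,z,t) = 2γA e^{γx} ∫_0^∞ [ (1/√(πτ)) exp(−x²/(4τ) − γ²τ) − γ e^{γx} erfc(x/(2√τ) + γ√τ) ]·exp(λ(z+ατ)/(2a²))·g₂(t,τ,z) dτ. Then u solves the fractional boundary value problem: (i) D_*^{2β}u(x,z,·)(t) = a² ∂²u/∂z²(x,z,t) − λ ∂u/∂z(x,z,t) for all x, z, t > 0; (ii) D_*^{2β}u(x,0,·)(t) = ∂²u/∂x²(x,0,t) − 2γ ∂u/∂x(x,0,t) + α ∂u/∂z(x,0,t) for all x, t > 0; (iii) ∂u/∂x(x,0,t) − 2γ u(x,0,t) → −2γA as x → 0⁺ for each t > 0; (iv) u(x,z,t) → 0 as x² + z² → ∞ for each t > 0; (v)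 u(x,z,t) → 0 as t → 0⁺ for all x, z > 0. -/

import Mathlib

open MeasureTheory Real Filter Set

/-- The Wright-type auxiliary function `M(y; δ)`. -/
noncomputable def Mwr (y δ : ℝ) : ℝ :=
  ∑' n : ℕ, (-y) ^ n / ((n.factorial : ℝ) * Real.Gamma (-δ * (n : ℝ) + 1 - δ))

/-- The Wright-type auxiliary function `N(y; β)`. -/
noncomputable def Nwr (y β : ℝ) : ℝ :=
  ∑' n : ℕ, (-y) ^ n / ((n.factorial : ℝ) * Real.Gamma (-2 * β * (n : ℝ) + 1))

/-- The Caputo fractional derivative of order `0 < δ < 1`. -/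
noncomputable def caputo (δ : ℝ) (v : ℝ → ℝ) (t : ℝ) : ℝ :=
  (1 / Real.Gamma (1 - δ)) * ∫ s in (0 : ℝ)..t, deriv v s * (t - s) ^ (-δ)

/-- The complementary error function `erfc(y) = (2/√π) ∫_y^∞ e^{−s²} ds`. -/
noncomputable def erfc (y : ℝ) : ℝ :=
  (2 / Real.sqrt π) * ∫ s in Ioi y, Real.exp (-s ^ 2)

open scoped Topology

/-! ### Wright series -/

/-- The Wright series `∑ (-y)^n / (n! Γ(1 - b - δ n))`. -/
noncomputable def wrightSeries (δ b y : ℝ) : ℝ :=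
  ∑' n : ℕ, (-y) ^ n / ((n.factorial : ℝ) * Real.Gamma (1 - (δ * n + b)))

theorem Mwr_eq_wrightSeries (y δ : ℝ) : Mwr y δ = wrightSeries δ δ y := by
  unfold Mwr wrightSeries
  congr 1; ext n; congr 3; ring

theorem Nwr_eq_wrightSeries (y β : ℝ) : Nwr y β = wrightSeries (2 * β) 0 y := by
  unfold Nwr wrightSeries
  congr 1; ext n; congr 3; ring

theorem one_div_Gamma_one_sub {s : ℝ} (hs : 0 < s) :
    1 / Real.Gamma (1 - s) = Real.Gamma s * Real.sin (π * s) / π := by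
  have h := Real.Gamma_mul_Gamma_one_sub s
  have hG := (Real.Gamma_pos_of_pos hs).ne'
  have : Real.Gamma (1 - s) = π / Real.sin (π * s) / Real.Gamma s := by
    field_simp at h ⊢; linarith
  rw [this, one_div, inv_div, div_div_eq_mul_div]

theorem abs_one_div_Gamma_one_sub_le {s : ℝ} (hs : 0 < s) :
    |1 / Real.Gamma (1 - s)| ≤ Real.Gamma s := by
  rw [one_div_Gamma_one_sub hs, abs_div, abs_mul, abs_of_pos (Real.Gamma_pos_of_pos hs),
    abs_of_pos pi_pos]
  have h1 := abs_sin_le_one (π * s)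
  have h2 := Real.Gamma_pos_of_pos hs
  rw [div_le_iff₀ pi_pos]
  have : (1 : ℝ) ≤ π := by linarith [pi_gt_three]
  nlinarith [abs_nonneg (sin (π * s))]

theorem Gamma_add_le {δ x : ℝ} (hδ0 : 0 < δ) (hδ1 : δ < 1) (hx : 0 < x) :
    Real.Gamma (x + δ) ≤ Real.Gamma x * x ^ δ := by
  have h := Real.Gamma_mul_add_mul_le_rpow_Gamma_mul_rpow_Gamma (s := x) (t := x + 1)
    (a := 1 - δ) (b := δ) hx (by linarith) (by linarith) hδ0 (by ring)
  have hG := Real.Gamma_pos_of_pos hx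
  rw [Real.Gamma_add_one hx.ne', mul_rpow hx.le hG.le] at h
  calc Real.Gamma (x + δ) = Real.Gamma ((1 - δ) * x + δ * (x + 1)) := by congr 1; ring
    _ ≤ _ := h
    _ = (Real.Gamma x ^ (1 - δ) * Real.Gamma x ^ δ) * x ^ δ := by ring
    _ = _ := by rw [← rpow_add hG]; simp

theorem summable_pow_div_factorial_mul_Gamma {δ b : ℝ} (hδ0 : 0 < δ) (hδ1 : δ < 1) (hb : 0 < b)
    (y : ℝ) : Summable fun n : ℕ => y ^ n / n.factorial * Real.Gamma (δ * n + b) := by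
  refine summable_of_ratio_norm_eventually_le (r := 1 / 2) (by norm_num) ?_
  have hlim : Tendsto (fun n : ℕ => |y| * (b + 1) ^ δ * ((n : ℝ) + 1) ^ (-(1 - δ))) atTop (𝓝 0) := by
    rw [← mul_zero (|y| * (b + 1) ^ δ)]
    refine Tendsto.const_mul _ ?_
    exact (tendsto_rpow_neg_atTop (by linarith : 0 < 1 - δ)).comp
      (tendsto_atTop_add_const_right _ _ tendsto_natCast_atTop_atTop)
  filter_upwards [hlim.eventually (Iio_mem_nhds (by norm_num : (0 : ℝ) < 1 / 2))] with n hn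
  have hx : 0 < δ * n + b := by positivity
  have h1 := Gamma_add_le hδ0 hδ1 hx
  have hG := Real.Gamma_pos_of_pos hx
  have hG' : 0 < Real.Gamma (δ * ((n + 1 : ℕ) : ℝ) + b) := Real.Gamma_pos_of_pos (by positivity)
  have h2 : (δ * n + b) ^ δ ≤ (b + 1) ^ δ * ((n : ℝ) + 1) ^ δ := by
    rw [← mul_rpow (by positivity) (by positivity)]
    refine rpow_le_rpow hx.le ?_ hδ0.le
    nlinarith [(Nat.cast_nonneg n : (0 : ℝ) ≤ n)]
  have h3 : ((n : ℝ) + 1) ^ δ = ((n : ℝ) + 1) ^ (-(1 - δ)) * (n + 1) := by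
    nth_rewrite 3 [← rpow_one ((n : ℝ) + 1)]
    rw [← rpow_add (by positivity)]; congr 1; ring
  have e1 : δ * ((n + 1 : ℕ) : ℝ) + b = δ * n + b + δ := by push_cast; ring
  rw [Real.norm_eq_abs, Real.norm_eq_abs, abs_mul, abs_mul, abs_of_pos hG, abs_of_pos hG', e1,
    abs_div, abs_div, abs_pow, abs_pow, Nat.abs_cast, Nat.abs_cast, Nat.factorial_succ, pow_succ]
  push_cast
  have hf : (0 : ℝ) < n.factorial := by exact_mod_cast n.factorial_pos
  calc |y| ^ n * |y| / ((n + 1) * n.factorial) * Real.Gamma (δ * n + b + δ)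
      ≤ |y| ^ n * |y| / ((n + 1) * n.factorial) *
        (Real.Gamma (δ * n + b) * ((b + 1) ^ δ * (((n : ℝ) + 1) ^ (-(1 - δ)) * (n + 1)))) := by
        rw [← h3]
        gcongr
        exact h1.trans (by gcongr)
    _ = (|y| * (b + 1) ^ δ * ((n : ℝ) + 1) ^ (-(1 - δ))) *
        (|y| ^ n / n.factorial * Real.Gamma (δ * n + b)) := by
        field_simp
    _ ≤ 1 / 2 * (|y| ^ n / n.factorial * Real.Gamma (δ * n + b)) := by
        gcongr

theorem hasDerivAt_wrightSeries {δ b : ℝ} (hδ0 : 0 < δ) (hδ1 : δ < 1) (hb : 0 ≤ b) (y : ℝ) :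
    HasDerivAt (wrightSeries δ b) (-wrightSeries δ (b + δ) y) y := by
  set R := |y| + 1
  have hR : 0 < R := by positivity
  let g : ℕ → ℝ → ℝ := fun n y => (-y) ^ n / ((n.factorial : ℝ) * Real.Gamma (1 - (δ * n + b)))
  let g' : ℕ → ℝ → ℝ := fun n y =>
    (n * (-y) ^ (n - 1) * (-1)) / ((n.factorial : ℝ) * Real.Gamma (1 - (δ * n + b)))
  let v : ℕ → ℝ := fun n => R ^ n / n.factorial * Real.Gamma (δ * n + (b + δ))
  let u : ℕ → ℝ := fun n => if n = 0 then 0 else v (n - 1)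
  have hv : Summable v := summable_pow_div_factorial_mul_Gamma hδ0 hδ1 (by positivity) R
  have hu : Summable u := by
    rw [← summable_nat_add_iff 1]
    simpa [u] using hv
  have key : ∀ (n : ℕ) (x : ℝ), g' (n + 1) x =
      -((-x) ^ n / ((n.factorial : ℝ) * Real.Gamma (1 - (δ * n + (b + δ))))) := by
    intro n x
    simp only [g', Nat.factorial_succ, Nat.add_sub_cancel]
    have : 1 - (δ * ((n + 1 : ℕ) : ℝ) + b) = 1 - (δ * n + (b + δ)) := by push_cast; ring
    rw [this, mul_assoc ((n + 1 : ℕ) : ℝ), Nat.cast_mul, mul_assoc ((n + 1 : ℕ) : ℝ),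
      mul_div_mul_left _ _ (by positivity)]
    ring
  have hd := hasDerivAt_tsum_of_isPreconnected (g := g) (g' := g') (u := u) (t := Metric.ball 0 R)
    (y₀ := 0) (y := y) hu Metric.isOpen_ball (convex_ball 0 R).isPreconnected ?_ ?_
    (by simpa using hR) ?_ (by simp [R])
  · have hs : Summable (fun n => g' n y) := by
      rw [← summable_nat_add_iff 1]
      refine Summable.of_norm_bounded hv fun n => ?_
      rw [key, norm_neg, Real.norm_eq_abs, abs_div, abs_pow, abs_neg, abs_mul, Nat.abs_cast]
      have := abs_one_div_Gamma_one_sub_le (s := δ * n + (b + δ)) (by positivity)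
      rw [abs_div, abs_one] at this
      calc |y| ^ n / (n.factorial * |Real.Gamma (1 - (δ * n + (b + δ)))|)
          = |y| ^ n / n.factorial * (1 / |Real.Gamma (1 - (δ * n + (b + δ)))|) := by
            rw [div_mul_div_comm, mul_one]
        _ ≤ _ := by
            simp only [v]; gcongr; simp [R]
    have e : ∑' n, g' n y = -wrightSeries δ (b + δ) y := by
      rw [hs.tsum_eq_zero_add]
      simp only [key, tsum_neg]
      simp [g', wrightSeries]
    rw [e] at hd
    exact hd
  · intro n x _
    have h1 : HasDerivAt (fun y : ℝ => (-y) ^ n) (n * (-x) ^ (n - 1) * (-1)) x := by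
      exact (hasDerivAt_neg x).fun_pow n
    exact h1.div_const _
  · intro n x hx
    rcases n with _ | n
    · simp [g', u]
    · rw [key, norm_neg, Real.norm_eq_abs, abs_div, abs_pow, abs_neg, abs_mul, Nat.abs_cast]
      have := abs_one_div_Gamma_one_sub_le (s := δ * n + (b + δ)) (by positivity)
      rw [abs_div, abs_one] at this
      calc |x| ^ n / (n.factorial * |Real.Gamma (1 - (δ * n + (b + δ)))|)
          = |x| ^ n / n.factorial * (1 / |Real.Gamma (1 - (δ * n + (b + δ)))|) := by
            rw [div_mul_div_comm, mul_one]
        _ ≤ _ := by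
            simp only [v, u, Nat.add_sub_cancel]
            rw [if_neg (by simp)]
            have : |x| ≤ R := by simpa using (mem_ball_zero_iff.1 hx).le
            gcongr
  · refine summable_of_ne_finset_zero (s := {0}) fun n hn => ?_
    have : n ≠ 0 := by simpa using hn
    simp [g, this]

theorem continuous_wrightSeries {δ b : ℝ} (hδ0 : 0 < δ) (hδ1 : δ < 1) (hb : 0 ≤ b) :
    Continuous (wrightSeries δ b) :=
  continuous_iff_continuousAt.2 fun y => (hasDerivAt_wrightSeries hδ0 hδ1 hb y).continuousAt

theorem wrightSeries_zero_zero (δ : ℝ) : wrightSeries δ 0 0 = 1 := by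
  unfold wrightSeries
  rw [tsum_eq_single 0]
  · simp
  · intro n hn; simp [hn]

theorem wrightSeries_one_eq {δ : ℝ} (hδ0 : 0 < δ) (hδ1 : δ < 1) (y : ℝ) :
    wrightSeries δ 1 y = δ * y * wrightSeries δ δ y := by
  have hs : Summable fun n : ℕ =>
      (-y) ^ n / ((n.factorial : ℝ) * Real.Gamma (1 - (δ * n + 1))) := by
    refine Summable.of_norm_bounded
      (summable_pow_div_factorial_mul_Gamma hδ0 hδ1 one_pos |y|) fun n => ?_
    have := abs_one_div_Gamma_one_sub_le (s := δ * n + 1) (by positivity)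
    rw [abs_div, abs_one] at this
    rw [Real.norm_eq_abs, abs_div, abs_pow, abs_neg, abs_mul, Nat.abs_cast]
    calc |y| ^ n / (n.factorial * |Real.Gamma (1 - (δ * n + 1))|)
        = |y| ^ n / n.factorial * (1 / |Real.Gamma (1 - (δ * n + 1))|) := by
          rw [div_mul_div_comm, mul_one]
      _ ≤ _ := by gcongr
  unfold wrightSeries
  rw [hs.tsum_eq_zero_add, ← tsum_mul_left]
  simp only [pow_zero, Nat.factorial_zero, Nat.cast_one, Nat.cast_zero, mul_zero, zero_add, sub_self,
    Real.Gamma_zero, div_zero]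
  congr 1; ext n
  have e1 : 1 - (δ * ((n + 1 : ℕ) : ℝ) + 1) = -(δ * (n + 1)) := by push_cast; ring
  have e2 : 1 - (δ * n + δ) = -(δ * (n + 1)) + 1 := by ring
  have hne : -(δ * ((n : ℝ) + 1)) ≠ 0 := by
    have : 0 < δ * ((n : ℝ) + 1) := by positivity
    linarith
  rw [e1, e2, Real.Gamma_add_one hne, pow_succ, Nat.factorial_succ]
  push_cast
  by_cases hG : Real.Gamma (-(δ * ((n : ℝ) + 1))) = 0
  · simp [hG]
  · have : (n.factorial : ℝ) ≠ 0 := by positivity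
    have h1 : (n : ℝ) + 1 ≠ 0 := by positivity
    field_simp

/-! ### Complex Gamma-type integrals -/

theorem integrableOn_rpow_mul_exp_neg_mul {q c : ℝ} (hq : -1 < q) (hc : 0 < c) :
    IntegrableOn (fun r : ℝ => r ^ q * Real.exp (-(c * r))) (Ioi 0) := by
  have := integrableOn_rpow_mul_exp_neg_mul_rpow (p := 1) hq one_pos hc
  simpa using this

theorem norm_cexp_neg_mul_ofReal (ζ : ℂ) (r : ℝ) :
    ‖Complex.exp (-(ζ * r))‖ = Real.exp (-(ζ.re * r)) := by
  rw [Complex.norm_exp]; simp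

theorem aestronglyMeasurable_rpow_mul {q : ℝ} {f : ℝ → ℂ} (hf : Continuous f) :
    AEStronglyMeasurable (fun r : ℝ => ((r ^ q : ℝ) : ℂ) * f r) (volume.restrict (Ioi 0)) := by
  refine ContinuousOn.aestronglyMeasurable ?_ measurableSet_Ioi
  refine ContinuousOn.mul ?_ hf.continuousOn
  refine Complex.continuous_ofReal.comp_continuousOn ?_
  exact fun r hr => (continuousAt_rpow_const r q (Or.inl (ne_of_gt hr))).continuousWithinAt

theorem integrableOn_rpow_mul_cexp {q : ℝ} (hq : -1 < q) {ζ : ℂ} (hζ : 0 < ζ.re) :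
    IntegrableOn (fun r : ℝ => ((r ^ q : ℝ) : ℂ) * Complex.exp (-(ζ * r))) (Ioi 0) := by
  refine Integrable.mono' (integrableOn_rpow_mul_exp_neg_mul hq hζ)
    (aestronglyMeasurable_rpow_mul (by fun_prop)) ?_
  filter_upwards [ae_restrict_mem measurableSet_Ioi] with r hr
  rw [norm_mul, norm_cexp_neg_mul_ofReal, Complex.norm_real, Real.norm_eq_abs,
    abs_of_nonneg (rpow_nonneg (le_of_lt hr) _)]

theorem integral_rpow_mul_cexp_neg_mul {s : ℝ} (hs : 0 < s) {ζ : ℂ} (hζ : 0 < ζ.re) :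
    ∫ r in Ioi (0 : ℝ), ((r ^ (s - 1) : ℝ) : ℂ) * Complex.exp (-(ζ * r)) =
      ζ ^ (-(s : ℂ)) * (Real.Gamma s : ℂ) := by
  set f : ℂ → ℂ := fun ζ => ∫ r in Ioi (0 : ℝ), ((r ^ (s - 1) : ℝ) : ℂ) * Complex.exp (-(ζ * r))
  set g : ℂ → ℂ := fun ζ => ζ ^ (-(s : ℂ)) * (Real.Gamma s : ℂ)
  let U : Set ℂ := {z | 0 < z.re}
  have hU : IsOpen U := isOpen_lt continuous_const Complex.continuous_re
  have hUc : IsPreconnected U := (convex_halfSpace_re_gt 0).isPreconnected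
  have hf : DifferentiableOn ℂ f U := by
    intro z hz
    have hz' : 0 < z.re / 2 := half_pos hz
    have h := hasDerivAt_integral_of_dominated_loc_of_deriv_le
      (μ := volume.restrict (Ioi (0 : ℝ)))
      (F := fun ζ r => ((r ^ (s - 1) : ℝ) : ℂ) * Complex.exp (-(ζ * r)))
      (F' := fun ζ (r : ℝ) => ((r ^ (s - 1) : ℝ) : ℂ) * (Complex.exp (-(ζ * r)) * (-r)))
      (bound := fun r => r ^ s * Real.exp (-(z.re / 2 * r)))
      (Metric.ball_mem_nhds z hz')
      (Eventually.of_forall fun ζ => aestronglyMeasurable_rpow_mul (by fun_prop))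
      (integrableOn_rpow_mul_cexp (by linarith) hz)
      (aestronglyMeasurable_rpow_mul (by fun_prop)) ?_
      (integrableOn_rpow_mul_exp_neg_mul (by linarith) hz') ?_
    · exact h.2.differentiableAt.differentiableWithinAt
    · filter_upwards [ae_restrict_mem measurableSet_Ioi] with r hr ζ hζ
      have hr : 0 < r := hr
      rw [norm_mul, norm_mul, norm_cexp_neg_mul_ofReal, Complex.norm_real, Real.norm_eq_abs,
        abs_of_nonneg (rpow_nonneg hr.le _), norm_neg, Complex.norm_real, Real.norm_eq_abs,
        abs_of_pos hr]
      have h1 : r ^ s = r ^ (s - 1) * r := by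
        nth_rewrite 3 [← rpow_one r]
        rw [← rpow_add hr]; congr 1; ring
      have h2 : z.re / 2 ≤ ζ.re := by
        have := (Complex.abs_re_le_norm (ζ - z)).trans_lt (mem_ball_iff_norm.1 hζ)
        rw [Complex.sub_re, abs_lt] at this
        linarith
      rw [h1]
      calc r ^ (s - 1) * (rexp (-(ζ.re * r)) * r) = r ^ (s - 1) * r * rexp (-(ζ.re * r)) := by ring
        _ ≤ _ := by gcongr
    · filter_upwards with r ζ _
      have h1 : HasDerivAt (fun ζ : ℂ => -(ζ * (r : ℂ))) (-(1 * (r : ℂ))) ζ :=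
        ((hasDerivAt_id ζ).mul_const (r : ℂ)).neg
      have h2 := (h1.cexp).const_mul ((r ^ (s - 1) : ℝ) : ℂ)
      simpa using h2
  have hg : DifferentiableOn ℂ g U := by
    intro z hz
    have : z ∈ Complex.slitPlane := Or.inl hz
    have h1 := ((hasDerivAt_id z).cpow_const (c := -(s : ℂ)) this).mul_const (Real.Gamma s : ℂ)
    exact h1.differentiableAt.differentiableWithinAt
  have hreal : ∀ x : ℝ, 0 < x → f x = g x := by
    intro x hx
    have h := Real.integral_rpow_mul_exp_neg_mul_Ioi hs hx
    have h' : f x = ((∫ r in Ioi (0 : ℝ), r ^ (s - 1) * Real.exp (-(x * r)) : ℝ) : ℂ) := by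
      refine Eq.trans ?_ integral_ofReal
      simp only [f]
      congr 1; ext r; simp
    rw [h', h]
    simp only [g]
    rw [one_div, Real.inv_rpow hx.le, ← Real.rpow_neg hx.le]
    push_cast
    rw [Complex.ofReal_cpow hx.le]; push_cast; rfl
  have := (hf.analyticOnNhd hU).eqOn_of_preconnected_of_frequently_eq (hg.analyticOnNhd hU) hUc
    (z₀ := 1) (by simp [U]) ?_
  · exact this hζ
  · have hseq : Tendsto (fun n : ℕ => ((1 + 1 / ((n : ℝ) + 1) : ℝ) : ℂ)) atTop (𝓝[≠] 1) := by
      refine tendsto_nhdsWithin_iff.2 ⟨?_, ?_⟩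
      · have h1 := (tendsto_one_div_add_atTop_nhds_zero_nat (𝕜 := ℝ)).const_add 1
        rw [add_zero] at h1
        have := (Complex.continuous_ofReal.tendsto 1).comp h1
        rw [Complex.ofReal_one] at this
        exact this
      · filter_upwards with n
        have : (1 : ℝ) / ((n : ℝ) + 1) ≠ 0 := by positivity
        simp only [mem_compl_iff, mem_singleton_iff]
        rw [show (1 : ℂ) = ((1 : ℝ) : ℂ) by simp, Complex.ofReal_inj]
        simpa using this
    exact hseq.frequently (Frequently.of_forall fun n => hreal _ (by positivity))

theorem hasSum_integral_rpow_mul_cexp {δ b : ℝ} (hδ0 : 0 < δ) (hδ1 : δ < 1) (hb : 0 < b)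
    {ζ : ℂ} (hζ : 0 < ζ.re) (ω : ℂ) :
    HasSum (fun n : ℕ => (-ω) ^ n / (n.factorial : ℂ) *
        (ζ ^ (-((δ * n + b : ℝ) : ℂ)) * (Real.Gamma (δ * n + b) : ℂ)))
      (∫ r in Ioi (0 : ℝ), ((r ^ (b - 1) : ℝ) : ℂ) *
        (Complex.exp (-(ζ * r)) * Complex.exp (-(ω * ((r ^ δ : ℝ) : ℂ))))) := by
  have hs : ∀ n : ℕ, 0 < δ * n + b := fun n => by positivity
  let F : ℕ → ℝ → ℂ := fun n r => (-ω) ^ n / (n.factorial : ℂ) *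
    (((r ^ (δ * n + b - 1) : ℝ) : ℂ) * Complex.exp (-(ζ * r)))
  have hInt : ∀ n, Integrable (F n) (volume.restrict (Ioi 0)) := fun n =>
    (integrableOn_rpow_mul_cexp (by linarith [hs n]) hζ).const_mul _
  have hnorm : ∀ n, ∫ r in Ioi (0 : ℝ), ‖F n r‖ =
      ζ.re ^ (-b) * ((‖ω‖ * ζ.re ^ (-δ)) ^ n / n.factorial * Real.Gamma (δ * n + b)) := by
    intro n
    have : ∫ r in Ioi (0 : ℝ), ‖F n r‖ = ∫ r in Ioi (0 : ℝ), ‖ω‖ ^ n / n.factorial *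
        (r ^ (δ * n + b - 1) * Real.exp (-(ζ.re * r))) := by
      refine setIntegral_congr_fun measurableSet_Ioi fun r hr => ?_
      simp only [F]
      rw [norm_mul, norm_mul, norm_cexp_neg_mul_ofReal, Complex.norm_real, Real.norm_eq_abs,
        abs_of_nonneg (rpow_nonneg (le_of_lt hr) _), norm_div, norm_pow, norm_neg,
        Complex.norm_natCast]
    rw [this, integral_const_mul, Real.integral_rpow_mul_exp_neg_mul_Ioi (hs n) hζ, one_div,
      Real.inv_rpow hζ.le, ← Real.rpow_neg hζ.le, mul_pow, ← Real.rpow_natCast (ζ.re ^ (-δ)),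
      ← Real.rpow_mul hζ.le, neg_add, Real.rpow_add hζ]
    rw [neg_mul]
    ring
  have h := hasSum_integral_of_summable_integral_norm hInt (by
    simp only [hnorm]
    exact (summable_pow_div_factorial_mul_Gamma hδ0 hδ1 hb _).mul_left _)
  have e1 : (fun n => ∫ r in Ioi (0 : ℝ), F n r) = fun n : ℕ => (-ω) ^ n / (n.factorial : ℂ) *
        (ζ ^ (-((δ * n + b : ℝ) : ℂ)) * (Real.Gamma (δ * n + b) : ℂ)) := by
    ext n
    simp only [F]
    rw [integral_const_mul, integral_rpow_mul_cexp_neg_mul (hs n) hζ]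
  have e2 : ∫ r in Ioi (0 : ℝ), ∑' n, F n r = ∫ r in Ioi (0 : ℝ), ((r ^ (b - 1) : ℝ) : ℂ) *
        (Complex.exp (-(ζ * r)) * Complex.exp (-(ω * ((r ^ δ : ℝ) : ℂ)))) := by
    refine setIntegral_congr_fun measurableSet_Ioi fun r hr => ?_
    have hr : 0 < r := hr
    have hexp : HasSum (fun n : ℕ => (-(ω * ((r ^ δ : ℝ) : ℂ))) ^ n / (n.factorial : ℂ))
        (Complex.exp (-(ω * ((r ^ δ : ℝ) : ℂ)))) := by
      rw [Complex.exp_eq_exp_ℂ]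
      exact NormedSpace.expSeries_div_hasSum_exp _
    have := (hexp.mul_left (((r ^ (b - 1) : ℝ) : ℂ) * Complex.exp (-(ζ * r)))).tsum_eq
    rw [mul_assoc] at this
    rw [← this]
    refine tsum_congr fun n => ?_
    simp only [F]
    have : r ^ (δ * n + b - 1) = r ^ (b - 1) * (r ^ δ) ^ n := by
      rw [← Real.rpow_natCast, ← Real.rpow_mul hr.le, ← Real.rpow_add hr]; congr 1; ring
    rw [this, neg_mul_eq_neg_mul ω, mul_pow]
    push_cast
    ring
  rw [e1, e2] at h
  exact h

theorem integrableOn_rpow_mul_exp_neg_mul_rpow_of_pos {δ b c : ℝ} (hδ : 0 < δ) (hb : 0 < b)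
    (hc : 0 < c) :
    IntegrableOn (fun r : ℝ => r ^ (b - 1) * Real.exp (-(c * r ^ δ))) (Ioi 0) := by
  have := integrableOn_rpow_mul_exp_neg_mul_rpow (p := δ) (s := b - 1) (by linarith) hδ hc
  simpa using this

theorem integral_rpow_mul_cexp_I_mul {δ b t : ℝ} (hδ0 : 0 < δ) (hδ1 : δ < 1) (hb : 0 < b)
    (ht : t ≠ 0) {ω : ℂ} (hω : 0 < ω.re) :
    ∫ r in Ioi (0 : ℝ), ((r ^ (b - 1) : ℝ) : ℂ) *
        (Complex.exp (Complex.I * t * r) * Complex.exp (-(ω * ((r ^ δ : ℝ) : ℂ)))) =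
    ∑' n : ℕ, (-ω) ^ n / (n.factorial : ℂ) *
        ((-(Complex.I * t)) ^ (-((δ * n + b : ℝ) : ℂ)) * (Real.Gamma (δ * n + b) : ℂ)) := by
  have hs : ∀ n : ℕ, 0 < δ * n + b := fun n => by positivity
  let ζ : ℝ → ℂ := fun ε => ε - Complex.I * t
  have hζ : Continuous ζ := by simp only [ζ]; fun_prop
  have hζ0 : ζ 0 = -(Complex.I * t) := by simp [ζ]
  have hnear : ∀ ε : ℝ, |t| ≤ ‖ζ ε‖ := fun ε => by
    have := Complex.abs_im_le_norm (ζ ε)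
    simpa [ζ] using this
  have hL : Tendsto (fun ε => ∫ r in Ioi (0 : ℝ), ((r ^ (b - 1) : ℝ) : ℂ) *
        (Complex.exp (-(ζ ε * r)) * Complex.exp (-(ω * ((r ^ δ : ℝ) : ℂ))))) (𝓝[>] 0)
      (𝓝 (∫ r in Ioi (0 : ℝ), ((r ^ (b - 1) : ℝ) : ℂ) *
        (Complex.exp (Complex.I * t * r) * Complex.exp (-(ω * ((r ^ δ : ℝ) : ℂ)))))) := by
    refine tendsto_integral_filter_of_dominated_convergence
      (fun r => r ^ (b - 1) * Real.exp (-(ω.re * r ^ δ))) ?_ ?_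
      (integrableOn_rpow_mul_exp_neg_mul_rpow_of_pos hδ0 hb hω) ?_
    · refine Eventually.of_forall fun ε => aestronglyMeasurable_rpow_mul ?_
      have : Continuous fun r : ℝ => r ^ δ := continuous_rpow_const hδ0.le
      fun_prop
    · filter_upwards [self_mem_nhdsWithin] with ε hε
      filter_upwards [ae_restrict_mem measurableSet_Ioi] with r hr
      have hr : 0 < r := hr
      have hε : 0 < ε := hε
      rw [norm_mul, norm_mul, norm_cexp_neg_mul_ofReal, norm_cexp_neg_mul_ofReal,
        Complex.norm_real, Real.norm_eq_abs, abs_of_nonneg (rpow_nonneg hr.le _)]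
      have : rexp (-((ζ ε).re * r)) ≤ 1 := by
        rw [Real.exp_le_one_iff]; simp [ζ]; positivity
      gcongr
      nlinarith [Real.exp_pos (-(ω.re * r ^ δ))]
    · filter_upwards with r
      refine Tendsto.mono_left ?_ nhdsWithin_le_nhds
      have : Continuous fun ε => ((r ^ (b - 1) : ℝ) : ℂ) *
        (Complex.exp (-(ζ ε * r)) * Complex.exp (-(ω * ((r ^ δ : ℝ) : ℂ)))) := by fun_prop
      have h := this.tendsto 0
      rw [hζ0] at h
      simpa using h
  have hR : Tendsto (fun ε => ∑' n : ℕ, (-ω) ^ n / (n.factorial : ℂ) *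
        ((ζ ε) ^ (-((δ * n + b : ℝ) : ℂ)) * (Real.Gamma (δ * n + b) : ℂ))) (𝓝[>] 0)
      (𝓝 (∑' n : ℕ, (-ω) ^ n / (n.factorial : ℂ) *
        ((-(Complex.I * t)) ^ (-((δ * n + b : ℝ) : ℂ)) * (Real.Gamma (δ * n + b) : ℂ)))) := by
    refine tendsto_tsum_of_dominated_convergence
      (bound := fun n : ℕ => |t| ^ (-b) *
        ((‖ω‖ * |t| ^ (-δ)) ^ n / n.factorial * Real.Gamma (δ * n + b)))
      ((summable_pow_div_factorial_mul_Gamma hδ0 hδ1 hb _).mul_left _) ?_ ?_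
    · intro n
      refine Tendsto.mono_left ?_ nhdsWithin_le_nhds
      rw [← hζ0]
      refine Tendsto.const_mul _ (Tendsto.mul_const _ ?_)
      refine (hζ.tendsto 0).cpow tendsto_const_nhds ?_
      right
      simpa [ζ] using ht
    · refine Eventually.of_forall fun ε n => ?_
      have ht' : 0 < |t| := abs_pos.2 ht
      rw [norm_mul, norm_mul, norm_div, norm_pow, norm_neg, Complex.norm_natCast,
        Complex.norm_real, Real.norm_eq_abs, abs_of_pos (Real.Gamma_pos_of_pos (hs n)),
        ← Complex.ofReal_neg, Complex.norm_cpow_real]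
      have h1 : ‖ζ ε‖ ^ (-(δ * n + b)) ≤ |t| ^ (-(δ * n + b)) :=
        Real.rpow_le_rpow_of_nonpos ht' (hnear ε) (by linarith [hs n])
      have h2 : |t| ^ (-(δ * n + b)) = |t| ^ (-b) * (|t| ^ (-δ)) ^ n := by
        rw [← Real.rpow_natCast, ← Real.rpow_mul ht'.le, ← Real.rpow_add ht']; congr 1; ring
      have hG := Real.Gamma_pos_of_pos (hs n)
      calc _ ≤ ‖ω‖ ^ n / n.factorial * (|t| ^ (-(δ * n + b)) * Real.Gamma (δ * n + b)) := by
            gcongr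
        _ = _ := by rw [h2]; ring
  refine tendsto_nhds_unique hL (hR.congr' ?_)
  filter_upwards [self_mem_nhdsWithin] with ε hε
  exact (hasSum_integral_rpow_mul_cexp hδ0 hδ1 hb (ζ := ζ ε) (by simpa [ζ] using hε) ω).tsum_eq

/-! ### The Fourier representation of one-sided stable densities -/

theorem cpow_mul_ofReal_of_pos {x : ℂ} (hx : x ≠ 0) {r : ℝ} (hr : 0 < r) (c : ℝ) :
    (x * r) ^ (c : ℂ) = ((r ^ c : ℝ) : ℂ) * x ^ (c : ℂ) := by
  have hr' : (r : ℂ) ≠ 0 := by exact_mod_cast hr.ne'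
  rw [Complex.cpow_def_of_ne_zero (mul_ne_zero hx hr'), Complex.cpow_def_of_ne_zero hx,
    Complex.log_mul_ofReal r hr x hx, Real.rpow_def_of_pos hr, Complex.ofReal_exp, ← Complex.exp_add]
  congr 1; push_cast; ring

theorem I_cpow (c : ℂ) : Complex.I ^ c = Complex.exp (π / 2 * c * Complex.I) := by
  rw [Complex.cpow_def_of_ne_zero Complex.I_ne_zero, Complex.log_I]
  congr 1; ring

theorem neg_I_cpow (c : ℂ) : (-Complex.I) ^ c = Complex.exp (-(π / 2 * c * Complex.I)) := by
  rw [Complex.cpow_def_of_ne_zero (neg_ne_zero.2 Complex.I_ne_zero), Complex.log_neg_I]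
  congr 1; ring

theorem re_I_cpow (c : ℝ) : (Complex.I ^ (c : ℂ)).re = Real.cos (π / 2 * c) := by
  rw [I_cpow, ← Complex.ofReal_ofNat, ← Complex.ofReal_div, ← Complex.ofReal_mul,
    Complex.exp_ofReal_mul_I_re]

theorem norm_I_cpow (c : ℝ) : ‖Complex.I ^ (c : ℂ)‖ = 1 := by
  rw [Complex.norm_cpow_real]; simp

theorem cos_pi_div_two_mul_pos {δ : ℝ} (hδ0 : 0 < δ) (hδ1 : δ < 1) : 0 < Real.cos (π / 2 * δ) := by
  apply Real.cos_pos_of_mem_Ioo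
  constructor <;> nlinarith [pi_pos]

/-- The characteristic exponential `exp (-w (i r)^δ)` of the one-sided `δ`-stable law. -/
noncomputable def stableSymbol (δ w r : ℝ) : ℂ :=
  Complex.exp (-(w * (Complex.I * r) ^ (δ : ℂ)))

/-- The integrand `(i r)^(b-1) exp (-w (i r)^δ)`. -/
noncomputable def stableIntegrand (δ b w r : ℝ) : ℂ :=
  (Complex.I * r) ^ ((b - 1 : ℝ) : ℂ) * stableSymbol δ w r

theorem stableIntegrand_of_pos {δ b w r : ℝ} (hr : 0 < r) :
    stableIntegrand δ b w r = Complex.I ^ ((b - 1 : ℝ) : ℂ) * (((r ^ (b - 1) : ℝ) : ℂ) *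
      Complex.exp (-(w * Complex.I ^ (δ : ℂ) * ((r ^ δ : ℝ) : ℂ)))) := by
  unfold stableIntegrand stableSymbol
  rw [cpow_mul_ofReal_of_pos Complex.I_ne_zero hr, cpow_mul_ofReal_of_pos Complex.I_ne_zero hr]
  rw [show (w : ℂ) * Complex.I ^ (δ : ℂ) * ((r ^ δ : ℝ) : ℂ) =
    w * (((r ^ δ : ℝ) : ℂ) * Complex.I ^ (δ : ℂ)) by ring]
  ring

theorem I_mul_neg_cpow {r : ℝ} (hr : 0 < r) (c : ℝ) :
    (Complex.I * ((-r : ℝ) : ℂ)) ^ (c : ℂ) =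
      (starRingEnd ℂ) ((Complex.I * r) ^ (c : ℂ)) := by
  have h1 : Complex.I * ((-r : ℝ) : ℂ) = -Complex.I * r := by push_cast; ring
  rw [h1, cpow_mul_ofReal_of_pos (neg_ne_zero.2 Complex.I_ne_zero) hr,
    cpow_mul_ofReal_of_pos Complex.I_ne_zero hr, neg_I_cpow, I_cpow, map_mul, ← Complex.exp_conj]
  simp [Complex.conj_ofNat]

theorem stableIntegrand_neg {δ b w r : ℝ} (hr : 0 < r) :
    stableIntegrand δ b w (-r) = (starRingEnd ℂ) (stableIntegrand δ b w r) := by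
  unfold stableIntegrand stableSymbol
  rw [I_mul_neg_cpow hr, I_mul_neg_cpow hr, map_mul, ← Complex.exp_conj]
  simp

theorem norm_stableIntegrand_of_pos {δ b w r : ℝ} (hr : 0 < r) :
    ‖stableIntegrand δ b w r‖ =
      r ^ (b - 1) * Real.exp (-(w * Real.cos (π / 2 * δ) * r ^ δ)) := by
  rw [stableIntegrand_of_pos hr, norm_mul, norm_I_cpow, one_mul, norm_mul,
    norm_cexp_neg_mul_ofReal, Complex.re_ofReal_mul, re_I_cpow, Complex.norm_real,
    Real.norm_of_nonneg (rpow_nonneg hr.le _)]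

theorem continuous_stableSymbol {δ : ℝ} (hδ0 : 0 < δ) (w : ℝ) : Continuous (stableSymbol δ w) := by
  unfold stableSymbol
  have : Continuous fun r : ℝ => (Complex.I * r) ^ (δ : ℂ) := by
    rw [continuous_iff_continuousAt]
    intro r
    have h1 : ContinuousAt (fun z : ℂ => z ^ (δ : ℂ)) (Complex.I * r) :=
      Complex.continuousAt_cpow_const_of_re_pos (by left; simp) (by simpa using hδ0)
    exact h1.comp (f := fun r : ℝ => Complex.I * (r : ℂ)) (by fun_prop)
  fun_prop

theorem stableIntegrand_one (δ w r : ℝ) : stableIntegrand δ 1 w r = stableSymbol δ w r := by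
  simp [stableIntegrand]

theorem aestronglyMeasurable_stableIntegrand {δ : ℝ} (hδ0 : 0 < δ) (b w : ℝ) :
    AEStronglyMeasurable (stableIntegrand δ b w) volume := by
  unfold stableIntegrand
  refine AEStronglyMeasurable.mul ?_ (continuous_stableSymbol hδ0 w).aestronglyMeasurable
  exact (Measurable.pow_const (by fun_prop) _).aestronglyMeasurable

theorem integrable_of_integrableOn_Ioi_of_norm_neg {f : ℝ → ℂ} (hf : IntegrableOn f (Ioi 0))
    (hm : AEStronglyMeasurable f volume) (hneg : ∀ r, 0 < r → ‖f (-r)‖ = ‖f r‖) :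
    Integrable f := by
  rw [← integrableOn_univ, ← Iic_union_Ioi (a := (0 : ℝ))]
  refine IntegrableOn.union ?_ hf
  rw [integrableOn_Iic_iff_integrableOn_Iio]
  have key : IntegrableOn (fun r => f (-r)) (Ioi 0) := ?_
  · simpa using key.comp_neg
  refine Integrable.mono hf (hm.comp_measurePreserving (Measure.measurePreserving_neg volume)).restrict ?_
  filter_upwards [ae_restrict_mem measurableSet_Ioi] with r hr
  exact (hneg r hr).le

theorem integrable_stableIntegrand {δ b w : ℝ} (hδ0 : 0 < δ) (hδ1 : δ < 1) (hb : 0 < b)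
    (hw : 0 < w) : Integrable (stableIntegrand δ b w) := by
  refine integrable_of_integrableOn_Ioi_of_norm_neg ?_
    (aestronglyMeasurable_stableIntegrand hδ0 b w) fun r hr => by
      rw [stableIntegrand_neg hr, RCLike.norm_conj]
  refine Integrable.mono' (integrableOn_rpow_mul_exp_neg_mul_rpow_of_pos hδ0 hb
    (mul_pos hw (cos_pi_div_two_mul_pos hδ0 hδ1)))
    (aestronglyMeasurable_stableIntegrand hδ0 b w).restrict ?_
  filter_upwards [ae_restrict_mem measurableSet_Ioi] with r hr
  exact (norm_stableIntegrand_of_pos hr).le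

/-- The inverse Fourier transform of `(i r)^(b-1) exp (-w (i r)^δ)`. -/
noncomputable def stableKernel (δ b w t : ℝ) : ℂ :=
  (1 / (2 * π) : ℝ) * ∫ r : ℝ, Complex.exp (Complex.I * t * r) * stableIntegrand δ b w r

theorem norm_cexp_I_mul (t r : ℝ) : ‖Complex.exp (Complex.I * t * r)‖ = 1 := by
  rw [Complex.norm_exp]; simp

theorem integrable_cexp_mul_stableIntegrand {δ b w : ℝ} (hδ0 : 0 < δ) (hδ1 : δ < 1) (hb : 0 < b)
    (hw : 0 < w) (t : ℝ) :
    Integrable fun r : ℝ => Complex.exp (Complex.I * t * r) * stableIntegrand δ b w r := by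
  refine (integrable_stableIntegrand hδ0 hδ1 hb hw).mono ?_ ?_
  · exact (Continuous.aestronglyMeasurable (by fun_prop)).mul
      (aestronglyMeasurable_stableIntegrand hδ0 b w)
  · filter_upwards with r
    rw [norm_mul, norm_cexp_I_mul, one_mul]

theorem stableKernel_eq_re {δ b w : ℝ} (hδ0 : 0 < δ) (hδ1 : δ < 1) (hb : 0 < b) (hw : 0 < w)
    (t : ℝ) : stableKernel δ b w t = ((1 / π * (∫ r in Ioi (0 : ℝ),
      Complex.exp (Complex.I * t * r) * stableIntegrand δ b w r).re : ℝ) : ℂ) := by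
  have hInt := integrable_cexp_mul_stableIntegrand hδ0 hδ1 hb hw t
  unfold stableKernel
  rw [← integral_add_compl (s := Ioi (0 : ℝ)) measurableSet_Ioi hInt, compl_Ioi]
  have : ∫ r in Iic (0 : ℝ), Complex.exp (Complex.I * t * r) * stableIntegrand δ b w r =
      (starRingEnd ℂ) (∫ r in Ioi (0 : ℝ),
        Complex.exp (Complex.I * t * r) * stableIntegrand δ b w r) := by
    rw [← integral_conj, ← neg_zero, ← integral_comp_neg_Ioi, neg_zero]
    refine setIntegral_congr_fun measurableSet_Ioi fun r hr => ?_
    rw [stableIntegrand_neg hr, map_mul, ← Complex.exp_conj]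
    simp
  rw [this, Complex.add_conj]
  push_cast
  field_simp

theorem integral_Ioi_stableIntegrand {δ b w t : ℝ} (hδ0 : 0 < δ) (hδ1 : δ < 1) (hb : 0 < b)
    (hw : 0 < w) (ht : t ≠ 0) :
    ∫ r in Ioi (0 : ℝ), Complex.exp (Complex.I * t * r) * stableIntegrand δ b w r =
      ∑' n : ℕ, Complex.I ^ ((b - 1 : ℝ) : ℂ) * ((-(w * Complex.I ^ (δ : ℂ))) ^ n / (n.factorial : ℂ) *
        ((-(Complex.I * t)) ^ (-((δ * n + b : ℝ) : ℂ)) * (Real.Gamma (δ * n + b) : ℂ))) := by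
  rw [tsum_mul_left, ← integral_rpow_mul_cexp_I_mul hδ0 hδ1 hb ht (ω := w * Complex.I ^ (δ : ℂ))
    (by rw [Complex.re_ofReal_mul, re_I_cpow]; exact mul_pos hw (cos_pi_div_two_mul_pos hδ0 hδ1)),
    ← integral_const_mul]
  refine setIntegral_congr_fun measurableSet_Ioi fun r hr => ?_
  rw [stableIntegrand_of_pos hr]
  ring

theorem I_cpow_phase (δ b : ℝ) (n : ℕ) :
    Complex.I ^ ((b - 1 : ℝ) : ℂ) * (Complex.I ^ (δ : ℂ)) ^ n =
      -Complex.I * Complex.exp (π / 2 * (δ * n + b) * Complex.I) := by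
  rw [I_cpow, I_cpow, ← Complex.exp_nat_mul, ← Complex.exp_add]
  have : -Complex.I = Complex.exp (-(π / 2) * Complex.I) := by
    rw [neg_mul, Complex.exp_neg, Complex.exp_pi_div_two_mul_I, Complex.inv_I]
  rw [this, ← Complex.exp_add]
  congr 1; push_cast; ring

theorem stableKernel_of_pos {δ b w t : ℝ} (hδ0 : 0 < δ) (hδ1 : δ < 1) (hb : 0 < b) (hw : 0 < w)
    (ht : 0 < t) :
    stableKernel δ b w t = ((t ^ (-b) * wrightSeries δ b (w * t ^ (-δ)) : ℝ) : ℂ) := by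
  rw [stableKernel_eq_re hδ0 hδ1 hb hw, integral_Ioi_stableIntegrand hδ0 hδ1 hb hw ht.ne']
  congr 1
  have hs : ∀ n : ℕ, 0 < δ * n + b := fun n => by positivity
  have hterm : ∀ n : ℕ, Complex.I ^ ((b - 1 : ℝ) : ℂ) *
      ((-(w * Complex.I ^ (δ : ℂ))) ^ n / (n.factorial : ℂ) *
        ((-(Complex.I * t)) ^ (-((δ * n + b : ℝ) : ℂ)) * (Real.Gamma (δ * n + b) : ℂ))) =
      (((-w) ^ n / n.factorial * t ^ (-(δ * n + b)) * Real.Gamma (δ * n + b) : ℝ) : ℂ) *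
        (-Complex.I * Complex.exp (((π * (δ * n + b) : ℝ) : ℂ) * Complex.I)) := by
    intro n
    rw [neg_mul_eq_neg_mul Complex.I, ← Complex.ofReal_neg,
      cpow_mul_ofReal_of_pos (neg_ne_zero.2 Complex.I_ne_zero) ht, neg_I_cpow,
      neg_mul_eq_neg_mul (w : ℂ), mul_pow]
    have h1 := I_cpow_phase δ b n
    have h2 : Complex.exp (((π * (δ * n + b) : ℝ) : ℂ) * Complex.I) =
        Complex.exp (π / 2 * (δ * n + b) * Complex.I) *
          Complex.exp (-(π / 2 * ((-(δ * n + b) : ℝ) : ℂ) * Complex.I)) := by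
      rw [← Complex.exp_add]; congr 1; push_cast; ring
    rw [h2, ← mul_assoc (-Complex.I), ← h1]
    push_cast
    ring
  simp only [hterm]
  have hre : ∀ n : ℕ, ((((-w) ^ n / n.factorial * t ^ (-(δ * n + b)) * Real.Gamma (δ * n + b) : ℝ) : ℂ) *
        (-Complex.I * Complex.exp (((π * (δ * n + b) : ℝ) : ℂ) * Complex.I))).re =
      π * (t ^ (-b) * ((-(w * t ^ (-δ))) ^ n /
        ((n.factorial : ℝ) * Real.Gamma (1 - (δ * n + b))))) := by
    intro n
    have h3 : (-Complex.I * Complex.exp (((π * (δ * n + b) : ℝ) : ℂ) * Complex.I)).re =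
        Real.sin (π * (δ * n + b)) := by
      rw [neg_mul, Complex.neg_re, Complex.I_mul_re, Complex.exp_ofReal_mul_I_im, neg_neg]
    rw [Complex.re_ofReal_mul, h3]
    have h4 := one_div_Gamma_one_sub (hs n)
    have h5 : t ^ (-(δ * n + b)) = t ^ (-b) * (t ^ (-δ)) ^ n := by
      rw [← Real.rpow_natCast, ← Real.rpow_mul ht.le, ← Real.rpow_add ht]; congr 1; ring
    calc _ = π * (t ^ (-b) * (((-w) * t ^ (-δ)) ^ n / n.factorial) *
          (Real.Gamma (δ * n + b) * Real.sin (π * (δ * n + b)) / π)) := by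
            rw [h5, mul_pow]; field_simp
      _ = _ := by rw [← h4]; rw [neg_mul]; ring
  have hsum : Summable fun n : ℕ =>
      (((-w) ^ n / n.factorial * t ^ (-(δ * n + b)) * Real.Gamma (δ * n + b) : ℝ) : ℂ) *
        (-Complex.I * Complex.exp (((π * (δ * n + b) : ℝ) : ℂ) * Complex.I)) := by
    refine Summable.of_norm_bounded ((summable_pow_div_factorial_mul_Gamma hδ0 hδ1 hb
      (w * t ^ (-δ))).mul_left (t ^ (-b))) fun n => ?_
    have h5 : t ^ (-(δ * n + b)) = t ^ (-b) * (t ^ (-δ)) ^ n := by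
      rw [← Real.rpow_natCast, ← Real.rpow_mul ht.le, ← Real.rpow_add ht]; congr 1; ring
    have hG := Real.Gamma_pos_of_pos (hs n)
    rw [norm_mul, norm_mul, norm_neg, Complex.norm_I, Complex.norm_exp_ofReal_mul_I, mul_one,
      mul_one, Complex.norm_real, Real.norm_eq_abs, h5, abs_mul, abs_mul, abs_div, abs_pow, abs_neg,
      abs_of_pos hw, Nat.abs_cast, abs_of_pos hG, abs_of_pos (by positivity), mul_pow]
    apply le_of_eq; ring
  rw [Complex.re_tsum hsum]
  simp only [hre]
  rw [tsum_mul_left, tsum_mul_left]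
  unfold wrightSeries
  field_simp

theorem stableKernel_of_neg {δ b w t : ℝ} (hδ0 : 0 < δ) (hδ1 : δ < 1) (hb : 0 < b) (hw : 0 < w)
    (ht : t < 0) : stableKernel δ b w t = 0 := by
  rw [stableKernel_eq_re hδ0 hδ1 hb hw, integral_Ioi_stableIntegrand hδ0 hδ1 hb hw ht.ne]
  have ht' : 0 < -t := by linarith
  have hterm : ∀ n : ℕ, Complex.I ^ ((b - 1 : ℝ) : ℂ) *
      ((-(w * Complex.I ^ (δ : ℂ))) ^ n / (n.factorial : ℂ) *
        ((-(Complex.I * t)) ^ (-((δ * n + b : ℝ) : ℂ)) * (Real.Gamma (δ * n + b) : ℂ))) =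
      -Complex.I * (((-w) ^ n / n.factorial * (-t) ^ (-(δ * n + b)) * Real.Gamma (δ * n + b) : ℝ) : ℂ)
      := by
    intro n
    rw [show -(Complex.I * (t : ℂ)) = Complex.I * ((-t : ℝ) : ℂ) by push_cast; ring,
      ← Complex.ofReal_neg,
      cpow_mul_ofReal_of_pos Complex.I_ne_zero ht', I_cpow ((-(δ * n + b) : ℝ) : ℂ),
      neg_mul_eq_neg_mul (w : ℂ), mul_pow]
    have h1 := I_cpow_phase δ b n
    have h2 : Complex.exp (π / 2 * (δ * n + b) * Complex.I) *
          Complex.exp (π / 2 * ((-(δ * n + b) : ℝ) : ℂ) * Complex.I) = 1 := by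
      rw [← Complex.exp_add, Complex.exp_eq_one_iff]; refine ⟨0, ?_⟩; push_cast; ring
    have h3 : Complex.I ^ ((b - 1 : ℝ) : ℂ) * (Complex.I ^ (δ : ℂ)) ^ n *
        Complex.exp (π / 2 * ((-(δ * n + b) : ℝ) : ℂ) * Complex.I) = -Complex.I := by
      rw [h1, mul_assoc, h2, mul_one]
    calc _ = (Complex.I ^ ((b - 1 : ℝ) : ℂ) * (Complex.I ^ (δ : ℂ)) ^ n *
        Complex.exp (π / 2 * ((-(δ * n + b) : ℝ) : ℂ) * Complex.I)) *
        ((-(w : ℂ)) ^ n / n.factorial * (((-t) ^ (-(δ * n + b)) : ℝ) : ℂ) *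
          (Real.Gamma (δ * n + b) : ℂ)) := by ring
      _ = _ := by rw [h3]; push_cast; ring
  simp only [hterm]
  rw [tsum_mul_left, ← Complex.ofReal_tsum, neg_mul, Complex.neg_re, Complex.I_mul_re,
    Complex.ofReal_im]
  simp

/-! ### Decay of the Wright series -/

theorem exists_abs_wrightSeries_le {δ b : ℝ} (hδ0 : 0 < δ) (hδ1 : δ < 1) (hb : 0 < b) :
    ∃ C, 0 < C ∧ ∀ y, 0 < y → |wrightSeries δ b y| ≤ C * y ^ (-b / δ) := by
  have hc := cos_pi_div_two_mul_pos hδ0 hδ1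
  set c := Real.cos (π / 2 * δ)
  refine ⟨1 / π * (c ^ (-b / δ) * (1 / δ) * Real.Gamma (b / δ)), ?_, fun y hy => ?_⟩
  · have := Real.Gamma_pos_of_pos (div_pos hb hδ0)
    have := pi_pos
    positivity
  have h1 := stableKernel_of_pos hδ0 hδ1 hb hy one_pos
  rw [stableKernel_eq_re hδ0 hδ1 hb hy, Complex.ofReal_inj] at h1
  simp only [one_rpow, one_mul, mul_one] at h1
  rw [← h1, abs_mul, abs_of_pos (by have := pi_pos; positivity), mul_assoc (1 / π)]
  gcongr
  refine (Complex.abs_re_le_norm _).trans ((norm_integral_le_integral_norm _).trans ?_)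
  have h2 := integral_rpow_mul_exp_neg_mul_rpow (p := δ) (q := b - 1) (b := y * c) hδ0 (by linarith)
    (mul_pos hy hc)
  rw [sub_add_cancel, mul_rpow hy.le hc.le] at h2
  apply le_of_eq
  calc _ = ∫ r in Ioi (0 : ℝ), r ^ (b - 1) * Real.exp (-(y * c) * r ^ δ) := by
        refine setIntegral_congr_fun measurableSet_Ioi fun r hr => ?_
        rw [norm_mul, norm_cexp_I_mul, one_mul, norm_stableIntegrand_of_pos hr, neg_mul]
    _ = _ := by rw [h2]; ring

theorem exists_abs_wrightSeries_self_le {δ : ℝ} (hδ0 : 0 < δ) (hδ1 : δ < 1) :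
    ∃ C, 0 < C ∧ ∀ y, 0 ≤ y → |wrightSeries δ δ y| ≤ C := by
  obtain ⟨C, hC, h⟩ := exists_abs_wrightSeries_le hδ0 hδ1 hδ0
  obtain ⟨D, hD⟩ := isCompact_Icc.exists_bound_of_continuousOn (s := Icc (0 : ℝ) 1)
    (continuous_wrightSeries hδ0 hδ1 hδ0.le).continuousOn
  refine ⟨max C D, lt_max_of_lt_left hC, fun y hy => ?_⟩
  rcases le_total y 1 with h1 | h1
  · exact (hD y ⟨hy, h1⟩).trans (le_max_right _ _)
  · refine (h y (by linarith)).trans ((?_ : _ ≤ C).trans (le_max_left _ _))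
    have : y ^ (-δ / δ) ≤ 1 := rpow_le_one_of_one_le_of_nonpos h1 (by
      rw [neg_div, div_self hδ0.ne']; norm_num)
    nlinarith

theorem exists_abs_wrightSeries_one_le {δ : ℝ} (hδ0 : 0 < δ) (hδ1 : δ < 1) :
    ∃ C, 0 < C ∧ ∀ y, 0 ≤ y → |wrightSeries δ 1 y| ≤ C := by
  obtain ⟨C, hC, h⟩ := exists_abs_wrightSeries_le hδ0 hδ1 one_pos
  obtain ⟨D, hD⟩ := isCompact_Icc.exists_bound_of_continuousOn (s := Icc (0 : ℝ) 1)
    (continuous_wrightSeries hδ0 hδ1 zero_le_one).continuousOn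
  refine ⟨max C D, lt_max_of_lt_left hC, fun y hy => ?_⟩
  rcases le_total y 1 with h1 | h1
  · exact (hD y ⟨hy, h1⟩).trans (le_max_right _ _)
  · refine (h y (by linarith)).trans ((?_ : _ ≤ C).trans (le_max_left _ _))
    have : y ^ (-1 / δ) ≤ 1 := rpow_le_one_of_one_le_of_nonpos h1 (by
      rw [neg_div]; have := div_pos one_pos hδ0; linarith)
    nlinarith

/-! ### The kernels `s^(-b) S_b (w s^(-δ))` -/

/-- The causal function `s ↦ s^(-b) S_b (w s^(-δ))`, where `S_b` is the Wright series. -/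
noncomputable def wrightKernel (δ b w s : ℝ) : ℝ :=
  if 0 < s then s ^ (-b) * wrightSeries δ b (w * s ^ (-δ)) else 0

theorem wrightKernel_of_pos {δ b w s : ℝ} (hs : 0 < s) :
    wrightKernel δ b w s = s ^ (-b) * wrightSeries δ b (w * s ^ (-δ)) := if_pos hs

theorem wrightKernel_of_nonpos {δ b w s : ℝ} (hs : s ≤ 0) : wrightKernel δ b w s = 0 :=
  if_neg hs.not_gt

theorem stableKernel_eq_wrightKernel {δ b w t : ℝ} (hδ0 : 0 < δ) (hδ1 : δ < 1) (hb : 0 < b)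
    (hw : 0 < w) (ht : t ≠ 0) : stableKernel δ b w t = wrightKernel δ b w t := by
  rcases ht.lt_or_gt with h | h
  · rw [stableKernel_of_neg hδ0 hδ1 hb hw h, wrightKernel_of_nonpos h.le, Complex.ofReal_zero]
  · rw [stableKernel_of_pos hδ0 hδ1 hb hw h, wrightKernel_of_pos h]

theorem measurable_wrightKernel {δ b : ℝ} (hδ0 : 0 < δ) (hδ1 : δ < 1) (hb : 0 ≤ b) :
    Measurable fun p : ℝ × ℝ => wrightKernel δ b p.1 p.2 := by
  unfold wrightKernel
  have := (continuous_wrightSeries hδ0 hδ1 hb).measurable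
  refine Measurable.ite (measurableSet_lt measurable_const measurable_snd) ?_ measurable_const
  refine (measurable_snd.pow_const _).mul (this.comp ?_)
  exact measurable_fst.mul (measurable_snd.pow_const _)

theorem measurable_wrightKernel_right {δ b : ℝ} (hδ0 : 0 < δ) (hδ1 : δ < 1) (hb : 0 ≤ b) (w : ℝ) :
    Measurable (wrightKernel δ b w) :=
  (measurable_wrightKernel hδ0 hδ1 hb).comp (measurable_const.prodMk measurable_id)

theorem exists_abs_wrightKernel_le {δ b : ℝ} (hδ0 : 0 < δ) (hδ1 : δ < 1) (hb : 0 < b) :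
    ∃ C, 0 < C ∧ ∀ w s, 0 < w → |wrightKernel δ b w s| ≤ C * w ^ (-b / δ) := by
  obtain ⟨C, hC, h⟩ := exists_abs_wrightSeries_le hδ0 hδ1 hb
  refine ⟨C, hC, fun w s hw => ?_⟩
  rcases le_or_gt s 0 with hs | hs
  · rw [wrightKernel_of_nonpos hs, abs_zero]; positivity
  rw [wrightKernel_of_pos hs, abs_mul, abs_of_pos (by positivity)]
  have h1 := h (w * s ^ (-δ)) (by positivity)
  rw [mul_rpow hw.le (by positivity), ← rpow_mul hs.le, show -δ * (-b / δ) = b by field_simp] at h1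
  have h2 : s ^ (-b) * s ^ b = 1 := by rw [← rpow_add hs]; simp
  calc _ ≤ s ^ (-b) * (C * (w ^ (-b / δ) * s ^ b)) := by gcongr
    _ = C * w ^ (-b / δ) * (s ^ (-b) * s ^ b) := by ring
    _ = _ := by rw [h2, mul_one]

theorem exists_abs_wrightKernel_one_le {δ : ℝ} (hδ0 : 0 < δ) (hδ1 : δ < 1) :
    ∃ C, 0 < C ∧ ∀ w s, 0 ≤ w → 0 < s → |wrightKernel δ 1 w s| ≤ C * (w * s ^ (-δ - 1)) := by
  obtain ⟨C, hC, h⟩ := exists_abs_wrightSeries_self_le hδ0 hδ1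
  refine ⟨δ * C, by positivity, fun w s hw hs => ?_⟩
  rw [wrightKernel_of_pos hs, wrightSeries_one_eq hδ0 hδ1, abs_mul, abs_mul, abs_of_pos (by positivity),
    abs_of_nonneg (by positivity)]
  calc _ ≤ s ^ (-1 : ℝ) * (δ * (w * s ^ (-δ)) * C) := by gcongr; exact h _ (by positivity)
    _ = _ := by rw [sub_eq_add_neg, rpow_add hs]; ring

theorem exists_abs_wrightKernel_one_le_div {δ : ℝ} (hδ0 : 0 < δ) (hδ1 : δ < 1) :
    ∃ C, 0 < C ∧ ∀ w s, 0 ≤ w → 0 < s → |wrightKernel δ 1 w s| ≤ C / s := by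
  obtain ⟨C, hC, h⟩ := exists_abs_wrightSeries_one_le hδ0 hδ1
  refine ⟨C, by positivity, fun w s hw hs => ?_⟩
  rw [wrightKernel_of_pos hs, abs_mul, abs_of_pos (by positivity), rpow_neg_one, div_eq_inv_mul]
  gcongr; exact h _ (by positivity)

theorem integrable_wrightKernel_one {δ w : ℝ} (hδ0 : 0 < δ) (hδ1 : δ < 1) (hw : 0 < w) :
    Integrable (wrightKernel δ 1 w) := by
  obtain ⟨C, hC, h⟩ := exists_abs_wrightKernel_le hδ0 hδ1 one_pos
  obtain ⟨D, hD, h'⟩ := exists_abs_wrightKernel_one_le hδ0 hδ1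
  have hm := measurable_wrightKernel_right hδ0 hδ1 zero_le_one w
  rw [← integrableOn_univ, ← Iic_union_Ioi (a := (0 : ℝ)),
    ← Ioc_union_Ioi_eq_Ioi (zero_le_one (α := ℝ))]
  refine IntegrableOn.union ?_ (IntegrableOn.union ?_ ?_)
  · refine integrableOn_zero.congr_fun (fun s hs => ?_) measurableSet_Iic
    exact (wrightKernel_of_nonpos hs).symm
  · refine Integrable.mono' (integrable_const (C * w ^ (-1 / δ))) hm.aestronglyMeasurable ?_
    filter_upwards with s using h w s hw
  · have h1 := (integrableOn_Ioi_rpow_of_lt (a := -δ - 1) (by linarith) one_pos).const_mul (D * w)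
    refine Integrable.mono' h1 hm.aestronglyMeasurable ?_
    filter_upwards [ae_restrict_mem measurableSet_Ioi] with s hs
    have hs' : (0 : ℝ) < s := one_pos.trans hs
    rw [mul_assoc]; exact h' w s hw.le hs'

theorem integral_wrightKernel_one_mul_cexp {δ w : ℝ} (hδ0 : 0 < δ) (hδ1 : δ < 1) (hw : 0 < w)
    (r : ℝ) : ∫ s : ℝ, Complex.exp (-(Complex.I * s * r)) * wrightKernel δ 1 w s =
      stableSymbol δ w r := by
  set f : ℝ → ℂ := fun r => stableSymbol δ w (2 * π * r)
  have h2π : (2 * π) ≠ 0 := by have := pi_pos; positivity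
  have hcont : Continuous f := (continuous_stableSymbol hδ0 w).comp (by fun_prop)
  have hi0 : Integrable (stableSymbol δ w) := by
    have := integrable_stableIntegrand hδ0 hδ1 one_pos hw
    simpa only [funext (stableIntegrand_one δ w)] using this
  have hInt : Integrable f := hi0.comp_mul_left' h2π
  have hinv : ∀ s : ℝ, FourierTransformInv.fourierInv f s = stableKernel δ 1 w s := by
    intro s
    rw [Real.fourierInv_eq']
    unfold stableKernel
    have := Measure.integral_comp_mul_left (fun r : ℝ => Complex.exp (Complex.I * s * r) *
      stableIntegrand δ 1 w r) (2 * π)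
    rw [abs_of_pos (by have := pi_pos; positivity)] at this
    rw [one_div, ← Complex.real_smul, ← this]
    congr 1; ext v
    rw [stableIntegrand_one, smul_eq_mul]
    congr 2
    simp; ring
  have hae : (fun s => FourierTransformInv.fourierInv f s) =ᵐ[volume] fun s => (wrightKernel δ 1 w s : ℂ) := by
    have : ∀ᵐ s : ℝ, s ≠ 0 := by simp [ae_iff]
    filter_upwards [this] with s hs
    rw [hinv, stableKernel_eq_wrightKernel hδ0 hδ1 one_pos hw hs]
  have hInt' : Integrable (FourierTransformInv.fourierInv f) :=
    (integrable_congr hae).2 (integrable_wrightKernel_one hδ0 hδ1 hw).ofReal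
  have hInt'' : Integrable (FourierTransform.fourier f) := by
    have := hInt'.comp_neg
    simpa only [Real.fourierInv_eq_fourier_neg, neg_neg] using this
  have key := congrFun (Continuous.fourier_fourierInv_eq hcont hInt hInt'') (r / (2 * π))
  have hf : f (r / (2 * π)) = stableSymbol δ w r := by
    show stableSymbol δ w (2 * π * (r / (2 * π))) = _
    rw [mul_div_cancel₀ _ h2π]
  rw [← hf, ← key, Real.fourier_eq']
  refine integral_congr_ae ?_
  filter_upwards [hae] with s hs
  rw [hs, smul_eq_mul]
  congr 2
  simp
  have : (π : ℂ) ≠ 0 := by exact_mod_cast pi_ne_zero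
  field_simp

theorem integral_wrightKernel_one {δ w : ℝ} (hδ0 : 0 < δ) (hδ1 : δ < 1) (hw : 0 < w) :
    ∫ s, wrightKernel δ 1 w s = 1 := by
  have := integral_wrightKernel_one_mul_cexp hδ0 hδ1 hw 0
  have h0 : (δ : ℂ) ≠ 0 := by exact_mod_cast hδ0.ne'
  simp [stableSymbol, h0] at this
  have h1 := (integral_ofReal (𝕜 := ℂ) (f := wrightKernel δ 1 w) (μ := volume)).symm.trans this
  exact Complex.ofReal_injective (h1.trans Complex.ofReal_one.symm)

/-! ### Semigroup property, the distribution function, and the fractional integral -/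

theorem ae_ne_zero_sub (t : ℝ) : ∀ᵐ s : ℝ, t - s ≠ 0 := by
  have : ∀ᵐ s : ℝ, s ≠ t := by simp [ae_iff]
  filter_upwards [this] with s hs
  exact sub_ne_zero.2 hs.symm

theorem integrable_stableSymbol {δ w : ℝ} (hδ0 : 0 < δ) (hδ1 : δ < 1) (hw : 0 < w) :
    Integrable (stableSymbol δ w) := by
  have := integrable_stableIntegrand hδ0 hδ1 one_pos hw
  simpa only [funext (stableIntegrand_one δ w)] using this

theorem integral_mul_wrightKernel_one_sub {δ w : ℝ} (hδ0 : 0 < δ) (hδ1 : δ < 1) (hw : 0 < w)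
    {h : ℝ → ℂ} (hh : Integrable h) (t : ℝ) :
    ∫ s, h s * wrightKernel δ 1 w (t - s) = (1 / (2 * π) : ℝ) *
      ∫ r : ℝ, Complex.exp (Complex.I * t * r) * stableSymbol δ w r *
        ∫ s : ℝ, Complex.exp (-(Complex.I * s * r)) * h s := by
  have hφ := integrable_stableSymbol hδ0 hδ1 hw
  have h1 : ∫ s, h s * wrightKernel δ 1 w (t - s) = ∫ s, (1 / (2 * π) : ℝ) * ∫ r : ℝ,
      h s * (Complex.exp (Complex.I * (t - s : ℝ) * r) * stableSymbol δ w r) := by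
    refine integral_congr_ae ?_
    filter_upwards [ae_ne_zero_sub t] with s hs
    rw [← stableKernel_eq_wrightKernel hδ0 hδ1 one_pos hw hs, stableKernel, integral_const_mul]
    simp only [stableIntegrand_one]
    ring
  rw [h1, integral_const_mul, integral_integral_swap]
  · congr 1
    refine integral_congr_ae (Eventually.of_forall fun r => ?_)
    simp only
    rw [← integral_const_mul]
    refine integral_congr_ae (Eventually.of_forall fun s => ?_)
    simp only
    have : Complex.exp (Complex.I * (t - s : ℝ) * r) =
        Complex.exp (Complex.I * t * r) * Complex.exp (-(Complex.I * s * r)) := by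
      rw [← Complex.exp_add]; congr 1; push_cast; ring
    rw [this]; ring
  · have hp := hh.mul_prod hφ
    refine hp.mono ?_ (Eventually.of_forall fun p => ?_)
    · have : (Function.uncurry fun s r : ℝ => h s * (Complex.exp (Complex.I * (t - s : ℝ) * r) *
          stableSymbol δ w r)) = fun p : ℝ × ℝ => Complex.exp (Complex.I * (t - p.1 : ℝ) * p.2) *
          (h p.1 * stableSymbol δ w p.2) := by
        ext p; simp only [Function.uncurry]; ring
      rw [this]
      exact (Continuous.aestronglyMeasurable (by fun_prop)).mul hp.aestronglyMeasurable
    · simp only [Function.uncurry, norm_mul]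
      rw [norm_cexp_I_mul, one_mul]

theorem stableSymbol_add (δ w τ r : ℝ) :
    stableSymbol δ (w + τ) r = stableSymbol δ w r * stableSymbol δ τ r := by
  unfold stableSymbol
  rw [← Complex.exp_add]; congr 1; push_cast; ring

theorem integral_wrightKernel_one_mul_wrightKernel_one {δ w τ t : ℝ} (hδ0 : 0 < δ) (hδ1 : δ < 1)
    (hw : 0 < w) (hτ : 0 < τ) (ht : t ≠ 0) :
    ∫ s, wrightKernel δ 1 τ s * wrightKernel δ 1 w (t - s) = wrightKernel δ 1 (w + τ) t := by
  have h := integral_mul_wrightKernel_one_sub hδ0 hδ1 hw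
    (integrable_wrightKernel_one hδ0 hδ1 hτ).ofReal t
  have h2 := stableKernel_eq_wrightKernel hδ0 hδ1 one_pos (add_pos hw hτ) ht
  rw [stableKernel] at h2
  simp only [stableIntegrand_one, stableSymbol_add] at h2
  apply Complex.ofReal_injective
  rw [← h2]
  refine Eq.trans ?_ (h.trans ?_)
  · refine Eq.trans integral_ofReal.symm ?_
    push_cast; rfl
  · congr 2; ext r
    rw [mul_assoc]; congr 2
    exact integral_wrightKernel_one_mul_cexp hδ0 hδ1 hτ r

theorem hasDerivAt_wrightSeries_zero_comp {δ w s : ℝ} (hδ0 : 0 < δ) (hδ1 : δ < 1) (hs : 0 < s) :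
    HasDerivAt (fun s => wrightSeries δ 0 (w * s ^ (-δ))) (wrightKernel δ 1 w s) s := by
  have h1 := hasDerivAt_wrightSeries hδ0 hδ1 le_rfl (w * s ^ (-δ))
  have h2 := (Real.hasDerivAt_rpow_const (x := s) (p := -δ) (Or.inl hs.ne')).const_mul w
  have h3 := h1.comp s h2
  rw [wrightKernel_of_pos hs, wrightSeries_one_eq hδ0 hδ1]
  rw [zero_add] at h3
  refine h3.congr_deriv ?_
  rw [sub_eq_add_neg, rpow_add hs]; ring

theorem hasDerivAt_wrightSeries_zero_comp_left {δ w s : ℝ} (hδ0 : 0 < δ) (hδ1 : δ < 1)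
    (hs : 0 < s) :
    HasDerivAt (fun w => wrightSeries δ 0 (w * s ^ (-δ))) (-wrightKernel δ δ w s) w := by
  have h1 := hasDerivAt_wrightSeries hδ0 hδ1 le_rfl (w * s ^ (-δ))
  have h3 := h1.comp w ((hasDerivAt_id w).mul_const (s ^ (-δ)))
  rw [wrightKernel_of_pos hs]
  rw [zero_add] at h3
  refine h3.congr_deriv ?_
  ring

theorem wrightSeries_zero_eq_integral {δ w t : ℝ} (hδ0 : 0 < δ) (hδ1 : δ < 1) (hw : 0 < w)
    (ht : 0 < t) : wrightSeries δ 0 (w * t ^ (-δ)) = ∫ s in Iic t, wrightKernel δ 1 w s := by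
  have hi := integrable_wrightKernel_one hδ0 hδ1 hw
  have hlim : Tendsto (fun s => wrightSeries δ 0 (w * s ^ (-δ))) atTop (𝓝 1) := by
    have h1 : Tendsto (fun s : ℝ => w * s ^ (-δ)) atTop (𝓝 0) := by
      simpa using (tendsto_rpow_neg_atTop hδ0).const_mul w
    have h2 := (continuous_wrightSeries hδ0 hδ1 le_rfl).tendsto 0
    rw [wrightSeries_zero_zero] at h2
    exact h2.comp h1
  have h := integral_Ioi_of_hasDerivAt_of_tendsto
    (hasDerivAt_wrightSeries_zero_comp (w := w) hδ0 hδ1 ht).continuousAt.continuousWithinAt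
    (fun s hs => hasDerivAt_wrightSeries_zero_comp (w := w) hδ0 hδ1 (ht.trans hs))
    hi.integrableOn hlim
  have h2 := intervalIntegral.integral_Iic_add_Ioi (b := t) hi.integrableOn hi.integrableOn
  rw [integral_wrightKernel_one hδ0 hδ1 hw] at h2
  linarith

theorem wrightKernel_zero_eq_integral {δ w : ℝ} (hδ0 : 0 < δ) (hδ1 : δ < 1) (hw : 0 < w)
    (t : ℝ) : wrightKernel δ 0 w t = ∫ s in Iic t, wrightKernel δ 1 w s := by
  rcases le_or_gt t 0 with ht | ht
  · rw [wrightKernel_of_nonpos ht]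
    symm
    exact setIntegral_eq_zero_of_forall_eq_zero fun s hs =>
      wrightKernel_of_nonpos (le_trans hs ht)
  · rw [wrightKernel_of_pos ht, ← wrightSeries_zero_eq_integral hδ0 hδ1 hw ht]
    simp

theorem exists_abs_wrightSeries_zero_le {δ : ℝ} (hδ0 : 0 < δ) (hδ1 : δ < 1) :
    ∃ C, 0 < C ∧ ∀ y, 0 ≤ y → |wrightSeries δ 0 y| ≤ C / (1 + y) := by
  obtain ⟨C, hC, h⟩ := exists_abs_wrightKernel_le hδ0 hδ1 one_pos
  obtain ⟨D, hD⟩ := isCompact_Icc.exists_bound_of_continuousOn (s := Icc (0 : ℝ) 1)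
    (continuous_wrightSeries hδ0 hδ1 le_rfl).continuousOn
  have hD0 : 0 ≤ D := (norm_nonneg _).trans (hD 0 ⟨le_rfl, zero_le_one⟩)
  refine ⟨2 * (C + D), by positivity, fun y hy => ?_⟩
  rw [le_div_iff₀ (by positivity)]
  rcases le_total y 1 with h1 | h1
  · have := hD y ⟨hy, h1⟩
    rw [Real.norm_eq_abs] at this
    nlinarith [abs_nonneg (wrightSeries δ 0 y)]
  · have hy0 : 0 < y := by linarith
    have h2 := wrightSeries_zero_eq_integral hδ0 hδ1 hy0 one_pos
    rw [one_rpow, mul_one] at h2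
    have h3 : ∫ s in Iic (1 : ℝ), wrightKernel δ 1 y s = ∫ s in Ioc 0 1, wrightKernel δ 1 y s := by
      refine setIntegral_eq_of_subset_of_forall_sdiff_eq_zero measurableSet_Iic
        Ioc_subset_Iic_self fun s hs => wrightKernel_of_nonpos ?_
      by_contra hc; exact hs.2 ⟨not_le.1 hc, hs.1⟩
    have h4 : |wrightSeries δ 0 y| ≤ C * y ^ (-1 / δ) := by
      rw [h2, h3]
      have := norm_setIntegral_le_of_norm_le_const (μ := volume) (s := Ioc (0 : ℝ) 1)
        (f := wrightKernel δ 1 y) (C := C * y ^ (-1 / δ)) (by simp) fun s _ => h y s hy0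
      simpa using this
    have h5 : y ^ (-1 / δ) ≤ y ^ (-1 : ℝ) := by
      apply rpow_le_rpow_of_exponent_le h1
      rw [neg_div, neg_le_neg_iff, le_div_iff₀ hδ0]; linarith
    rw [rpow_neg_one] at h5
    have h6 : y⁻¹ * y = 1 := inv_mul_cancel₀ hy0.ne'
    have h7 : |wrightSeries δ 0 y| ≤ C * y⁻¹ := h4.trans (by gcongr)
    have h8 : 0 < y⁻¹ := by positivity
    calc _ ≤ C * y⁻¹ * (2 * y) := by gcongr; linarith
      _ = 2 * C := by rw [show C * y⁻¹ * (2 * y) = 2 * C * (y⁻¹ * y) by ring, h6]; ring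
      _ ≤ _ := by linarith

theorem integral_wrightKernel_one_mul_wrightKernel_zero {δ w τ : ℝ} (hδ0 : 0 < δ)
    (hδ1 : δ < 1) (hw : 0 < w) (hτ : 0 < τ) (t : ℝ) :
    ∫ s, wrightKernel δ 1 τ s * wrightKernel δ 0 w (t - s) = wrightKernel δ 0 (w + τ) t := by
  have h1 : ∀ s, wrightKernel δ 1 τ s * wrightKernel δ 0 w (t - s) =
      ∫ σ in Iic t, wrightKernel δ 1 τ s * wrightKernel δ 1 w (σ - s) := by
    intro s
    rw [wrightKernel_zero_eq_integral hδ0 hδ1 hw, integral_const_mul]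
    congr 1
    rw [← integral_indicator measurableSet_Iic, ← integral_indicator measurableSet_Iic,
      ← integral_sub_right_eq_self _ s]
    congr 1; ext σ
    simp only [indicator, mem_Iic, sub_le_sub_iff_right]
  have hi := integrable_wrightKernel_one hδ0 hδ1 hw
  have hi' := integrable_wrightKernel_one hδ0 hδ1 hτ
  simp only [h1]
  rw [integral_integral_swap, wrightKernel_zero_eq_integral hδ0 hδ1 (add_pos hw hτ)]
  · refine integral_congr_ae (ae_restrict_of_ae ?_)
    have : ∀ᵐ s : ℝ, s ≠ 0 := by simp [ae_iff]
    filter_upwards [this] with σ hσ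
    exact integral_wrightKernel_one_mul_wrightKernel_one hδ0 hδ1 hw hτ hσ
  · have h2 := (Integrable.convolution_integrand (ContinuousLinearMap.mul ℝ ℝ) hi' hi).swap
    have h3 := h2.mono_measure (Measure.prod_mono (le_refl (volume : Measure ℝ))
      (Measure.restrict_le_self (μ := (volume : Measure ℝ)) (s := Iic t)))
    exact h3

theorem norm_ofReal_add_I_mul_cpow_le {δ ε r : ℝ} (hδ1 : δ < 1) (hr : r ≠ 0) :
    ‖((ε : ℂ) + Complex.I * r) ^ ((δ - 1 : ℝ) : ℂ)‖ ≤ ‖(Complex.I * r) ^ ((δ - 1 : ℝ) : ℂ)‖ := by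
  rw [Complex.norm_cpow_real, Complex.norm_cpow_real]
  apply rpow_le_rpow_of_nonpos _ _ (by linarith)
  · simpa using hr
  · have := Complex.abs_im_le_norm ((ε : ℂ) + Complex.I * r)
    simpa using this

theorem integral_exp_mul_rpow_mul_wrightKernel_one {δ w t ε : ℝ} (hδ0 : 0 < δ) (hδ1 : δ < 1)
    (hw : 0 < w) (hε : 0 < ε) :
    ((∫ s in Ioi (0 : ℝ), s ^ (-δ) * Real.exp (-(ε * s)) * wrightKernel δ 1 w (t - s) : ℝ) : ℂ) =
      (1 / (2 * π) : ℝ) * ∫ r : ℝ, Complex.exp (Complex.I * t * r) * stableSymbol δ w r *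
        ((ε + Complex.I * r) ^ ((δ - 1 : ℝ) : ℂ) * Real.Gamma (1 - δ)) := by
  set h : ℝ → ℂ := (Ioi (0 : ℝ)).indicator fun s => ((s ^ (-δ) * Real.exp (-(ε * s)) : ℝ) : ℂ)
  have hi : Integrable h := by
    rw [integrable_indicator_iff measurableSet_Ioi]
    exact (integrableOn_rpow_mul_exp_neg_mul (q := -δ) (by linarith) hε).ofReal
  have key := integral_mul_wrightKernel_one_sub hδ0 hδ1 hw hi t
  have h1 : ∀ r : ℝ, ∫ s : ℝ, Complex.exp (-(Complex.I * s * r)) * h s =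
      (ε + Complex.I * r) ^ ((δ - 1 : ℝ) : ℂ) * Real.Gamma (1 - δ) := by
    intro r
    have h2 := integral_rpow_mul_cexp_neg_mul (s := 1 - δ) (by linarith)
      (ζ := ε + Complex.I * r) (by simpa using hε)
    rw [show -((1 - δ : ℝ) : ℂ) = ((δ - 1 : ℝ) : ℂ) by push_cast; ring] at h2
    rw [← h2, ← integral_indicator measurableSet_Ioi]
    congr 1; ext s
    by_cases hs : s ∈ Ioi (0 : ℝ)
    · simp only [h, indicator_of_mem hs]
      rw [show 1 - δ - 1 = -δ by ring, Complex.ofReal_mul, Complex.ofReal_exp,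
        show -(((ε : ℂ) + Complex.I * r) * s) = -(Complex.I * s * r) + ((-(ε * s) : ℝ) : ℂ) by
          push_cast; ring, Complex.exp_add]
      ring
    · simp only [h, indicator_of_notMem hs, mul_zero]
  simp only [h1] at key
  rw [← key, ← integral_indicator measurableSet_Ioi]
  refine Eq.trans integral_ofReal.symm ?_
  congr 1; ext s
  by_cases hs : s ∈ Ioi (0 : ℝ)
  · simp only [h, indicator_of_mem hs]; exact Complex.ofReal_mul _ _
  · simp only [h, indicator_of_notMem hs]; simp

theorem integral_rpow_mul_wrightKernel_one {δ w t : ℝ} (hδ0 : 0 < δ) (hδ1 : δ < 1)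
    (hw : 0 < w) (ht : 0 < t) :
    ∫ s in Ioi (0 : ℝ), s ^ (-δ) * wrightKernel δ 1 w (t - s) =
      Real.Gamma (1 - δ) * wrightKernel δ δ w t := by
  obtain ⟨C, hC, hbd⟩ := exists_abs_wrightKernel_le hδ0 hδ1 one_pos
  have hmeas := (measurable_wrightKernel_right hδ0 hδ1 zero_le_one w).comp
    (measurable_const.sub measurable_id : Measurable fun s : ℝ => t - s)
  have hε : ∀ᶠ ε in 𝓝[>] (0 : ℝ), 0 < ε := eventually_mem_nhdsWithin
  have hdom : IntegrableOn (fun s : ℝ => s ^ (-δ) * |wrightKernel δ 1 w (t - s)|) (Ioi 0) := by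
    rw [← Ioc_union_Ioi_eq_Ioi ht.le]
    refine IntegrableOn.union ?_ ?_
    · have h1 : IntegrableOn (fun s : ℝ => s ^ (-δ)) (Ioc 0 t) :=
        (intervalIntegrable_iff_integrableOn_Ioc_of_le ht.le).1
          (intervalIntegral.intervalIntegrable_rpow' (by linarith))
      refine Integrable.mono' (h1.mul_const (C * w ^ (-1 / δ)))
        ((measurable_id.pow_const _).mul hmeas.abs).aestronglyMeasurable ?_
      filter_upwards [ae_restrict_mem measurableSet_Ioc] with s hs
      have := rpow_nonneg hs.1.le (-δ)
      rw [norm_mul, Real.norm_of_nonneg this, Real.norm_of_nonneg (abs_nonneg _)]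
      gcongr
      exact hbd w _ hw
    · refine integrableOn_zero.congr_fun (fun s hs => ?_) measurableSet_Ioi
      rw [wrightKernel_of_nonpos (by linarith [mem_Ioi.1 hs])]; simp
  have hL : Tendsto (fun ε : ℝ => ∫ s in Ioi (0 : ℝ),
      s ^ (-δ) * Real.exp (-(ε * s)) * wrightKernel δ 1 w (t - s)) (𝓝[>] 0)
      (𝓝 (∫ s in Ioi (0 : ℝ), s ^ (-δ) * wrightKernel δ 1 w (t - s))) := by
    refine tendsto_integral_filter_of_dominated_convergence _ ?_ ?_ hdom ?_
    · filter_upwards with ε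
      exact (((measurable_id.pow_const _).mul (by fun_prop)).mul hmeas).aestronglyMeasurable
    · filter_upwards [hε] with ε hε
      filter_upwards [ae_restrict_mem measurableSet_Ioi] with s hs
      have hs' : (0 : ℝ) < s := hs
      rw [norm_mul, norm_mul, Real.norm_of_nonneg (rpow_nonneg hs'.le _),
        Real.norm_of_nonneg (Real.exp_pos _).le, Real.norm_eq_abs]
      have : Real.exp (-(ε * s)) ≤ 1 := Real.exp_le_one_iff.2 (by nlinarith)
      have h2 := rpow_nonneg hs'.le (-δ)
      calc _ ≤ s ^ (-δ) * 1 * |wrightKernel δ 1 w (t - s)| := by gcongr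
        _ = _ := by ring
    · filter_upwards with s
      have : Tendsto (fun ε : ℝ => s ^ (-δ) * Real.exp (-(ε * s)) * wrightKernel δ 1 w (t - s))
          (𝓝 0) (𝓝 (s ^ (-δ) * Real.exp (-(0 * s)) * wrightKernel δ 1 w (t - s))) :=
        Continuous.tendsto (by fun_prop) 0
      simpa using this.mono_left nhdsWithin_le_nhds
  have hR : Tendsto (fun ε : ℝ => ((1 / (2 * π) : ℝ) : ℂ) * ∫ r : ℝ,
      Complex.exp (Complex.I * t * r) * stableSymbol δ w r *
        ((ε + Complex.I * r) ^ ((δ - 1 : ℝ) : ℂ) * Real.Gamma (1 - δ))) (𝓝[>] 0)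
      (𝓝 (((1 / (2 * π) : ℝ) : ℂ) * ∫ r : ℝ,
      Complex.exp (Complex.I * t * r) * stableSymbol δ w r *
        ((Complex.I * r) ^ ((δ - 1 : ℝ) : ℂ) * Real.Gamma (1 - δ)))) := by
    have hne : ∀ᵐ s : ℝ, s ≠ 0 := by simp [ae_iff]
    have hm := (continuous_stableSymbol hδ0 w).measurable
    refine Tendsto.const_mul _ ?_
    refine tendsto_integral_filter_of_dominated_convergence
      (fun r => ‖stableIntegrand δ δ w r‖ * |Real.Gamma (1 - δ)|) ?_ ?_
      ((integrable_stableIntegrand hδ0 hδ1 hδ0 hw).norm.mul_const _) ?_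
    · filter_upwards with ε
      refine Measurable.aestronglyMeasurable ?_
      exact (Measurable.mul (by fun_prop) hm).mul ((Measurable.pow_const (by fun_prop) _).mul_const _)
    · filter_upwards with ε
      filter_upwards [hne] with r hr
      rw [norm_mul, norm_mul, norm_mul, norm_cexp_I_mul, one_mul, Complex.norm_real,
        Real.norm_eq_abs, stableIntegrand, norm_mul]
      have := norm_ofReal_add_I_mul_cpow_le (ε := ε) hδ1 hr
      calc _ ≤ ‖stableSymbol δ w r‖ * (‖(Complex.I * r) ^ ((δ - 1 : ℝ) : ℂ)‖ * |Real.Gamma (1 - δ)|) := by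
            gcongr
        _ = _ := by ring
    · filter_upwards [hne] with r hr
      refine Tendsto.const_mul _ (Tendsto.mul_const _ ?_)
      have h1 : ContinuousAt (fun z : ℂ => z ^ ((δ - 1 : ℝ) : ℂ)) (Complex.I * r) :=
        continuousAt_cpow_const (Complex.mem_slitPlane_iff.2 (Or.inr (by simpa using hr)))
      have h2 : Tendsto (fun ε : ℝ => (ε : ℂ) + Complex.I * r) (𝓝[>] 0) (𝓝 (Complex.I * r)) := by
        have : Tendsto (fun ε : ℝ => (ε : ℂ) + Complex.I * r) (𝓝 0) (𝓝 ((0 : ℝ) + Complex.I * r)) :=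
          Continuous.tendsto (by fun_prop) 0
        simpa using this.mono_left nhdsWithin_le_nhds
      exact h1.tendsto.comp h2
  have hL' := (Complex.continuous_ofReal.tendsto _).comp hL
  have heq : (fun ε : ℝ => ((1 / (2 * π) : ℝ) : ℂ) * ∫ r : ℝ,
      Complex.exp (Complex.I * t * r) * stableSymbol δ w r *
        ((ε + Complex.I * r) ^ ((δ - 1 : ℝ) : ℂ) * Real.Gamma (1 - δ))) =ᶠ[𝓝[>] 0]
      (Complex.ofReal ∘ fun ε : ℝ => ∫ s in Ioi (0 : ℝ),
        s ^ (-δ) * Real.exp (-(ε * s)) * wrightKernel δ 1 w (t - s)) := by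
    filter_upwards [hε] with ε hε
    exact (integral_exp_mul_rpow_mul_wrightKernel_one hδ0 hδ1 hw hε).symm
  have hlim := tendsto_nhds_unique (hR.congr' heq) hL'
  apply Complex.ofReal_injective
  rw [← hlim, Complex.ofReal_mul, ← stableKernel_eq_wrightKernel hδ0 hδ1 hδ0 hw ht.ne', stableKernel,
    mul_left_comm]
  congr 1
  rw [← integral_const_mul]
  refine integral_congr_ae (Eventually.of_forall fun r => ?_)
  simp only
  rw [stableIntegrand]; ring

/-! ### Estimates for the distribution function and the Caputo derivative of mixtures -/

theorem wrightKernel_zero_of_pos {δ w t : ℝ} (ht : 0 < t) :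
    wrightKernel δ 0 w t = wrightSeries δ 0 (w * t ^ (-δ)) := by
  rw [wrightKernel_of_pos ht, neg_zero, rpow_zero, one_mul]

theorem hasDerivAt_wrightKernel_zero {δ w t : ℝ} (hδ0 : 0 < δ) (hδ1 : δ < 1) (ht : 0 < t) :
    HasDerivAt (wrightKernel δ 0 w) (wrightKernel δ 1 w t) t := by
  refine (hasDerivAt_wrightSeries_zero_comp hδ0 hδ1 ht).congr_of_eventuallyEq ?_
  filter_upwards [lt_mem_nhds ht] with s hs
  exact wrightKernel_zero_of_pos hs

theorem hasDerivAt_wrightKernel_zero_left {δ w t : ℝ} (hδ0 : 0 < δ) (hδ1 : δ < 1) (ht : 0 < t) :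
    HasDerivAt (fun w => wrightKernel δ 0 w t) (-wrightKernel δ δ w t) w := by
  simp only [wrightKernel_zero_of_pos ht]
  exact hasDerivAt_wrightSeries_zero_comp_left hδ0 hδ1 ht

theorem exists_abs_wrightKernel_zero_le {δ : ℝ} (hδ0 : 0 < δ) (hδ1 : δ < 1) :
    ∃ C, 0 < C ∧ ∀ w t, 0 ≤ w → |wrightKernel δ 0 w t| ≤ C := by
  obtain ⟨C, hC, h⟩ := exists_abs_wrightSeries_zero_le hδ0 hδ1
  refine ⟨C, hC, fun w t hw => ?_⟩
  rcases le_or_gt t 0 with ht | ht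
  · rw [wrightKernel_of_nonpos ht, abs_zero]; exact hC.le
  rw [wrightKernel_zero_of_pos ht]
  have h0 : 0 ≤ w * t ^ (-δ) := by positivity
  exact (h _ h0).trans (div_le_self hC.le (by linarith))

theorem exists_abs_wrightKernel_zero_le_div {δ : ℝ} (hδ0 : 0 < δ) (hδ1 : δ < 1) :
    ∃ C, 0 < C ∧ ∀ w t, 0 < w → 0 < t → |wrightKernel δ 0 w t| ≤ C * t ^ δ / w := by
  obtain ⟨C, hC, h⟩ := exists_abs_wrightSeries_zero_le hδ0 hδ1
  refine ⟨C, hC, fun w t hw ht => ?_⟩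
  rw [wrightKernel_zero_of_pos ht]
  have h0 : 0 < w * t ^ (-δ) := by positivity
  have h1 : t ^ (-δ) * t ^ δ = 1 := by rw [← rpow_add ht]; simp
  calc _ ≤ C / (1 + w * t ^ (-δ)) := h _ h0.le
    _ ≤ C / (w * t ^ (-δ)) := by gcongr; linarith
    _ = _ := by
      rw [div_eq_div_iff (by positivity) (by positivity)]
      calc C * w = C * w * (t ^ (-δ) * t ^ δ) := by rw [h1, mul_one]
        _ = _ := by ring

theorem exists_abs_wrightKernel_self_le {δ t : ℝ} (hδ0 : 0 < δ) (hδ1 : δ < 1) (ht : 0 < t) :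
    ∃ C, 0 < C ∧ ∀ w, 0 ≤ w → |wrightKernel δ δ w t| ≤ C := by
  obtain ⟨C, hC, h⟩ := exists_abs_wrightSeries_self_le hδ0 hδ1
  refine ⟨t ^ (-δ) * C, by positivity, fun w hw => ?_⟩
  rw [wrightKernel_of_pos ht, abs_mul, abs_of_pos (by positivity)]
  gcongr
  exact h _ (by positivity)

theorem exists_abs_wrightKernel_zero_sub_one_le {δ t : ℝ} (hδ0 : 0 < δ) (hδ1 : δ < 1)
    (ht : 0 < t) : ∃ C, 0 < C ∧ ∀ w, 0 ≤ w → |wrightKernel δ 0 w t - 1| ≤ C * w := by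
  obtain ⟨C, hC, h⟩ := exists_abs_wrightKernel_self_le hδ0 hδ1 ht
  refine ⟨C, hC, fun w hw => ?_⟩
  have := (convex_Ici (0 : ℝ)).norm_image_sub_le_of_norm_hasDerivWithin_le
    (f := fun w => wrightKernel δ 0 w t) (f' := fun w => -wrightKernel δ δ w t) (C := C)
    (x := 0) (y := w)
    (fun x _ => (hasDerivAt_wrightKernel_zero_left hδ0 hδ1 ht).hasDerivWithinAt)
    (fun x hx => by rw [norm_neg]; exact h x hx) self_mem_Ici hw
  rw [wrightKernel_zero_of_pos (w := 0) ht, zero_mul, wrightSeries_zero_zero, sub_zero,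
    Real.norm_eq_abs, Real.norm_of_nonneg hw] at this
  exact this

theorem intervalIntegral_wrightKernel_zero_mul {δ w τ t : ℝ} (hδ0 : 0 < δ) (hδ1 : δ < 1)
    (hw : 0 < w) (hτ : 0 < τ) (ht : 0 < t) :
    ∫ s in (0 : ℝ)..t, wrightKernel δ 0 τ (t - s) * wrightKernel δ 1 w s =
      wrightKernel δ 0 (τ + w) t := by
  rw [← integral_wrightKernel_one_mul_wrightKernel_zero hδ0 hδ1 hτ hw,
    intervalIntegral.integral_of_le ht.le, ← integral_indicator measurableSet_Ioc]
  congr 1; ext s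
  by_cases hs : s ∈ Ioc 0 t
  · rw [indicator_of_mem hs, mul_comm]
  · rw [indicator_of_notMem hs]
    rcases le_or_gt s 0 with h | h
    · rw [wrightKernel_of_nonpos h, zero_mul]
    · have : t < s := by by_contra hc; exact hs ⟨h, not_lt.1 hc⟩
      rw [wrightKernel_of_nonpos (s := t - s) (by linarith), mul_zero]

theorem intervalIntegral_wrightKernel_one_mul_rpow {δ w t : ℝ} (hδ0 : 0 < δ) (hδ1 : δ < 1)
    (hw : 0 < w) (ht : 0 < t) :
    ∫ s in (0 : ℝ)..t, wrightKernel δ 1 w s * (t - s) ^ (-δ) =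
      Real.Gamma (1 - δ) * wrightKernel δ δ w t := by
  rw [← integral_rpow_mul_wrightKernel_one hδ0 hδ1 hw ht]
  have h1 := intervalIntegral.integral_comp_sub_left (a := 0) (b := t)
    (fun s => s ^ (-δ) * wrightKernel δ 1 w (t - s)) t
  rw [sub_self, sub_zero] at h1
  have h2 : ∫ s in Ioi (0 : ℝ), s ^ (-δ) * wrightKernel δ 1 w (t - s) =
      ∫ s in Ioc 0 t, s ^ (-δ) * wrightKernel δ 1 w (t - s) := by
    refine setIntegral_eq_of_subset_of_forall_sdiff_eq_zero measurableSet_Ioi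
      Ioc_subset_Ioi_self fun s hs => ?_
    have : t < s := by by_contra hc; exact hs.2 ⟨hs.1, not_lt.1 hc⟩
    rw [wrightKernel_of_nonpos (s := t - s) (by linarith), mul_zero]
  rw [h2, ← intervalIntegral.integral_of_le ht.le, ← h1]
  refine intervalIntegral.integral_congr fun s _ => ?_
  simp only [sub_sub_cancel]
  ring

theorem caputo_integral_wrightKernel_zero {X : Type*} [MeasurableSpace X] {ν : Measure X}
    [SFinite ν] {δ t : ℝ} (hδ0 : 0 < δ) (hδ1 : δ < 1) (ht : 0 < t) {k W : X → ℝ}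
    (hW : Measurable W) (hWpos : ∀ᵐ p ∂ν, 0 < W p) (hk : Integrable k ν)
    (hkW : Integrable (fun p => k p * W p ^ (-1 / δ)) ν) :
    caputo δ (fun t' => ∫ p, k p * wrightKernel δ 0 (W p) t' ∂ν) t =
      ∫ p, k p * wrightKernel δ δ (W p) t ∂ν := by
  obtain ⟨C0, hC0, hb0⟩ := exists_abs_wrightKernel_zero_le hδ0 hδ1
  obtain ⟨C1, hC1, hb1⟩ := exists_abs_wrightKernel_one_le_div hδ0 hδ1
  obtain ⟨C2, hC2, hb2⟩ := exists_abs_wrightKernel_le hδ0 hδ1 one_pos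
  have hmeas : ∀ b, 0 ≤ b → ∀ s, AEStronglyMeasurable (fun p => k p * wrightKernel δ b (W p) s) ν :=
    fun b hb s => hk.aestronglyMeasurable.mul ((measurable_wrightKernel hδ0 hδ1 hb).comp
      (hW.prodMk measurable_const)).aestronglyMeasurable
  have hder : ∀ s, 0 < s → HasDerivAt (fun t' => ∫ p, k p * wrightKernel δ 0 (W p) t' ∂ν)
      (∫ p, k p * wrightKernel δ 1 (W p) s ∂ν) s := by
    intro s hs
    refine (hasDerivAt_integral_of_dominated_loc_of_deriv_le
      (s := Ioi (s / 2)) (bound := fun p => |k p| * (C1 / (s / 2)))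
      (F' := fun t' p => k p * wrightKernel δ 1 (W p) t')
      (Ioi_mem_nhds (by linarith)) (Eventually.of_forall fun s => hmeas 0 le_rfl s) ?_
      (hmeas 1 zero_le_one s) ?_ (hk.abs.mul_const _) ?_).2
    · refine Integrable.mono' (hk.abs.mul_const C0) (hmeas 0 le_rfl s) ?_
      filter_upwards [hWpos] with p hp
      rw [norm_mul, Real.norm_eq_abs, Real.norm_eq_abs]
      gcongr; exact hb0 _ _ hp.le
    · filter_upwards [hWpos] with p hp s' hs'
      have hs'0 : s / 2 < s' := hs'
      have : 0 < s' := by linarith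
      rw [norm_mul, Real.norm_eq_abs, Real.norm_eq_abs]
      gcongr
      refine (hb1 _ _ hp.le this).trans ?_
      gcongr
    · filter_upwards with p s' hs'
      have hs'0 : s / 2 < s' := hs'
      exact (hasDerivAt_wrightKernel_zero hδ0 hδ1 (by linarith)).const_mul _
  have hG : Real.Gamma (1 - δ) ≠ 0 := (Real.Gamma_pos_of_pos (by linarith)).ne'
  have h1 : ∫ s in (0 : ℝ)..t, deriv (fun t' => ∫ p, k p * wrightKernel δ 0 (W p) t' ∂ν) s *
      (t - s) ^ (-δ) = ∫ s in Ioc 0 t, ∫ p, k p * wrightKernel δ 1 (W p) s * (t - s) ^ (-δ) ∂ν := by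
    rw [intervalIntegral.integral_of_le ht.le]
    refine setIntegral_congr_fun measurableSet_Ioc fun s hs => ?_
    rw [(hder s hs.1).deriv, integral_mul_const]
  have h2 : IntegrableOn (fun s : ℝ => (t - s) ^ (-δ)) (Ioc 0 t) := by
    have := (intervalIntegral.intervalIntegrable_rpow' (r := -δ) (a := 0) (b := t)
      (by linarith)).comp_sub_left t
    rw [sub_zero, sub_self] at this
    exact (intervalIntegrable_iff_integrableOn_Ioc_of_le ht.le).1 this.symm
  have h3 : Integrable (Function.uncurry fun (s : ℝ) (p : X) =>
      k p * wrightKernel δ 1 (W p) s * (t - s) ^ (-δ)) ((volume.restrict (Ioc 0 t)).prod ν) := by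
    refine Integrable.mono' ((h2.mul_prod hkW.abs).const_mul C2) ?_ ?_
    · refine AEStronglyMeasurable.mul (AEStronglyMeasurable.mul ?_ ?_) ?_
      · exact hk.aestronglyMeasurable.comp_snd
      · exact ((measurable_wrightKernel hδ0 hδ1 zero_le_one).comp
          ((hW.comp measurable_snd).prodMk measurable_fst)).aestronglyMeasurable
      · exact ((measurable_const.sub measurable_fst).pow_const _).aestronglyMeasurable
    · have e1 : ∀ᵐ q ∂((volume.restrict (Ioc 0 t)).prod ν), 0 < W q.2 :=
        Measure.quasiMeasurePreserving_snd.ae hWpos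
      have e2 : ∀ᵐ q ∂((volume.restrict (Ioc 0 t)).prod ν), q.1 ∈ Ioc 0 t :=
        Measure.quasiMeasurePreserving_fst.ae (ae_restrict_mem measurableSet_Ioc)
      filter_upwards [e1, e2] with q hq1 hq2
      simp only [Function.uncurry]
      have h4 : 0 ≤ (t - q.1) ^ (-δ) := rpow_nonneg (by linarith [hq2.2]) _
      rw [norm_mul, norm_mul, Real.norm_eq_abs, Real.norm_eq_abs, Real.norm_of_nonneg h4, abs_mul,
        abs_of_pos (rpow_pos_of_pos hq1 _)]
      calc _ ≤ |k q.2| * (C2 * W q.2 ^ (-1 / δ)) * (t - q.1) ^ (-δ) := by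
            gcongr; exact hb2 _ _ hq1
        _ = _ := by ring
  unfold caputo
  rw [h1, integral_integral_swap h3, ← integral_const_mul]
  refine integral_congr_ae ?_
  filter_upwards [hWpos] with p hp
  have h5 : ∫ s in Ioc 0 t, k p * wrightKernel δ 1 (W p) s * (t - s) ^ (-δ) =
      k p * (Real.Gamma (1 - δ) * wrightKernel δ δ (W p) t) := by
    rw [← intervalIntegral_wrightKernel_one_mul_rpow hδ0 hδ1 hp ht,
      intervalIntegral.integral_of_le ht.le, ← integral_const_mul]
    congr 1; ext s; ring
  rw [h5]
  field_simp

/-! ### Inverse Gaussian densities -/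

theorem exists_rpow_mul_exp_neg_mul_le {k c : ℝ} (hk : 0 ≤ k) (hc : 0 < c) :
    ∃ C, 0 < C ∧ ∀ x, 0 ≤ x → x ^ k * Real.exp (-(c * x)) ≤ C := by
  have h1 := tendsto_rpow_mul_exp_neg_mul_atTop_nhds_zero k c hc
  obtain ⟨N, hN⟩ := eventually_atTop.1 (h1.eventually (gt_mem_nhds zero_lt_one))
  have hcont : Continuous fun x : ℝ => x ^ k * Real.exp (-(c * x)) :=
    (continuous_id.rpow_const fun _ => Or.inr hk).mul (by fun_prop)
  obtain ⟨D, hD⟩ := isCompact_Icc.exists_bound_of_continuousOn (s := Icc (0 : ℝ) N)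
    hcont.continuousOn
  refine ⟨max 1 D, lt_max_of_lt_left one_pos, fun x hx => ?_⟩
  rcases le_total N x with h | h
  · have := (hN x h).le
    rw [neg_mul] at this
    exact this.trans (le_max_left _ _)
  · exact (le_abs_self _).trans ((hD x ⟨hx, h⟩).trans (le_max_right _ _))

theorem exists_rpow_neg_mul_exp_neg_div_le {k c : ℝ} (hk : 0 ≤ k) (hc : 0 < c) :
    ∃ C, 0 < C ∧ ∀ v, 0 < v → v ^ (-k) * Real.exp (-(c / v)) ≤ C := by
  obtain ⟨C, hC, h⟩ := exists_rpow_mul_exp_neg_mul_le hk hc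
  refine ⟨C, hC, fun v hv => ?_⟩
  have := h v⁻¹ (by positivity)
  rwa [inv_rpow hv.le, ← rpow_neg hv.le, ← div_eq_mul_inv] at this

theorem exists_one_add_pow_mul_exp_neg_mul_le (n : ℕ) {c : ℝ} (hc : 0 < c) :
    ∃ C, 0 < C ∧ ∀ v, 0 ≤ v → (1 + v) ^ n * Real.exp (-(c * v)) ≤ C := by
  obtain ⟨C, hC, h⟩ := exists_rpow_mul_exp_neg_mul_le (Nat.cast_nonneg n) hc
  refine ⟨C * Real.exp c, by positivity, fun v hv => ?_⟩
  have h1 := h (1 + v) (by positivity)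
  rw [rpow_natCast] at h1
  calc _ = (1 + v) ^ n * Real.exp (-(c * (1 + v))) * Real.exp c := by
        rw [mul_assoc, ← Real.exp_add]; congr 2; ring
    _ ≤ _ := by gcongr

/-- The exponential factor of the inverse Gaussian density. -/
noncomputable def igExp (b l Z v : ℝ) : ℝ := Real.exp (-(Z - l * v) ^ 2 / (4 * b ^ 2 * v))

/-- The inverse Gaussian density: the first-passage density at level `Z` of Brownian motion with
drift `l` and diffusivity `b ^ 2`. It is extended by the same formula to `Z < 0`. -/
noncomputable def igDensity (b l Z v : ℝ) : ℝ :=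
  Z / (2 * b * √π) * v ^ (-(3 / 2) : ℝ) * igExp b l Z v

theorem igExp_pos (b l Z v : ℝ) : 0 < igExp b l Z v := Real.exp_pos _

theorem igExp_le_abs {b l Z v : ℝ} (hb : 0 < b) (hl : 0 < l) (hv : 0 < v) :
    igExp b l Z v ≤ igExp b l |Z| v := by
  unfold igExp
  gcongr 3
  rcases le_total 0 Z with h | h
  · rw [abs_of_nonneg h]
  · rw [abs_of_nonpos h]
    nlinarith [mul_nonneg (neg_nonneg.2 h) (mul_pos hl hv).le]

theorem exists_igExp_le {b l Z₀ k : ℝ} (hb : 0 < b) (hl : 0 < l) (hZ₀ : 0 < Z₀) (hk : 0 ≤ k)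
    (n : ℕ) : ∃ C, 0 < C ∧ ∀ Z v, Z₀ ≤ Z → 0 < v →
      v ^ (-k) * (1 + v) ^ n * igExp b l Z v ≤ C * (1 + Z) ^ n := by
  obtain ⟨C₁, hC₁, h₁⟩ := exists_rpow_neg_mul_exp_neg_div_le hk
    (c := Z₀ ^ 2 / (16 * b ^ 2)) (by positivity)
  obtain ⟨C₂, hC₂, h₂⟩ := exists_one_add_pow_mul_exp_neg_mul_le n
    (c := l ^ 2 / (16 * b ^ 2)) (by positivity)
  set D := (Z₀ / (2 * l)) ^ (-k) with hD
  have hD0 : 0 < D := by positivity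
  refine ⟨(C₁ + D) * (1 + 2 / l) ^ n + D * C₂, by positivity, fun Z v hZ hv => ?_⟩
  have hZ0 : 0 < Z := hZ₀.trans_le hZ
  have hE0 : 0 ≤ igExp b l Z v := (igExp_pos b l Z v).le
  have hexp1 : igExp b l Z v ≤ 1 := by
    unfold igExp
    rw [Real.exp_le_one_iff, neg_div, neg_nonpos]; positivity
  have hpow : Z₀ / (2 * l) ≤ v → v ^ (-k) ≤ D := fun h =>
    rpow_le_rpow_of_nonpos (by positivity) h (by linarith)
  have h1Z : 1 ≤ (1 + Z) ^ n := one_le_pow₀ (by linarith)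
  rcases le_or_gt v (2 * Z / l) with hA | hB
  · have e1 : v ^ (-k) * igExp b l Z v ≤ C₁ + D := by
      rcases le_or_gt v (Z / (2 * l)) with h | h
      · have h2 : l * v ≤ Z / 2 := by
          calc l * v ≤ l * (Z / (2 * l)) := by gcongr
            _ = Z / 2 := by field_simp
        have h3 : igExp b l Z v ≤ Real.exp (-(Z₀ ^ 2 / (16 * b ^ 2) / v)) := by
          unfold igExp
          gcongr 1
          rw [neg_div, neg_le_neg_iff, div_div, div_le_div_iff₀ (by positivity) (by positivity)]
          have : (Z₀ / 2) ^ 2 ≤ (Z - l * v) ^ 2 := by gcongr; linarith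
          have h5 : 0 < b ^ 2 * v := by positivity
          nlinarith
        calc _ ≤ v ^ (-k) * Real.exp (-(Z₀ ^ 2 / (16 * b ^ 2) / v)) := by gcongr
          _ ≤ C₁ := h₁ v hv
          _ ≤ _ := by linarith
      · have h2 := hpow (le_trans (by gcongr) h.le)
        calc _ ≤ D * 1 := by gcongr
          _ ≤ _ := by linarith
    have e2 : (1 + v) ≤ (1 + 2 / l) * (1 + Z) := by
      have : 2 * Z / l = 2 / l * Z := by ring
      have h0 : 0 < 2 / l := by positivity
      nlinarith
    calc _ = v ^ (-k) * igExp b l Z v * (1 + v) ^ n := by ring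
      _ ≤ (C₁ + D) * ((1 + 2 / l) * (1 + Z)) ^ n := by gcongr
      _ = (C₁ + D) * (1 + 2 / l) ^ n * (1 + Z) ^ n := by rw [mul_pow]; ring
      _ ≤ _ := by gcongr; linarith [mul_pos hD0 hC₂]
  · have h2 : Z < l * v / 2 := by
      have : 2 * Z < v * l := (div_lt_iff₀ hl).1 hB
      linarith
    have h3 := hpow (by
      rw [div_le_iff₀ (by positivity)]; nlinarith)
    have h4 : igExp b l Z v ≤ Real.exp (-(l ^ 2 / (16 * b ^ 2) * v)) := by
      unfold igExp
      gcongr 1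
      rw [neg_div, neg_le_neg_iff, div_mul_eq_mul_div, div_le_div_iff₀ (by positivity) (by positivity)]
      have : (l * v / 2) ^ 2 ≤ (l * v - Z) ^ 2 := by
        have : 0 < l * v := by positivity
        gcongr; linarith
      have h5 : 0 < b ^ 2 := by positivity
      nlinarith
    calc _ ≤ D * (1 + v) ^ n * Real.exp (-(l ^ 2 / (16 * b ^ 2) * v)) := by gcongr
      _ = D * ((1 + v) ^ n * Real.exp (-(l ^ 2 / (16 * b ^ 2) * v))) := by ring
      _ ≤ D * C₂ := by gcongr; exact h₂ v hv.le
      _ ≤ D * C₂ * (1 + Z) ^ n := le_mul_of_one_le_right (by positivity) h1Z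
      _ ≤ _ := by gcongr; linarith [show 0 < (C₁ + D) * (1 + 2 / l) ^ n by positivity]

theorem measurable_igExp (b l : ℝ) : Measurable fun p : ℝ × ℝ => igExp b l p.1 p.2 := by
  unfold igExp; fun_prop

theorem measurable_igDensity (b l : ℝ) : Measurable fun p : ℝ × ℝ => igDensity b l p.1 p.2 := by
  unfold igDensity
  exact ((measurable_fst.div_const _).mul (measurable_snd.pow_const _)).mul (measurable_igExp b l)

theorem igDensity_nonneg {b l Z v : ℝ} (hb : 0 < b) (hZ : 0 ≤ Z) (hv : 0 < v) :
    0 ≤ igDensity b l Z v := by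
  have := igExp_pos b l Z v
  unfold igDensity; positivity

theorem abs_igDensity_le {b l Z v : ℝ} (hb : 0 < b) (hl : 0 < l) (hv : 0 < v) :
    |igDensity b l Z v| ≤ igDensity b l |Z| v := by
  have h1 := igExp_le_abs (Z := Z) hb hl hv
  have h0 := igExp_pos b l Z v
  unfold igDensity
  rw [abs_mul, abs_mul, abs_div, abs_of_pos h0, abs_of_pos (show 0 < 2 * b * √π by
    have := Real.sqrt_pos.2 pi_pos; positivity), abs_of_pos (rpow_pos_of_pos hv _)]
  gcongr

theorem hasDerivAt_igExp_left {b l Z v : ℝ} (hb : 0 < b) (hv : 0 < v) :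
    HasDerivAt (fun Z => igExp b l Z v) (igExp b l Z v * (-(Z - l * v) / (2 * b ^ 2 * v))) Z := by
  unfold igExp
  have h1 : HasDerivAt (fun Z => -(Z - l * v) ^ 2 / (4 * b ^ 2 * v))
      (-(2 * (Z - l * v)) / (4 * b ^ 2 * v)) Z := by
    have := ((((hasDerivAt_id Z).sub_const (l * v)).fun_pow 2).fun_neg).div_const (4 * b ^ 2 * v)
    refine this.congr_deriv ?_
    simp
  refine h1.exp.congr_deriv ?_
  congr 1
  field_simp; ring

theorem hasDerivAt_igExp_right {b l Z v : ℝ} (hb : 0 < b) (hv : 0 < v) :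
    HasDerivAt (fun v => igExp b l Z v)
      (igExp b l Z v * (Z ^ 2 / (4 * b ^ 2 * v ^ 2) - l ^ 2 / (4 * b ^ 2))) v := by
  unfold igExp
  have h1 : HasDerivAt (fun v => -(Z - l * v) ^ 2 / (4 * b ^ 2 * v))
      (Z ^ 2 / (4 * b ^ 2 * v ^ 2) - l ^ 2 / (4 * b ^ 2)) v := by
    have := (((((hasDerivAt_id v).const_mul l).const_sub Z).fun_pow 2).fun_neg).fun_div
      ((hasDerivAt_id v).const_mul (4 * b ^ 2)) (ne_of_gt (by simp only [id]; positivity))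
    refine this.congr_deriv ?_
    simp; field_simp; ring
  exact h1.exp

/-- The derivative of the inverse Gaussian density in the level `Z`. -/
noncomputable def igDensityZ (b l Z v : ℝ) : ℝ :=
  1 / (2 * b * √π) * igExp b l Z v *
    ((1 + l * Z / (2 * b ^ 2)) * v ^ (-(3 / 2) : ℝ) - Z ^ 2 / (2 * b ^ 2) * v ^ (-(5 / 2) : ℝ))

/-- The second derivative of the inverse Gaussian density in the level `Z`. -/
noncomputable def igDensityZZ (b l Z v : ℝ) : ℝ :=
  1 / (2 * b * √π) * igExp b l Z v *
    ((l / b ^ 2 + l ^ 2 * Z / (4 * b ^ 4)) * v ^ (-(3 / 2) : ℝ) -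
      (3 * Z / (2 * b ^ 2) + l * Z ^ 2 / (2 * b ^ 4)) * v ^ (-(5 / 2) : ℝ) +
      Z ^ 3 / (4 * b ^ 4) * v ^ (-(7 / 2) : ℝ))

theorem rpow_neg_five_halves {v : ℝ} (hv : 0 < v) :
    v ^ (-(5 / 2) : ℝ) = v ^ (-(3 / 2) : ℝ) / v := by
  rw [← rpow_sub_one hv.ne']; norm_num

theorem rpow_neg_seven_halves {v : ℝ} (hv : 0 < v) :
    v ^ (-(7 / 2) : ℝ) = v ^ (-(3 / 2) : ℝ) / v ^ 2 := by
  rw [← rpow_sub_natCast hv.ne']; norm_num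

theorem hasDerivAt_igDensity {b l Z v : ℝ} (hb : 0 < b) (hv : 0 < v) :
    HasDerivAt (fun Z => igDensity b l Z v) (igDensityZ b l Z v) Z := by
  unfold igDensity igDensityZ
  have h := (((hasDerivAt_id Z).div_const (2 * b * √π)).mul_const (v ^ (-(3 / 2) : ℝ))).fun_mul
    (hasDerivAt_igExp_left (l := l) (Z := Z) hb hv)
  refine h.congr_deriv ?_
  rw [rpow_neg_five_halves hv]
  simp only [id]
  field_simp
  ring

theorem hasDerivAt_igDensityZ {b l Z v : ℝ} (hb : 0 < b) (hv : 0 < v) :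
    HasDerivAt (fun Z => igDensityZ b l Z v) (igDensityZZ b l Z v) Z := by
  unfold igDensityZ igDensityZZ
  have h2 : HasDerivAt (fun Z : ℝ => (1 + l * Z / (2 * b ^ 2)) * v ^ (-(3 / 2) : ℝ) -
      Z ^ 2 / (2 * b ^ 2) * v ^ (-(5 / 2) : ℝ))
      (l / (2 * b ^ 2) * v ^ (-(3 / 2) : ℝ) - 2 * Z / (2 * b ^ 2) * v ^ (-(5 / 2) : ℝ)) Z := by
    have := (((((hasDerivAt_id Z).const_mul l).div_const (2 * b ^ 2)).const_add 1).mul_const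
      (v ^ (-(3 / 2) : ℝ))).fun_sub ((((hasDerivAt_id Z).fun_pow 2).div_const (2 * b ^ 2)).mul_const
      (v ^ (-(5 / 2) : ℝ)))
    refine this.congr_deriv ?_
    simp
  have h := ((hasDerivAt_igExp_left (l := l) (Z := Z) hb hv).const_mul (1 / (2 * b * √π))).fun_mul h2
  refine h.congr_deriv ?_
  rw [rpow_neg_five_halves hv, rpow_neg_seven_halves hv]
  field_simp
  ring

theorem hasDerivAt_igDensity_right {b l Z v : ℝ} (hb : 0 < b) (hv : 0 < v) :
    HasDerivAt (fun v => igDensity b l Z v)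
      (b ^ 2 * igDensityZZ b l Z v - l * igDensityZ b l Z v) v := by
  unfold igDensity igDensityZZ igDensityZ
  have h := ((Real.hasDerivAt_rpow_const (x := v) (p := -(3 / 2)) (Or.inl hv.ne')).const_mul
    (Z / (2 * b * √π))).fun_mul (hasDerivAt_igExp_right (l := l) (Z := Z) hb hv)
  refine h.congr_deriv ?_
  rw [rpow_neg_five_halves hv, rpow_neg_seven_halves hv, rpow_sub_one hv.ne']
  field_simp
  ring

/-! ### The complementary error function -/

theorem integrable_exp_neg_sq : Integrable fun s : ℝ => Real.exp (-s ^ 2) := by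
  simpa using integrable_exp_neg_mul_sq one_pos

theorem integral_exp_neg_sq : ∫ s : ℝ, Real.exp (-s ^ 2) = √π := by
  simpa using integral_gaussian 1

theorem erfc_eq (y : ℝ) :
    erfc y = (2 / √π) * ((∫ s in Ioi (0 : ℝ), Real.exp (-s ^ 2)) -
      ∫ s in (0 : ℝ)..y, Real.exp (-s ^ 2)) := by
  unfold erfc
  congr 1
  have h := intervalIntegral.integral_interval_add_Ioi (a := 0) (b := y)
    integrable_exp_neg_sq.integrableOn integrable_exp_neg_sq.integrableOn
  linarith

theorem hasDerivAt_erfc (y : ℝ) : HasDerivAt erfc (-(2 / √π * Real.exp (-y ^ 2))) y := by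
  have hc : Continuous fun s : ℝ => Real.exp (-s ^ 2) := by fun_prop
  have h := intervalIntegral.integral_hasDerivAt_right (hc.intervalIntegrable 0 y)
    (hc.stronglyMeasurableAtFilter _ _) hc.continuousAt
  have h2 := (h.const_sub (∫ s in Ioi (0 : ℝ), Real.exp (-s ^ 2))).const_mul (2 / √π)
  rw [funext erfc_eq]
  exact h2.congr_deriv (by ring)

theorem continuous_erfc : Continuous erfc :=
  continuous_iff_continuousAt.2 fun y => (hasDerivAt_erfc y).continuousAt

theorem erfc_nonneg (y : ℝ) : 0 ≤ erfc y := by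
  unfold erfc
  have := integral_nonneg (μ := volume.restrict (Ioi y)) (f := fun s : ℝ => Real.exp (-s ^ 2))
    fun s => (Real.exp_pos _).le
  positivity

theorem tendsto_erfc_atTop : Tendsto erfc atTop (𝓝 0) := by
  have h := intervalIntegral_tendsto_integral_Ioi 0 integrable_exp_neg_sq.integrableOn tendsto_id
  have h2 := (h.const_sub (∫ s in Ioi (0 : ℝ), Real.exp (-s ^ 2))).const_mul (2 / √π)
  rw [sub_self, mul_zero] at h2
  exact h2.congr fun y => (erfc_eq y).symm

theorem tendsto_erfc_atBot : Tendsto erfc atBot (𝓝 2) := by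
  have h := intervalIntegral_tendsto_integral_Iic 0 integrable_exp_neg_sq.integrableOn tendsto_id
  have h2 := (h.const_add (∫ s in Ioi (0 : ℝ), Real.exp (-s ^ 2))).const_mul (2 / √π)
  have h3 : (∫ s in Ioi (0 : ℝ), Real.exp (-s ^ 2)) + ∫ s in Iic (0 : ℝ), Real.exp (-s ^ 2) = √π := by
    rw [add_comm, ← integral_exp_neg_sq]
    exact intervalIntegral.integral_Iic_add_Ioi integrable_exp_neg_sq.integrableOn
      integrable_exp_neg_sq.integrableOn
  rw [h3, div_mul_cancel₀ _ (Real.sqrt_pos.2 pi_pos).ne'] at h2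
  refine h2.congr fun y => ?_
  simp only [id]
  rw [erfc_eq, intervalIntegral.integral_symm 0 y]
  ring

theorem erfc_le {y : ℝ} (hy : 0 < y) : erfc y ≤ Real.exp (-y ^ 2) / (√π * y) := by
  have hd : ∀ s ∈ Ici y, HasDerivAt (fun s : ℝ => -(Real.exp (-s ^ 2) / (2 * y)))
      (s / y * Real.exp (-s ^ 2)) s := fun s _ => by
    have := ((((hasDerivAt_id s).fun_pow 2).fun_neg.exp).div_const (2 * y)).fun_neg
    refine this.congr_deriv ?_
    simp; field_simp
  have hn : ∀ s ∈ Ioi y, 0 ≤ s / y * Real.exp (-s ^ 2) := fun s hs => by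
    have := hy.trans hs
    positivity
  have hlim : Tendsto (fun s : ℝ => -(Real.exp (-s ^ 2) / (2 * y))) atTop (𝓝 0) := by
    have : Tendsto (fun s : ℝ => Real.exp (-s ^ 2)) atTop (𝓝 0) :=
      Real.tendsto_exp_neg_atTop_nhds_zero.comp (tendsto_pow_atTop two_ne_zero)
    simpa using (this.div_const (2 * y)).neg
  have h1 := integral_Ioi_of_hasDerivAt_of_nonneg' hd hn hlim
  have h2 := integrableOn_Ioi_deriv_of_nonneg' hd hn hlim
  have h3 : ∫ s in Ioi y, Real.exp (-s ^ 2) ≤ ∫ s in Ioi y, s / y * Real.exp (-s ^ 2) := by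
    refine setIntegral_mono_on integrable_exp_neg_sq.integrableOn h2 measurableSet_Ioi fun s hs => ?_
    refine le_mul_of_one_le_left (Real.exp_pos _).le ?_
    rw [one_le_div hy]; exact le_of_lt hs
  rw [h1] at h3
  have := Real.sqrt_pos.2 pi_pos
  unfold erfc
  calc _ ≤ 2 / √π * (0 - -(Real.exp (-y ^ 2) / (2 * y))) := by gcongr
    _ = _ := by field_simp; ring

/-! ### Moments of the inverse Gaussian density -/

theorem integrable_one_add_abs_sq_inv : Integrable fun v : ℝ => ((1 + |v|) ^ 2)⁻¹ := by
  have := integrable_one_add_norm (E := ℝ) (μ := volume) (r := 2) (by simp)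
  refine this.congr (Eventually.of_forall fun v => ?_)
  simp only [norm_eq_abs]
  rw [rpow_neg (by positivity)]
  norm_cast

theorem integrableOn_Ioi_of_abs_le {f : ℝ → ℝ} {C : ℝ} (hf : Measurable f)
    (h : ∀ v, 0 < v → |f v| ≤ C * ((1 + v) ^ 2)⁻¹) : IntegrableOn f (Ioi 0) := by
  refine ((integrable_one_add_abs_sq_inv.const_mul C).integrableOn (s := Ioi 0)).mono'
    hf.aestronglyMeasurable ?_
  refine (ae_restrict_mem measurableSet_Ioi).mono fun v hv => ?_
  rw [abs_of_pos (show 0 < v from hv)]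
  exact h v hv

theorem exists_rpow_mul_igExp_le {b l Z₀ : ℝ} (hb : 0 < b) (hl : 0 < l) (hZ₀ : 0 < Z₀) (k : ℝ) :
    ∃ C, 0 < C ∧ ∃ n : ℕ, ∀ Z v, Z₀ ≤ Z → 0 < v →
      v ^ (-k) * igExp b l Z v ≤ C * (1 + Z) ^ n * ((1 + v) ^ 2)⁻¹ := by
  obtain ⟨m, hm⟩ := exists_nat_ge (-k)
  obtain ⟨C, hC, h⟩ := exists_igExp_le (k := k + m) hb hl hZ₀ (by linarith) (m + 2)
  refine ⟨C, hC, m + 2, fun Z v hZ hv => ?_⟩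
  rw [le_mul_inv_iff₀ (by positivity)]
  refine le_trans ?_ (h Z v hZ hv)
  have hE := (igExp_pos b l Z v).le
  have h1 : v ^ (-k) = v ^ (-(k + m)) * v ^ m := by
    rw [← rpow_natCast v m, ← rpow_add hv]; congr 1; ring
  rw [h1, pow_add]
  calc _ = v ^ (-(k + m)) * (v ^ m * (1 + v) ^ 2) * igExp b l Z v := by ring
    _ ≤ v ^ (-(k + m)) * ((1 + v) ^ m * (1 + v) ^ 2) * igExp b l Z v := by
      gcongr; linarith

theorem integrableOn_rpow_mul_igExp {b l Z : ℝ} (hb : 0 < b) (hl : 0 < l) (hZ : 0 < Z) (k : ℝ) :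
    IntegrableOn (fun v => v ^ (-k) * igExp b l Z v) (Ioi 0) := by
  obtain ⟨C, hC, n, h⟩ := exists_rpow_mul_igExp_le hb hl hZ k
  refine integrableOn_Ioi_of_abs_le (C := C * (1 + Z) ^ n)
    ((measurable_id.pow_const _).mul ((measurable_igExp b l).comp measurable_prodMk_left))
    fun v hv => ?_
  have hE := (igExp_pos b l Z v).le
  rw [abs_of_nonneg (by positivity)]
  exact h Z v le_rfl hv

theorem integral_Ioi_of_hasDerivAt_of_tendsto_nhdsGT {F F' : ℝ → ℝ} {m n : ℝ}
    (hF : ∀ v ∈ Ioi (0 : ℝ), HasDerivAt F (F' v) v) (hi : IntegrableOn F' (Ioi 0))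
    (h0 : Tendsto F (𝓝[>] 0) (𝓝 m)) (h1 : Tendsto F atTop (𝓝 n)) :
    ∫ v in Ioi 0, F' v = n - m := by
  have := integral_Ioi_deriv_mul_eq_sub (u := F) (v := fun _ => 1) (u' := F') (v' := fun _ => 0)
    (a := 0) (a' := m) (b' := n) hF (fun v _ => hasDerivAt_const v 1)
    (by refine hi.congr_fun (fun v _ => ?_) measurableSet_Ioi; simp)
    (by refine h0.congr fun v => ?_; simp) (by refine h1.congr fun v => ?_; simp)
  rw [← this]
  simp

theorem rpow_neg_three_halves {v : ℝ} (hv : 0 < v) : v ^ (-(3 / 2) : ℝ) = (v * √v)⁻¹ := by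
  rw [rpow_neg hv.le, Real.sqrt_eq_rpow]
  nth_rewrite 2 [← rpow_one v]
  rw [← rpow_add hv]; norm_num

theorem rpow_neg_one_half {v : ℝ} (hv : 0 < v) : v ^ (-(1 / 2) : ℝ) = (√v)⁻¹ := by
  rw [rpow_neg hv.le, Real.sqrt_eq_rpow]

theorem hasDerivAt_erfc_comp {b Z c v : ℝ} (hb : 0 < b) (hv : 0 < v) :
    HasDerivAt (fun v => erfc ((Z + c * v) / (2 * b * √v)))
      ((Z - c * v) / (2 * b * √π) * v ^ (-(3 / 2) : ℝ) *
        Real.exp (-((Z + c * v) / (2 * b * √v)) ^ 2)) v := by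
  have hs := Real.sqrt_pos.2 hv
  have h1 := (((hasDerivAt_id v).const_mul c).const_add Z).fun_div
    ((Real.hasDerivAt_sqrt hv.ne').const_mul (2 * b)) (by positivity)
  have h2 := (hasDerivAt_erfc ((Z + c * v) / (2 * b * √v))).comp v h1
  refine h2.congr_deriv ?_
  rw [rpow_neg_three_halves hv]
  have hv2 : v = √v ^ 2 := (Real.sq_sqrt hv.le).symm
  have hp := Real.sqrt_pos.2 pi_pos
  simp only [id]
  generalize Real.exp (-((Z + c * v) / (2 * b * √v)) ^ 2) = e
  generalize √v = s at *
  subst hv2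
  field_simp
  ring

theorem exp_neg_sq_eq_igExp {b l Z v : ℝ} (hv : 0 < v) :
    Real.exp (-((Z + -l * v) / (2 * b * √v)) ^ 2) = igExp b l Z v := by
  unfold igExp
  rw [div_pow, mul_pow, Real.sq_sqrt hv.le]
  congr 1; ring

theorem exp_neg_sq_eq_igExp_mul {b l Z v : ℝ} (hb : 0 < b) (hv : 0 < v) :
    Real.exp (-((Z + l * v) / (2 * b * √v)) ^ 2) = igExp b l Z v * Real.exp (-(l * Z / b ^ 2)) := by
  unfold igExp
  rw [div_pow, mul_pow, Real.sq_sqrt hv.le, ← Real.exp_add]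
  congr 1
  field_simp
  ring

theorem tendsto_sqrt_nhdsGT_zero : Tendsto (fun v : ℝ => √v) (𝓝[>] 0) (𝓝[>] 0) := by
  refine tendsto_nhdsWithin_iff.2 ⟨?_, ?_⟩
  · have := (Real.continuous_sqrt.tendsto 0).mono_left (nhdsWithin_le_nhds (s := Ioi (0 : ℝ)))
    simpa using this
  · exact (eventually_mem_nhdsWithin).mono fun v hv => Real.sqrt_pos.2 hv

theorem erfc_arg_eq {b Z c v : ℝ} (hb : 0 < b) (hv : 0 < v) :
    (Z + c * v) / (2 * b * √v) = Z / (2 * b) * (√v)⁻¹ + c / (2 * b) * √v := by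
  have hs := Real.sqrt_pos.2 hv
  have hv2 : v = √v ^ 2 := (Real.sq_sqrt hv.le).symm
  generalize √v = s at *
  subst hv2
  field_simp

theorem tendsto_erfc_arg_nhdsGT {b Z : ℝ} (hb : 0 < b) (hZ : 0 < Z) (c : ℝ) :
    Tendsto (fun v => (Z + c * v) / (2 * b * √v)) (𝓝[>] 0) atTop := by
  have h1 : Tendsto (fun v : ℝ => Z / (2 * b) * (√v)⁻¹) (𝓝[>] 0) atTop :=
    (tendsto_inv_nhdsGT_zero.comp tendsto_sqrt_nhdsGT_zero).const_mul_atTop (by positivity)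
  have h2 : Tendsto (fun v : ℝ => c / (2 * b) * √v) (𝓝[>] 0) (𝓝 (c / (2 * b) * 0)) :=
    (tendsto_sqrt_nhdsGT_zero.mono_right nhdsWithin_le_nhds).const_mul _
  refine (h1.atTop_add h2).congr' ?_
  filter_upwards [self_mem_nhdsWithin] with v hv
  exact (erfc_arg_eq hb hv).symm

theorem tendsto_erfc_arg_atTop {b c : ℝ} (hb : 0 < b) (hc : 0 < c) (Z : ℝ) :
    Tendsto (fun v => (Z + c * v) / (2 * b * √v)) atTop atTop := by
  have h1 : Tendsto (fun v : ℝ => c / (2 * b) * √v) atTop atTop :=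
    Real.tendsto_sqrt_atTop.const_mul_atTop (by positivity)
  have h2 : Tendsto (fun v : ℝ => Z / (2 * b) * (√v)⁻¹) atTop (𝓝 (Z / (2 * b) * 0)) :=
    (tendsto_inv_atTop_zero.comp Real.tendsto_sqrt_atTop).const_mul _
  refine (h2.add_atTop h1).congr' ?_
  filter_upwards [eventually_gt_atTop 0] with v hv
  exact (erfc_arg_eq hb hv).symm

theorem tendsto_erfc_arg_atBot {b l : ℝ} (hb : 0 < b) (hl : 0 < l) (Z : ℝ) :
    Tendsto (fun v => (Z + -l * v) / (2 * b * √v)) atTop atBot := by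
  have := tendsto_neg_atTop_atBot.comp (tendsto_erfc_arg_atTop hb hl (-Z))
  refine this.congr fun v => ?_
  simp only [Function.comp]
  ring

theorem integrableOn_rpow_mul_igDensity {b l Z : ℝ} (hb : 0 < b) (hl : 0 < l) (hZ : 0 < Z)
    (k : ℝ) : IntegrableOn (fun v => v ^ (-k) * igDensity b l Z v) (Ioi 0) := by
  refine IntegrableOn.congr_fun
    ((integrableOn_rpow_mul_igExp hb hl hZ (k + 3 / 2)).const_mul (Z / (2 * b * √π)))
    (fun v (hv : 0 < v) => ?_) measurableSet_Ioi
  simp only [igDensity]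
  rw [show -(k + 3 / 2) = -k + -(3 / 2) by ring, rpow_add hv]
  ring

theorem integrableOn_igDensity {b l Z : ℝ} (hb : 0 < b) (hl : 0 < l) (hZ : 0 < Z) :
    IntegrableOn (igDensity b l Z) (Ioi 0) := by
  simpa using integrableOn_rpow_mul_igDensity hb hl hZ 0

theorem integrableOn_mul_igDensity {b l Z : ℝ} (hb : 0 < b) (hl : 0 < l) (hZ : 0 < Z) :
    IntegrableOn (fun v => v * igDensity b l Z v) (Ioi 0) := by
  simpa using integrableOn_rpow_mul_igDensity hb hl hZ (-1)

theorem integrableOn_igDensity_div {b l Z : ℝ} (hb : 0 < b) (hl : 0 < l) (hZ : 0 < Z) :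
    IntegrableOn (fun v => igDensity b l Z v / v) (Ioi 0) := by
  refine (integrableOn_rpow_mul_igDensity hb hl hZ 1).congr_fun (fun v (hv : 0 < v) => ?_)
    measurableSet_Ioi
  simp only [rpow_neg_one]
  field_simp

theorem integral_igDensity_add_sub {b l Z : ℝ} (hb : 0 < b) (hl : 0 < l) (hZ : 0 < Z) :
    (∫ v in Ioi 0, igDensity b l Z v) + l / Z * (∫ v in Ioi 0, v * igDensity b l Z v) = 2 ∧
    (∫ v in Ioi 0, igDensity b l Z v) - l / Z * (∫ v in Ioi 0, v * igDensity b l Z v) = 0 := by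
  have i1 := integrableOn_igDensity hb hl hZ
  have i2 := (integrableOn_mul_igDensity hb hl hZ).const_mul (l / Z)
  constructor
  · rw [← integral_const_mul, ← integral_add i1 i2]
    refine (integral_Ioi_of_hasDerivAt_of_tendsto_nhdsGT (m := 0) (n := 2)
      (F := fun v => erfc ((Z + -l * v) / (2 * b * √v))) (fun v (hv : 0 < v) => ?_) (i1.add i2)
      (tendsto_erfc_atTop.comp (tendsto_erfc_arg_nhdsGT hb hZ _))
      (tendsto_erfc_atBot.comp (tendsto_erfc_arg_atBot hb hl Z))).trans (by ring)
    refine (hasDerivAt_erfc_comp hb hv).congr_deriv ?_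
    rw [exp_neg_sq_eq_igExp hv]
    simp only [igDensity]
    field_simp
    simp only [Pi.add_apply, igDensity]
    field_simp
    ring
  · rw [← integral_const_mul, ← integral_sub i1 i2]
    have i3 := (i1.sub i2).mul_const (Real.exp (-(l * Z / b ^ 2)))
    have := integral_Ioi_of_hasDerivAt_of_tendsto_nhdsGT (m := 0) (n := 0)
      (F := fun v => erfc ((Z + l * v) / (2 * b * √v))) (fun v (hv : 0 < v) => ?_) i3
      (tendsto_erfc_atTop.comp (tendsto_erfc_arg_nhdsGT hb hZ _))
      (tendsto_erfc_atTop.comp (tendsto_erfc_arg_atTop hb hl Z))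
    · rw [integral_mul_const, sub_self] at this
      exact (mul_eq_zero.1 this).resolve_right (Real.exp_pos _).ne'
    refine (hasDerivAt_erfc_comp hb hv).congr_deriv ?_
    rw [exp_neg_sq_eq_igExp_mul hb hv]
    simp only [Pi.sub_apply, igDensity]
    field_simp

theorem integral_igDensity {b l Z : ℝ} (hb : 0 < b) (hl : 0 < l) (hZ : 0 < Z) :
    ∫ v in Ioi 0, igDensity b l Z v = 1 := by
  linarith [(integral_igDensity_add_sub hb hl hZ).1, (integral_igDensity_add_sub hb hl hZ).2]

theorem integral_mul_igDensity {b l Z : ℝ} (hb : 0 < b) (hl : 0 < l) (hZ : 0 < Z) :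
    ∫ v in Ioi 0, v * igDensity b l Z v = Z / l := by
  have h := (integral_igDensity_add_sub hb hl hZ).2
  rw [integral_igDensity hb hl hZ] at h
  field_simp at h ⊢
  linarith

theorem tendsto_rpow_mul_igExp_nhdsGT {b l Z : ℝ} (hb : 0 < b) (hl : 0 < l) (hZ : 0 < Z)
    {k : ℝ} (hk : 0 ≤ k) : Tendsto (fun v => v ^ (-k) * igExp b l Z v) (𝓝[>] 0) (𝓝 0) := by
  obtain ⟨C, hC, h⟩ := exists_igExp_le (k := k + 1) hb hl hZ (by linarith) 0
  have h0 : Tendsto (fun v : ℝ => C * v) (𝓝[>] 0) (𝓝 0) := by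
    have : Tendsto (fun v : ℝ => C * v) (𝓝 0) (𝓝 (C * 0)) := tendsto_id.const_mul C
    rw [mul_zero] at this
    exact this.mono_left nhdsWithin_le_nhds
  refine squeeze_zero' ?_ ?_ h0
  · filter_upwards [self_mem_nhdsWithin] with v (hv : 0 < v)
    have := (igExp_pos b l Z v).le
    positivity
  · filter_upwards [self_mem_nhdsWithin] with v (hv : 0 < v)
    have := h Z v le_rfl hv
    rw [show -(k + 1) = -k - 1 by ring, rpow_sub_one hv.ne'] at this
    simp only [pow_zero, mul_one] at this
    calc _ = v ^ (-k) / v * igExp b l Z v * v := by field_simp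
      _ ≤ C * v := by gcongr

theorem tendsto_rpow_mul_igExp_atTop {b l Z : ℝ} (hb : 0 < b) (hl : 0 < l) (hZ : 0 < Z)
    {k : ℝ} (hk : 0 ≤ k) : Tendsto (fun v => v ^ (-k) * igExp b l Z v) atTop (𝓝 0) := by
  obtain ⟨C, hC, h⟩ := exists_igExp_le (k := k) hb hl hZ hk 1
  have h0 : Tendsto (fun v : ℝ => C * (1 + Z) * v⁻¹) atTop (𝓝 0) := by
    have := tendsto_inv_atTop_zero (𝕜 := ℝ).const_mul (C * (1 + Z))
    rwa [mul_zero] at this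
  refine squeeze_zero' ?_ ?_ h0
  · filter_upwards [eventually_gt_atTop 0] with v (hv : 0 < v)
    have := (igExp_pos b l Z v).le
    positivity
  · filter_upwards [eventually_gt_atTop 0] with v (hv : 0 < v)
    have h1 := h Z v le_rfl hv
    have := (igExp_pos b l Z v).le
    rw [le_mul_inv_iff₀ hv]
    rw [pow_one, pow_one] at h1
    refine le_trans ?_ h1
    calc _ = v ^ (-k) * v * igExp b l Z v := by ring
      _ ≤ _ := by gcongr; linarith

theorem integral_igDensity_div {b l Z : ℝ} (hb : 0 < b) (hl : 0 < l) (hZ : 0 < Z) :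
    ∫ v in Ioi 0, igDensity b l Z v / v = 2 * b ^ 2 / Z ^ 2 + l / Z := by
  have i1 := (integrableOn_igDensity hb hl hZ).const_mul (-1 / 2)
  have i2 := (integrableOn_igDensity_div hb hl hZ).const_mul (Z ^ 2 / (4 * b ^ 2))
  have i3 := (integrableOn_mul_igDensity hb hl hZ).const_mul (l ^ 2 / (4 * b ^ 2))
  have hp := Real.sqrt_pos.2 pi_pos
  have t1 := (tendsto_rpow_mul_igExp_nhdsGT hb hl hZ (k := 1 / 2) (by norm_num)).const_mul
    (Z / (2 * b * √π))
  have t2 := (tendsto_rpow_mul_igExp_atTop hb hl hZ (k := 1 / 2) (by norm_num)).const_mul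
    (Z / (2 * b * √π))
  have := integral_Ioi_of_hasDerivAt_of_tendsto_nhdsGT (m := 0) (n := 0)
    (F := fun v => Z / (2 * b * √π) * (v ^ (-(1 / 2) : ℝ) * igExp b l Z v))
    (fun v (hv : 0 < v) => ?_) ((i1.add i2).sub i3)
    (by simpa using t1) (by simpa using t2)
  · rw [integral_sub' (i1.add i2) i3, integral_add' i1 i2, integral_const_mul, integral_const_mul,
      integral_const_mul, integral_igDensity hb hl hZ, integral_mul_igDensity hb hl hZ] at this
    field_simp at this ⊢
    linarith
  · have h := ((Real.hasDerivAt_rpow_const (x := v) (p := -(1 / 2)) (Or.inl hv.ne')).fun_mul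
      (hasDerivAt_igExp_right (l := l) (Z := Z) hb hv)).const_mul (Z / (2 * b * √π))
    refine h.congr_deriv ?_
    simp only [Pi.sub_apply, Pi.add_apply, igDensity]
    rw [rpow_sub_one hv.ne', rpow_neg_three_halves hv, rpow_neg_one_half hv]
    have hs := Real.sqrt_pos.2 hv
    field_simp
    ring

theorem integral_abs_igDensity_le {b l : ℝ} (hb : 0 < b) (hl : 0 < l) (Z : ℝ) :
    IntegrableOn (igDensity b l Z) (Ioi 0) ∧ ∫ v in Ioi 0, |igDensity b l Z v| ≤ 1 := by
  rcases eq_or_ne Z 0 with rfl | hZ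
  · have : igDensity b l 0 = fun _ => 0 := by ext v; simp [igDensity]
    simp [this]
  have hZ' := abs_pos.2 hZ
  have hm : Measurable (igDensity b l Z) := (measurable_igDensity b l).comp measurable_prodMk_left
  have hle : ∀ᵐ v ∂volume.restrict (Ioi (0 : ℝ)), ‖igDensity b l Z v‖ ≤ igDensity b l |Z| v :=
    (ae_restrict_mem measurableSet_Ioi).mono fun v hv => abs_igDensity_le hb hl hv
  have hi : IntegrableOn (igDensity b l Z) (Ioi 0) :=
    (integrableOn_igDensity hb hl hZ').mono' hm.aestronglyMeasurable hle
  refine ⟨hi, ?_⟩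
  rw [← integral_igDensity hb hl hZ']
  exact integral_mono_ae hi.abs (integrableOn_igDensity hb hl hZ') hle

/-! ### Decay of the inverse Gaussian density and its derivatives -/

theorem exists_rpow_mul_igExp_weight_le {b l Z₀ k j : ℝ} (hb : 0 < b) (hl : 0 < l) (hZ₀ : 0 < Z₀)
    (hk : 0 ≤ k) (hj : 0 ≤ j) (n : ℕ) : ∃ C, 0 < C ∧ ∀ Z v, Z₀ ≤ Z → 0 < v →
      v ^ (-k) * (1 + v) ^ n * (v ^ (-j) * igExp b l Z v) ≤ C * (1 + Z) ^ n := by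
  obtain ⟨C, hC, h⟩ := exists_igExp_le (k := k + j) hb hl hZ₀ (by linarith) n
  refine ⟨C, hC, fun Z v hZ hv => le_trans (le_of_eq ?_) (h Z v hZ hv)⟩
  rw [neg_add, rpow_add hv]
  ring

theorem exists_igDensity_le {b l Z₀ k : ℝ} (hb : 0 < b) (hl : 0 < l) (hZ₀ : 0 < Z₀) (hk : 0 ≤ k)
    (n : ℕ) : ∃ C, 0 < C ∧ ∀ Z v, Z₀ ≤ Z → 0 < v →
      v ^ (-k) * (1 + v) ^ n * |igDensity b l Z v| ≤ C * (1 + Z) ^ (n + 3) := by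
  obtain ⟨C, hC, h⟩ := exists_rpow_mul_igExp_weight_le (j := 3 / 2) hb hl hZ₀ hk (by norm_num) n
  have hp := Real.sqrt_pos.2 pi_pos
  refine ⟨1 / (2 * b * √π) * C, by positivity, fun Z v hZ hv => ?_⟩
  have hZ0 : 0 < Z := hZ₀.trans_le hZ
  have hE := igExp_pos b l Z v
  have h1 := h Z v hZ hv
  rw [abs_of_nonneg (igDensity_nonneg hb hZ0.le hv), igDensity]
  calc _ = 1 / (2 * b * √π) * Z * (v ^ (-k) * (1 + v) ^ n *
        (v ^ (-(3 / 2) : ℝ) * igExp b l Z v)) := by ring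
    _ ≤ 1 / (2 * b * √π) * (1 + Z) ^ 3 * (C * (1 + Z) ^ n) := by
      gcongr
      nlinarith [pow_pos hZ0 2, pow_pos hZ0 3]
    _ = _ := by ring

theorem exists_igDensityZ_le {b l Z₀ k : ℝ} (hb : 0 < b) (hl : 0 < l) (hZ₀ : 0 < Z₀) (hk : 0 ≤ k)
    (n : ℕ) : ∃ C, 0 < C ∧ ∀ Z v, Z₀ ≤ Z → 0 < v →
      v ^ (-k) * (1 + v) ^ n * |igDensityZ b l Z v| ≤ C * (1 + Z) ^ (n + 3) := by
  obtain ⟨C₁, hC₁, h₁⟩ := exists_rpow_mul_igExp_weight_le (j := 3 / 2) hb hl hZ₀ hk (by norm_num) n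
  obtain ⟨C₂, hC₂, h₂⟩ := exists_rpow_mul_igExp_weight_le (j := 5 / 2) hb hl hZ₀ hk (by norm_num) n
  have hp := Real.sqrt_pos.2 pi_pos
  refine ⟨1 / (2 * b * √π) * ((1 + l / (2 * b ^ 2)) * C₁ + 1 / (2 * b ^ 2) * C₂), by positivity,
    fun Z v hZ hv => ?_⟩
  have hZ0 : 0 < Z := hZ₀.trans_le hZ
  have hE := igExp_pos b l Z v
  have h1 := h₁ Z v hZ hv
  have h2 := h₂ Z v hZ hv
  have e1 : 1 ≤ (1 + Z) ^ 3 := one_le_pow₀ (by linarith)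
  have e2 : Z ≤ (1 + Z) ^ 3 := by nlinarith [pow_pos hZ0 2, pow_pos hZ0 3]
  have e3 : Z ^ 2 ≤ (1 + Z) ^ 3 := by nlinarith [pow_pos hZ0 2, pow_pos hZ0 3]
  have habs : |igDensityZ b l Z v| ≤ 1 / (2 * b * √π) * igExp b l Z v *
      ((1 + l / (2 * b ^ 2) * Z) * v ^ (-(3 / 2) : ℝ) + 1 / (2 * b ^ 2) * Z ^ 2 * v ^ (-(5 / 2) : ℝ)) := by
    unfold igDensityZ
    rw [abs_mul, abs_of_pos (show 0 < 1 / (2 * b * √π) * igExp b l Z v by positivity)]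
    gcongr
    refine (abs_sub _ _).trans (le_of_eq ?_)
    rw [abs_of_pos (by positivity), abs_of_pos (by positivity)]
    ring
  calc _ ≤ v ^ (-k) * (1 + v) ^ n * (1 / (2 * b * √π) * igExp b l Z v *
      ((1 + l / (2 * b ^ 2) * Z) * v ^ (-(3 / 2) : ℝ) +
        1 / (2 * b ^ 2) * Z ^ 2 * v ^ (-(5 / 2) : ℝ))) := by gcongr
    _ = 1 / (2 * b * √π) * ((1 + l / (2 * b ^ 2) * Z) * (v ^ (-k) * (1 + v) ^ n *
        (v ^ (-(3 / 2) : ℝ) * igExp b l Z v)) + 1 / (2 * b ^ 2) * Z ^ 2 * (v ^ (-k) * (1 + v) ^ n *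
        (v ^ (-(5 / 2) : ℝ) * igExp b l Z v))) := by ring
    _ ≤ 1 / (2 * b * √π) * (((1 + Z) ^ 3 + l / (2 * b ^ 2) * (1 + Z) ^ 3) * (C₁ * (1 + Z) ^ n) +
        1 / (2 * b ^ 2) * (1 + Z) ^ 3 * (C₂ * (1 + Z) ^ n)) := by gcongr
    _ = _ := by ring

theorem exists_igDensityZZ_le {b l Z₀ k : ℝ} (hb : 0 < b) (hl : 0 < l) (hZ₀ : 0 < Z₀) (hk : 0 ≤ k)
    (n : ℕ) : ∃ C, 0 < C ∧ ∀ Z v, Z₀ ≤ Z → 0 < v →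
      v ^ (-k) * (1 + v) ^ n * |igDensityZZ b l Z v| ≤ C * (1 + Z) ^ (n + 3) := by
  obtain ⟨C₁, hC₁, h₁⟩ := exists_rpow_mul_igExp_weight_le (j := 3 / 2) hb hl hZ₀ hk (by norm_num) n
  obtain ⟨C₂, hC₂, h₂⟩ := exists_rpow_mul_igExp_weight_le (j := 5 / 2) hb hl hZ₀ hk (by norm_num) n
  obtain ⟨C₃, hC₃, h₃⟩ := exists_rpow_mul_igExp_weight_le (j := 7 / 2) hb hl hZ₀ hk (by norm_num) n
  have hp := Real.sqrt_pos.2 pi_pos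
  refine ⟨1 / (2 * b * √π) * ((l / b ^ 2 + l ^ 2 / (4 * b ^ 4)) * C₁ +
    (3 / (2 * b ^ 2) + l / (2 * b ^ 4)) * C₂ + 1 / (4 * b ^ 4) * C₃), by positivity,
    fun Z v hZ hv => ?_⟩
  have hZ0 : 0 < Z := hZ₀.trans_le hZ
  have hE := igExp_pos b l Z v
  have h1 := h₁ Z v hZ hv
  have h2 := h₂ Z v hZ hv
  have h3 := h₃ Z v hZ hv
  have e1 : 1 ≤ (1 + Z) ^ 3 := one_le_pow₀ (by linarith)
  have e2 : Z ≤ (1 + Z) ^ 3 := by nlinarith [pow_pos hZ0 2, pow_pos hZ0 3]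
  have e3 : Z ^ 2 ≤ (1 + Z) ^ 3 := by nlinarith [pow_pos hZ0 2, pow_pos hZ0 3]
  have e4 : Z ^ 3 ≤ (1 + Z) ^ 3 := by gcongr; linarith
  have habs : |igDensityZZ b l Z v| ≤ 1 / (2 * b * √π) * igExp b l Z v *
      ((l / b ^ 2 * 1 + l ^ 2 / (4 * b ^ 4) * Z) * v ^ (-(3 / 2) : ℝ) +
      (3 / (2 * b ^ 2) * Z + l / (2 * b ^ 4) * Z ^ 2) * v ^ (-(5 / 2) : ℝ) +
      1 / (4 * b ^ 4) * Z ^ 3 * v ^ (-(7 / 2) : ℝ)) := by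
    unfold igDensityZZ
    rw [abs_mul, abs_of_pos (show 0 < 1 / (2 * b * √π) * igExp b l Z v by positivity)]
    gcongr
    refine (abs_add_le _ _).trans ((add_le_add_left (abs_sub _ _) _).trans (le_of_eq ?_))
    rw [abs_of_pos (by positivity), abs_of_pos (by positivity), abs_of_pos (by positivity)]
    ring
  calc _ ≤ v ^ (-k) * (1 + v) ^ n * (1 / (2 * b * √π) * igExp b l Z v *
      ((l / b ^ 2 * 1 + l ^ 2 / (4 * b ^ 4) * Z) * v ^ (-(3 / 2) : ℝ) +
      (3 / (2 * b ^ 2) * Z + l / (2 * b ^ 4) * Z ^ 2) * v ^ (-(5 / 2) : ℝ) +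
      1 / (4 * b ^ 4) * Z ^ 3 * v ^ (-(7 / 2) : ℝ))) := by gcongr
    _ = 1 / (2 * b * √π) * ((l / b ^ 2 * 1 + l ^ 2 / (4 * b ^ 4) * Z) * (v ^ (-k) * (1 + v) ^ n *
        (v ^ (-(3 / 2) : ℝ) * igExp b l Z v)) +
        (3 / (2 * b ^ 2) * Z + l / (2 * b ^ 4) * Z ^ 2) * (v ^ (-k) * (1 + v) ^ n *
        (v ^ (-(5 / 2) : ℝ) * igExp b l Z v)) + 1 / (4 * b ^ 4) * Z ^ 3 * (v ^ (-k) * (1 + v) ^ n *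
        (v ^ (-(7 / 2) : ℝ) * igExp b l Z v))) := by ring
    _ ≤ 1 / (2 * b * √π) * ((l / b ^ 2 * (1 + Z) ^ 3 + l ^ 2 / (4 * b ^ 4) * (1 + Z) ^ 3) *
        (C₁ * (1 + Z) ^ n) +
        (3 / (2 * b ^ 2) * (1 + Z) ^ 3 + l / (2 * b ^ 4) * (1 + Z) ^ 3) * (C₂ * (1 + Z) ^ n) +
        1 / (4 * b ^ 4) * (1 + Z) ^ 3 * (C₃ * (1 + Z) ^ n)) := by gcongr
    _ = _ := by ring

theorem measurable_igDensityZ (b l : ℝ) : Measurable fun p : ℝ × ℝ => igDensityZ b l p.1 p.2 := by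
  unfold igDensityZ
  have := measurable_igExp b l
  have h1 : Measurable fun p : ℝ × ℝ => p.2 ^ (-(3 / 2) : ℝ) := measurable_snd.pow_const _
  have h2 : Measurable fun p : ℝ × ℝ => p.2 ^ (-(5 / 2) : ℝ) := measurable_snd.pow_const _
  fun_prop

theorem measurable_igDensityZZ (b l : ℝ) : Measurable fun p : ℝ × ℝ => igDensityZZ b l p.1 p.2 := by
  unfold igDensityZZ
  have := measurable_igExp b l
  have h1 : Measurable fun p : ℝ × ℝ => p.2 ^ (-(3 / 2) : ℝ) := measurable_snd.pow_const _
  have h2 : Measurable fun p : ℝ × ℝ => p.2 ^ (-(5 / 2) : ℝ) := measurable_snd.pow_const _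
  have h3 : Measurable fun p : ℝ × ℝ => p.2 ^ (-(7 / 2) : ℝ) := measurable_snd.pow_const _
  fun_prop

/-! ### The kernel of the radiation boundary condition -/

/-- The kernel in the variable `x` that satisfies the Robin condition at `x = 0`. -/
noncomputable def robinKernel (γ x τ : ℝ) : ℝ :=
  Real.exp (γ * x) * ((1 / √(π * τ)) * Real.exp (-x ^ 2 / (4 * τ) - γ ^ 2 * τ) -
    γ * Real.exp (γ * x) * erfc (x / (2 * √τ) + γ * √τ))

theorem measurable_robinKernel (γ : ℝ) : Measurable fun p : ℝ × ℝ => robinKernel γ p.1 p.2 := by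
  unfold robinKernel
  have h : Measurable fun p : ℝ × ℝ => erfc (p.1 / (2 * √p.2) + γ * √p.2) :=
    continuous_erfc.measurable.comp (by fun_prop)
  fun_prop

theorem robinKernel_eq {γ x τ : ℝ} (hτ : 0 < τ) :
    robinKernel γ x τ = 1 / √π * (τ ^ (-(1 / 2) : ℝ) * igExp 1 (2 * γ) x τ) -
      γ * Real.exp (2 * γ * x) * erfc ((x + 2 * γ * τ) / (2 * 1 * √τ)) := by
  have hs := Real.sqrt_pos.2 hτ
  have e1 : x / (2 * √τ) + γ * √τ = (x + 2 * γ * τ) / (2 * 1 * √τ) := by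
    nth_rewrite 3 [← Real.sq_sqrt hτ.le]
    field_simp
  have e2 : igExp 1 (2 * γ) x τ = Real.exp (γ * x) * Real.exp (-x ^ 2 / (4 * τ) - γ ^ 2 * τ) := by
    unfold igExp
    rw [← Real.exp_add]
    congr 1
    field_simp
    ring
  unfold robinKernel
  rw [e1, e2, Real.sqrt_mul pi_pos.le, rpow_neg_one_half hτ,
    show 2 * γ * x = γ * x + γ * x by ring, Real.exp_add]
  ring

theorem robinKernel_le {γ x τ : ℝ} (hγ : 0 < γ) (hτ : 0 < τ) :
    robinKernel γ x τ ≤ 1 / √π * (τ ^ (-(1 / 2) : ℝ) * igExp 1 (2 * γ) x τ) := by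
  rw [robinKernel_eq hτ, sub_le_self_iff]
  have := erfc_nonneg ((x + 2 * γ * τ) / (2 * 1 * √τ))
  positivity

theorem robinKernel_le_igDensity {γ x τ : ℝ} (hγ : 0 < γ) (hx : 0 < x) (hτ : 0 < τ) :
    robinKernel γ x τ ≤ 2 * τ / x * igDensity 1 (2 * γ) x τ := by
  refine (robinKernel_le hγ hτ).trans (le_of_eq ?_)
  have hs := Real.sqrt_pos.2 hτ
  have hp := Real.sqrt_pos.2 pi_pos
  rw [igDensity, rpow_neg_three_halves hτ, rpow_neg_one_half hτ]
  field_simp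

theorem robinKernel_nonneg {γ x τ : ℝ} (hγ : 0 < γ) (hx : 0 < x) (hτ : 0 < τ) :
    0 ≤ robinKernel γ x τ := by
  have hs := Real.sqrt_pos.2 hτ
  have hp := Real.sqrt_pos.2 pi_pos
  have hE := igExp_pos 1 (2 * γ) x τ
  have h := erfc_le (y := (x + 2 * γ * τ) / (2 * 1 * √τ)) (by positivity)
  rw [exp_neg_sq_eq_igExp_mul one_pos hτ] at h
  rw [robinKernel_eq hτ, sub_nonneg, rpow_neg_one_half hτ]
  calc _ ≤ γ * Real.exp (2 * γ * x) * (igExp 1 (2 * γ) x τ * Real.exp (-(2 * γ * x / 1 ^ 2)) /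
        (√π * ((x + 2 * γ * τ) / (2 * 1 * √τ)))) := by gcongr
    _ = 2 * γ * √τ / (x + 2 * γ * τ) * (1 / √π * igExp 1 (2 * γ) x τ) := by
      rw [one_pow, div_one, Real.exp_neg]
      have := Real.exp_pos (2 * γ * x)
      field_simp
    _ ≤ (√τ)⁻¹ * (1 / √π * igExp 1 (2 * γ) x τ) := by
      gcongr
      rw [inv_eq_one_div, div_le_div_iff₀ (by positivity) hs]
      nlinarith [Real.sq_sqrt hτ.le]
    _ = _ := by ring

theorem exists_robinKernel_le {γ x₀ k : ℝ} (hγ : 0 < γ) (hx₀ : 0 < x₀) (hk : 0 ≤ k) (n : ℕ) :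
    ∃ C, 0 < C ∧ ∀ x τ, x₀ ≤ x → 0 < τ →
      τ ^ (-k) * (1 + τ) ^ n * |robinKernel γ x τ| ≤ C * (1 + x) ^ n := by
  obtain ⟨C, hC, h⟩ := exists_rpow_mul_igExp_weight_le (b := 1) (l := 2 * γ) (j := 1 / 2) one_pos
    (by positivity) hx₀ hk (by norm_num) n
  have hp := Real.sqrt_pos.2 pi_pos
  refine ⟨1 / √π * C, by positivity, fun x τ hx hτ => ?_⟩
  have h1 := h x τ hx hτ
  rw [abs_of_nonneg (robinKernel_nonneg hγ (hx₀.trans_le hx) hτ)]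
  calc _ ≤ τ ^ (-k) * (1 + τ) ^ n * (1 / √π * (τ ^ (-(1 / 2) : ℝ) * igExp 1 (2 * γ) x τ)) := by
        gcongr; exact robinKernel_le hγ hτ
    _ = 1 / √π * (τ ^ (-k) * (1 + τ) ^ n * (τ ^ (-(1 / 2) : ℝ) * igExp 1 (2 * γ) x τ)) := by ring
    _ ≤ 1 / √π * (C * (1 + x) ^ n) := by gcongr
    _ = _ := by ring

theorem hasDerivAt_robinKernel_left {γ x τ : ℝ} (hτ : 0 < τ) :
    HasDerivAt (fun x => robinKernel γ x τ)
      (2 * γ * robinKernel γ x τ - igDensity 1 (2 * γ) x τ) x := by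
  have hs := Real.sqrt_pos.2 hτ
  have hp := Real.sqrt_pos.2 pi_pos
  rw [funext fun x => robinKernel_eq (γ := γ) (x := x) hτ, robinKernel_eq hτ, igDensity]
  have h1 := ((hasDerivAt_igExp_left (b := 1) (l := 2 * γ) (Z := x) one_pos hτ).const_mul
    (τ ^ (-(1 / 2) : ℝ))).const_mul (1 / √π)
  have h2 := ((hasDerivAt_id x).const_mul (2 * γ)).exp.const_mul γ
  have h3 := (hasDerivAt_erfc ((x + 2 * γ * τ) / (2 * 1 * √τ))).comp x
    (((hasDerivAt_id x).add_const (2 * γ * τ)).div_const (2 * 1 * √τ))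
  have h := h1.fun_sub (h2.fun_mul h3)
  refine h.congr_deriv ?_
  simp only [id, Function.comp]
  rw [exp_neg_sq_eq_igExp_mul one_pos hτ, one_pow, div_one, Real.exp_neg, rpow_neg_three_halves hτ,
    rpow_neg_one_half hτ]
  have := Real.exp_pos (2 * γ * x)
  field_simp
  ring

theorem hasDerivAt_robinKernel_right {γ x τ : ℝ} (hτ : 0 < τ) :
    HasDerivAt (fun τ => robinKernel γ x τ) (-igDensityZ 1 (2 * γ) x τ) τ := by
  have hs := Real.sqrt_pos.2 hτ
  have hp := Real.sqrt_pos.2 pi_pos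
  have h1 := ((Real.hasDerivAt_rpow_const (x := τ) (p := -(1 / 2)) (Or.inl hτ.ne')).fun_mul
    (hasDerivAt_igExp_right (b := 1) (l := 2 * γ) (Z := x) one_pos hτ)).const_mul (1 / √π)
  have h2 := (hasDerivAt_erfc_comp (b := 1) (Z := x) (c := 2 * γ) one_pos hτ).const_mul
    (γ * Real.exp (2 * γ * x))
  refine ((h1.fun_sub h2).congr_of_eventuallyEq ?_).congr_deriv ?_
  · filter_upwards [lt_mem_nhds hτ] with σ hσ
    exact robinKernel_eq hσ
  rw [igDensityZ, exp_neg_sq_eq_igExp_mul one_pos hτ, one_pow, div_one, Real.exp_neg,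
    rpow_neg_five_halves hτ, rpow_sub_one hτ.ne', rpow_neg_three_halves hτ, rpow_neg_one_half hτ]
  have := Real.exp_pos (2 * γ * x)
  field_simp
  ring

/-! ### Representation of the solution as an integral over a quadrant -/

/-- Lebesgue measure on the open positive half-line. -/
noncomputable abbrev halfLine : Measure ℝ := volume.restrict (Ioi 0)

/-- Lebesgue measure on the open positive quadrant. -/
noncomputable abbrev quadrant : Measure (ℝ × ℝ) := halfLine.prod halfLine

theorem ae_quadrant : ∀ᵐ p ∂quadrant, 0 < p.1 ∧ 0 < p.2 := by
  have : quadrant = volume.restrict (Ioi (0 : ℝ) ×ˢ Ioi (0 : ℝ)) := by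
    rw [quadrant, halfLine, Measure.prod_restrict]; rfl
  rw [this]
  exact (ae_restrict_mem (measurableSet_Ioi.prod measurableSet_Ioi)).mono fun p hp => hp

theorem integrable_mul_igDensity_prod {a l : ℝ} (ha : 0 < a) (hl : 0 < l) {ν : Measure ℝ}
    [SFinite ν] {h Z : ℝ → ℝ} (hh : Integrable h ν) (hZ : Measurable Z) :
    Integrable (fun p : ℝ × ℝ => h p.1 * igDensity a l (Z p.1) p.2) (ν.prod halfLine) ∧
      ∫ p, |h p.1 * igDensity a l (Z p.1) p.2| ∂ν.prod halfLine ≤ ∫ τ, |h τ| ∂ν := by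
  have hm : AEStronglyMeasurable (fun p : ℝ × ℝ => h p.1 * igDensity a l (Z p.1) p.2) (ν.prod halfLine) :=
    hh.1.comp_fst.mul ((measurable_igDensity a l).comp
      ((hZ.comp measurable_fst).prodMk measurable_snd)).aestronglyMeasurable
  have hle : ∀ τ, ∫ v, ‖h τ * igDensity a l (Z τ) v‖ ∂halfLine ≤ |h τ| := fun τ => by
    simp only [norm_mul, norm_eq_abs]
    rw [integral_const_mul]
    exact mul_le_of_le_one_right (abs_nonneg _) (integral_abs_igDensity_le ha hl (Z τ)).2
  have hi : Integrable (fun p : ℝ × ℝ => h p.1 * igDensity a l (Z p.1) p.2) (ν.prod halfLine) := by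
    refine (integrable_prod_iff hm).2 ⟨Eventually.of_forall fun τ =>
      Integrable.const_mul (integral_abs_igDensity_le ha hl (Z τ)).1 (h τ), ?_⟩
    refine hh.abs.mono' hm.norm.integral_prod_right' (Eventually.of_forall fun τ => ?_)
    rw [Real.norm_of_nonneg (integral_nonneg fun v => norm_nonneg _)]
    exact hle τ
  refine ⟨hi, ?_⟩
  have h2 := hi.norm
  calc _ = ∫ τ, ∫ v, ‖h τ * igDensity a l (Z τ) v‖ ∂halfLine ∂ν := integral_prod _ h2
    _ ≤ _ := integral_mono h2.integral_prod_left hh.abs hle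

theorem integrableOn_rpow_mul_igDensity' {b l : ℝ} (hb : 0 < b) (hl : 0 < l) (Z k : ℝ) :
    IntegrableOn (fun v => v ^ (-k) * |igDensity b l Z v|) (Ioi 0) := by
  rcases eq_or_ne Z 0 with rfl | hZ
  · simp [igDensity]
  refine (integrableOn_rpow_mul_igDensity hb hl (abs_pos.2 hZ) k).mono'
    ((measurable_id.pow_const _).mul
      ((measurable_igDensity b l).comp measurable_prodMk_left).abs).aestronglyMeasurable ?_
  refine (ae_restrict_mem measurableSet_Ioi).mono fun v (hv : 0 < v) => ?_
  rw [Real.norm_of_nonneg (by positivity)]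
  gcongr
  exact abs_igDensity_le hb hl hv

theorem exp_mul_setIntegral_Mwr {a lam Z β s : ℝ} (ha : 0 < a) (hβ : 0 < β) (hβ₂ : β < 1 / 2)
    (hs : 0 < s) :
    Real.exp (lam * Z / (2 * a ^ 2)) * ((β * Z / (a * √π * s ^ (2 * β + 1))) *
        ∫ w in Ioi (0 : ℝ), w ^ (-(1 / 2 : ℝ)) *
          Real.exp (-Z ^ 2 / (4 * a ^ 2 * w) - lam ^ 2 * w / (4 * a ^ 2)) *
          Mwr (w / s ^ (2 * β)) (2 * β)) =
      ∫ w in Ioi (0 : ℝ), igDensity a lam Z w * wrightKernel (2 * β) 1 w s := by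
  rw [← mul_assoc, ← integral_const_mul]
  refine setIntegral_congr_fun measurableSet_Ioi fun w (hw : 0 < w) => ?_
  have hp := Real.sqrt_pos.2 pi_pos
  have hsw := Real.sqrt_pos.2 hw
  have hE : igExp a lam Z w = Real.exp (lam * Z / (2 * a ^ 2)) *
      Real.exp (-Z ^ 2 / (4 * a ^ 2 * w) - lam ^ 2 * w / (4 * a ^ 2)) := by
    unfold igExp
    rw [← Real.exp_add]
    congr 1
    field_simp
    ring
  rw [wrightKernel_of_pos hs, wrightSeries_one_eq (by linarith) (by linarith), igDensity, hE,
    Mwr_eq_wrightSeries, rpow_neg_three_halves hw, rpow_neg_one_half hw, rpow_neg hs.le (2 * β),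
    ← div_eq_mul_inv w, rpow_add_one hs.ne', rpow_neg_one]
  have := rpow_pos_of_pos hs (2 * β)
  field_simp

theorem integral_Nwr_mul_integral {a lam Z β τ t : ℝ} (ha : 0 < a) (hlam : 0 < lam) (hβ : 0 < β)
    (hβ₂ : β < 1 / 2) (hτ : 0 < τ) (ht : 0 < t) :
    ∫ s in (0 : ℝ)..t, Nwr (τ / (t - s) ^ (2 * β)) β *
        ∫ w in Ioi (0 : ℝ), igDensity a lam Z w * wrightKernel (2 * β) 1 w s =
      ∫ v in Ioi (0 : ℝ), igDensity a lam Z v * wrightKernel (2 * β) 0 (τ + v) t := by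
  set δ := 2 * β with hδ
  have hδ0 : 0 < δ := by positivity
  have hδ1 : δ < 1 := by linarith
  obtain ⟨C₀, hC₀0, hC₀⟩ := exists_abs_wrightKernel_zero_le hδ0 hδ1
  obtain ⟨C₁, hC₁, h₁⟩ := exists_abs_wrightKernel_le hδ0 hδ1 one_pos
  have step : ∫ s in (0 : ℝ)..t, Nwr (τ / (t - s) ^ δ) β *
        ∫ w in Ioi (0 : ℝ), igDensity a lam Z w * wrightKernel δ 1 w s =
      ∫ s in Ioo 0 t, ∫ w in Ioi (0 : ℝ),
        wrightKernel δ 0 τ (t - s) * (igDensity a lam Z w * wrightKernel δ 1 w s) := by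
    rw [intervalIntegral.integral_of_le ht.le, integral_Ioc_eq_integral_Ioo]
    refine setIntegral_congr_fun measurableSet_Ioo fun s hs => ?_
    rw [integral_const_mul, wrightKernel_zero_of_pos (sub_pos.2 hs.2), Nwr_eq_wrightSeries,
      rpow_neg (sub_pos.2 hs.2).le, ← div_eq_mul_inv]
  rw [step, integral_integral_swap]
  · refine setIntegral_congr_fun measurableSet_Ioi fun w (hw : 0 < w) => ?_
    rw [← intervalIntegral_wrightKernel_zero_mul hδ0 hδ1 hw hτ ht,
      intervalIntegral.integral_of_le ht.le, integral_Ioc_eq_integral_Ioo, ← integral_const_mul]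
    refine integral_congr_ae (Eventually.of_forall fun s => ?_)
    simp only
    ring
  · have hb : Integrable (fun q : ℝ × ℝ => (fun _ : ℝ => C₀ * C₁) q.1 *
        (fun w : ℝ => w ^ (-(1 / δ)) * |igDensity a lam Z w|) q.2)
        ((volume.restrict (Ioo 0 t)).prod (volume.restrict (Ioi 0))) :=
      Integrable.mul_prod (integrable_const _) (integrableOn_rpow_mul_igDensity' ha hlam Z _)
    refine hb.mono' ?_ ?_
    · have m1 : Measurable fun q : ℝ × ℝ => wrightKernel δ 0 τ (t - q.1) :=
        (measurable_wrightKernel_right hδ0 hδ1 le_rfl τ).comp (measurable_const.sub measurable_fst)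
      have m2 : Measurable fun q : ℝ × ℝ => igDensity a lam Z q.2 :=
        (measurable_igDensity a lam).comp (measurable_const.prodMk measurable_snd)
      have m3 : Measurable fun q : ℝ × ℝ => wrightKernel δ 1 q.2 q.1 :=
        (measurable_wrightKernel hδ0 hδ1 zero_le_one).comp (measurable_snd.prodMk measurable_fst)
      exact (m1.mul (m2.mul m3)).aestronglyMeasurable
    · rw [Measure.prod_restrict]
      refine (ae_restrict_mem (measurableSet_Ioo.prod measurableSet_Ioi)).mono fun q hq => ?_
      have hw : 0 < q.2 := hq.2
      have e1 := hC₀ τ (t - q.1) hτ.le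
      have e2 := h₁ q.2 q.1 hw
      simp only [Function.uncurry, norm_mul, norm_eq_abs]
      calc _ ≤ C₀ * (|igDensity a lam Z q.2| * (C₁ * q.2 ^ (-1 / δ))) := by gcongr
        _ = _ := by rw [neg_div]; ring

/-- The solution up to the factor `2γA`, as an integral over the quadrant. -/
noncomputable def lumpedSol (a lam α γ δ x z t : ℝ) : ℝ :=
  ∫ p, robinKernel γ x p.1 * igDensity a lam (z + α * p.1) p.2 *
    wrightKernel δ 0 (p.1 + p.2) t ∂quadrant

theorem integrable_robinKernel {γ x : ℝ} (hγ : 0 < γ) (hx : 0 < x) :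
    Integrable (robinKernel γ x) halfLine := by
  obtain ⟨C, hC, h⟩ := exists_robinKernel_le hγ hx le_rfl 2
  refine integrableOn_Ioi_of_abs_le (C := C * (1 + x) ^ 2)
    ((measurable_robinKernel γ).comp measurable_prodMk_left) fun τ hτ => ?_
  have := h x τ le_rfl hτ
  rw [neg_zero, rpow_zero, one_mul] at this
  rw [le_mul_inv_iff₀ (by positivity)]
  linarith

theorem measurable_wrightKernel_zero_add {δ : ℝ} (hδ0 : 0 < δ) (hδ1 : δ < 1) (t : ℝ) :
    Measurable fun p : ℝ × ℝ => wrightKernel δ 0 (p.1 + p.2) t :=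
  (measurable_wrightKernel hδ0 hδ1 le_rfl).comp
    ((measurable_fst.add measurable_snd).prodMk measurable_const)

theorem integrable_mul_wrightKernel_zero {δ t : ℝ} (hδ0 : 0 < δ) (hδ1 : δ < 1) {k : ℝ × ℝ → ℝ}
    (hk : Integrable k quadrant) :
    Integrable (fun p => k p * wrightKernel δ 0 (p.1 + p.2) t) quadrant := by
  obtain ⟨C₀, hC₀0, hC₀⟩ := exists_abs_wrightKernel_zero_le hδ0 hδ1
  refine hk.mul_bdd (c := C₀) (measurable_wrightKernel_zero_add hδ0 hδ1 t).aestronglyMeasurable ?_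
  filter_upwards [ae_quadrant] with p hp
  exact hC₀ _ _ (add_pos hp.1 hp.2).le

theorem lumpedSol_eq {a lam α γ β x t : ℝ} (ha : 0 < a) (hlam : 0 < lam) (hγ : 0 < γ)
    (hβ : 0 < β) (hβ₂ : β < 1 / 2) (hx : 0 < x) (ht : 0 < t) (z : ℝ) :
    lumpedSol a lam α γ (2 * β) x z t = ∫ τ in Ioi (0 : ℝ), robinKernel γ x τ *
      ∫ s in (0 : ℝ)..t, Nwr (τ / (t - s) ^ (2 * β)) β *
        ∫ w in Ioi (0 : ℝ), igDensity a lam (z + α * τ) w * wrightKernel (2 * β) 1 w s := by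
  unfold lumpedSol
  rw [integral_prod _ (integrable_mul_wrightKernel_zero (by linarith) (by linarith)
    (integrable_mul_igDensity_prod (Z := fun τ => z + α * τ) ha hlam (integrable_robinKernel hγ hx)
      (by fun_prop)).1)]
  refine setIntegral_congr_fun measurableSet_Ioi fun τ (hτ : 0 < τ) => ?_
  simp only
  rw [integral_Nwr_mul_integral ha hlam hβ hβ₂ hτ ht, ← integral_const_mul]
  simp only [mul_assoc]

/-! ### Caputo derivative, decay and initial behaviour -/

theorem abs_integral_le_of_abs_le {X : Type*} [MeasurableSpace X] {ν : Measure X} {f g : X → ℝ}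
    (hg : Integrable g ν) (h : ∀ᵐ p ∂ν, |f p| ≤ g p) : |∫ p, f p ∂ν| ≤ ∫ p, g p ∂ν := by
  rw [← norm_eq_abs]
  exact norm_integral_le_of_norm_le hg h

theorem integrable_rpow_mul_robinKernel {γ x k : ℝ} (hγ : 0 < γ) (hx : 0 < x) (hk : 0 ≤ k) :
    Integrable (fun τ => τ ^ (-k) * robinKernel γ x τ) halfLine := by
  obtain ⟨C, hC, h⟩ := exists_robinKernel_le hγ hx hk 2
  refine integrableOn_Ioi_of_abs_le (C := C * (1 + x) ^ 2)
    ((measurable_id.pow_const _).mul ((measurable_robinKernel γ).comp measurable_prodMk_left))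
    fun τ hτ => ?_
  have := h x τ le_rfl hτ
  rw [le_mul_inv_iff₀ (by positivity), abs_mul, abs_of_pos (rpow_pos_of_pos hτ _)]
  linarith

theorem integrable_robinKernel_mul_igDensity {a lam γ x : ℝ} (ha : 0 < a) (hlam : 0 < lam)
    (hγ : 0 < γ) (hx : 0 < x) (α z : ℝ) :
    Integrable (fun p : ℝ × ℝ => robinKernel γ x p.1 * igDensity a lam (z + α * p.1) p.2)
      quadrant :=
  (integrable_mul_igDensity_prod (Z := fun τ => z + α * τ) ha hlam (integrable_robinKernel hγ hx)
    (by fun_prop)).1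

theorem caputo_lumpedSol {a lam α γ δ x t : ℝ} (ha : 0 < a) (hlam : 0 < lam) (hγ : 0 < γ)
    (hδ0 : 0 < δ) (hδ1 : δ < 1) (hx : 0 < x) (ht : 0 < t) (z : ℝ) :
    caputo δ (fun t' => lumpedSol a lam α γ δ x z t') t =
      ∫ p, robinKernel γ x p.1 * igDensity a lam (z + α * p.1) p.2 *
        wrightKernel δ δ (p.1 + p.2) t ∂quadrant := by
  refine caputo_integral_wrightKernel_zero (W := fun p : ℝ × ℝ => p.1 + p.2) hδ0 hδ1 ht
    (by fun_prop) (ae_quadrant.mono fun p hp => add_pos hp.1 hp.2)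
    (integrable_robinKernel_mul_igDensity ha hlam hγ hx α z) ?_
  have hb := (integrable_mul_igDensity_prod (Z := fun τ => z + α * τ) ha hlam
    (integrable_rpow_mul_robinKernel (k := 1 / δ) hγ hx (by positivity)) (by fun_prop)).1
  refine hb.mono ?_ ?_
  · have m := (integrable_robinKernel_mul_igDensity ha hlam hγ hx α z).1
    exact m.mul ((measurable_fst.add measurable_snd).pow_const _).aestronglyMeasurable
  · filter_upwards [ae_quadrant] with p hp
    have h1 := hp.1
    have h2 := hp.2
    have h3 : (p.1 + p.2) ^ (-1 / δ) ≤ p.1 ^ (-(1 / δ)) := by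
      rw [neg_div]
      exact rpow_le_rpow_of_nonpos h1 (by linarith) (by rw [neg_nonpos]; positivity)
    simp only [norm_mul, norm_eq_abs]
    rw [abs_of_pos (rpow_pos_of_pos (add_pos h1 h2) _), abs_of_pos (rpow_pos_of_pos h1 _)]
    calc _ ≤ |robinKernel γ x p.1| * |igDensity a lam (z + α * p.1) p.2| * p.1 ^ (-(1 / δ)) := by
          gcongr
      _ = _ := by ring

theorem integral_rpow_neg_one_mul_robinKernel_le {γ x : ℝ} (hγ : 0 < γ) (hx : 0 < x) :
    ∫ τ, |τ ^ (-1 : ℝ) * robinKernel γ x τ| ∂halfLine ≤ 2 / x := by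
  have hi := integrableOn_igDensity (b := 1) one_pos (show 0 < 2 * γ by positivity) hx
  calc _ ≤ ∫ τ, 2 / x * igDensity 1 (2 * γ) x τ ∂halfLine := by
        refine integral_mono_ae (integrable_rpow_mul_robinKernel hγ hx zero_le_one).abs
          (hi.const_mul _) ?_
        refine (ae_restrict_mem measurableSet_Ioi).mono fun τ (hτ : 0 < τ) => ?_
        have h0 := robinKernel_nonneg hγ hx hτ
        simp only
        rw [abs_of_nonneg (by positivity), rpow_neg_one, inv_mul_le_iff₀ hτ]
        refine (robinKernel_le_igDensity hγ hx hτ).trans (le_of_eq ?_)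
        ring
    _ = _ := by rw [integral_const_mul, integral_igDensity one_pos (by positivity) hx, mul_one]

theorem integral_robinKernel_le {γ x : ℝ} (hγ : 0 < γ) (hx : 0 < x) :
    ∫ τ, |robinKernel γ x τ| ∂halfLine ≤ 1 / γ := by
  have hi := integrableOn_mul_igDensity (b := 1) one_pos (show 0 < 2 * γ by positivity) hx
  calc _ ≤ ∫ τ, 2 / x * (τ * igDensity 1 (2 * γ) x τ) ∂halfLine := by
        refine integral_mono_ae (integrable_robinKernel hγ hx).abs (hi.const_mul _) ?_
        refine (ae_restrict_mem measurableSet_Ioi).mono fun τ (hτ : 0 < τ) => ?_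
        have h0 := robinKernel_nonneg hγ hx hτ
        simp only
        rw [abs_of_nonneg (by positivity)]
        refine (robinKernel_le_igDensity hγ hx hτ).trans (le_of_eq ?_)
        ring
    _ = _ := by
      rw [integral_const_mul, integral_mul_igDensity one_pos (by positivity) hx]
      field_simp

theorem exists_lumpedSol_le_div {a lam γ δ : ℝ} (ha : 0 < a) (hlam : 0 < lam) (hγ : 0 < γ)
    (hδ0 : 0 < δ) (hδ1 : δ < 1) (α : ℝ) : ∃ C, 0 < C ∧ ∀ x z t, 0 < x → 0 < t →
      |lumpedSol a lam α γ δ x z t| ≤ C * t ^ δ / x := by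
  obtain ⟨C, hC, h⟩ := exists_abs_wrightKernel_zero_le_div hδ0 hδ1
  refine ⟨2 * C, by positivity, fun x z t hx ht => ?_⟩
  obtain ⟨hb, hb'⟩ := integrable_mul_igDensity_prod (Z := fun τ => z + α * τ) ha hlam
    (integrable_rpow_mul_robinKernel (k := 1) hγ hx zero_le_one) (by fun_prop)
  have htd := rpow_pos_of_pos ht δ
  calc |lumpedSol a lam α γ δ x z t| ≤ ∫ p, C * t ^ δ *
        |p.1 ^ (-1 : ℝ) * robinKernel γ x p.1 * igDensity a lam (z + α * p.1) p.2| ∂quadrant := by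
        refine abs_integral_le_of_abs_le (hb.abs.const_mul _) ?_
        filter_upwards [ae_quadrant] with p hp
        have h1 := h (p.1 + p.2) t (add_pos hp.1 hp.2) ht
        have h2 : C * t ^ δ / (p.1 + p.2) ≤ C * t ^ δ / p.1 := by
          have := hp.1
          gcongr
          linarith [hp.2]
        rw [abs_mul, abs_mul, abs_mul, abs_mul,
          abs_of_pos (rpow_pos_of_pos hp.1 _), rpow_neg_one]
        calc _ ≤ |robinKernel γ x p.1| * |igDensity a lam (z + α * p.1) p.2| *
              (C * t ^ δ / p.1) := by gcongr; exact h1.trans h2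
          _ = _ := by ring
    _ ≤ C * t ^ δ * (2 / x) := by
      rw [integral_const_mul]
      gcongr
      exact hb'.trans (integral_rpow_neg_one_mul_robinKernel_le hγ hx)
    _ = _ := by ring

theorem lumpedSol_eq_iterated {a lam γ δ x : ℝ} (ha : 0 < a) (hlam : 0 < lam) (hγ : 0 < γ)
    (hδ0 : 0 < δ) (hδ1 : δ < 1) (hx : 0 < x) (α z t : ℝ) :
    lumpedSol a lam α γ δ x z t = ∫ τ, robinKernel γ x τ *
      ∫ v, igDensity a lam (z + α * τ) v * wrightKernel δ 0 (τ + v) t ∂halfLine ∂halfLine := by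
  unfold lumpedSol
  rw [integral_prod _ (integrable_mul_wrightKernel_zero hδ0 hδ1
    (integrable_robinKernel_mul_igDensity ha hlam hγ hx α z))]
  refine integral_congr_ae (Eventually.of_forall fun τ => ?_)
  simp only
  rw [← integral_const_mul]
  simp only [mul_assoc]

theorem exists_lumpedSol_le_div_level {a lam α γ δ : ℝ} (ha : 0 < a) (hlam : 0 < lam) (hα : 0 < α)
    (hγ : 0 < γ) (hδ0 : 0 < δ) (hδ1 : δ < 1) : ∃ C, 0 < C ∧ ∀ x z t, 0 < x → 0 < z → 0 < t →
      |lumpedSol a lam α γ δ x z t| ≤ C * t ^ δ * (2 * a ^ 2 / z ^ 2 + lam / z) := by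
  obtain ⟨C, hC, h⟩ := exists_abs_wrightKernel_zero_le_div hδ0 hδ1
  refine ⟨C / γ, by positivity, fun x z t hx hz ht => ?_⟩
  have htd := rpow_pos_of_pos ht δ
  have inner : ∀ τ, 0 < τ → |∫ v, igDensity a lam (z + α * τ) v * wrightKernel δ 0 (τ + v) t
      ∂halfLine| ≤ C * t ^ δ * (2 * a ^ 2 / z ^ 2 + lam / z) := fun τ hτ => by
    have hZ : z ≤ z + α * τ := by nlinarith
    have hZ0 : 0 < z + α * τ := hz.trans_le hZ
    calc _ ≤ ∫ v, C * t ^ δ * (igDensity a lam (z + α * τ) v / v) ∂halfLine := by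
          refine abs_integral_le_of_abs_le
            ((integrableOn_igDensity_div ha hlam hZ0).const_mul _) ?_
          refine (ae_restrict_mem measurableSet_Ioi).mono fun v (hv : 0 < v) => ?_
          have h1 := h (τ + v) t (by positivity) ht
          have h2 : C * t ^ δ / (τ + v) ≤ C * t ^ δ / v := by
            gcongr
            linarith
          have h3 := igDensity_nonneg (l := lam) ha hZ0.le hv
          rw [abs_mul, abs_of_nonneg h3]
          calc _ ≤ igDensity a lam (z + α * τ) v * (C * t ^ δ / v) := by gcongr; exact h1.trans h2
            _ = _ := by ring
      _ = C * t ^ δ * (2 * a ^ 2 / (z + α * τ) ^ 2 + lam / (z + α * τ)) := by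
        rw [integral_const_mul, integral_igDensity_div ha hlam hZ0]
      _ ≤ _ := by gcongr
  rw [lumpedSol_eq_iterated ha hlam hγ hδ0 hδ1 hx]
  calc _ ≤ ∫ τ, |robinKernel γ x τ| * (C * t ^ δ * (2 * a ^ 2 / z ^ 2 + lam / z)) ∂halfLine := by
        refine abs_integral_le_of_abs_le ((integrable_robinKernel hγ hx).abs.mul_const _) ?_
        refine (ae_restrict_mem measurableSet_Ioi).mono fun τ (hτ : 0 < τ) => ?_
        rw [abs_mul]
        exact mul_le_mul_of_nonneg_left (inner τ hτ) (abs_nonneg _)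
    _ ≤ 1 / γ * (C * t ^ δ * (2 * a ^ 2 / z ^ 2 + lam / z)) := by
      rw [integral_mul_const]
      gcongr
      exact integral_robinKernel_le hγ hx
    _ = _ := by ring

theorem tendsto_lumpedSol_time {a lam γ δ x : ℝ} (ha : 0 < a) (hlam : 0 < lam)
    (hγ : 0 < γ) (hδ0 : 0 < δ) (hδ1 : δ < 1) (hx : 0 < x) (α z : ℝ) :
    Tendsto (fun t => lumpedSol a lam α γ δ x z t) (𝓝[>] 0) (𝓝 0) := by
  obtain ⟨C, hC, h⟩ := exists_lumpedSol_le_div ha hlam hγ hδ0 hδ1 α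
  have h0 : Tendsto (fun t : ℝ => C * t ^ δ / x) (𝓝[>] 0) (𝓝 0) := by
    have : Tendsto (fun t : ℝ => C * t ^ δ / x) (𝓝 0) (𝓝 (C * 0 ^ δ / x)) :=
      ((continuousAt_rpow_const 0 δ (Or.inr hδ0.le)).tendsto.const_mul C).div_const x
    rw [zero_rpow hδ0.ne', mul_zero, zero_div] at this
    exact this.mono_left nhdsWithin_le_nhds
  refine squeeze_zero_norm' ?_ h0
  filter_upwards [self_mem_nhdsWithin] with t ht
  exact h x z t hx ht

theorem tendsto_lumpedSol_space {a lam α γ δ t : ℝ} (ha : 0 < a) (hlam : 0 < lam) (hα : 0 < α)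
    (hγ : 0 < γ) (hδ0 : 0 < δ) (hδ1 : δ < 1) (ht : 0 < t) :
    Tendsto (fun w : ℝ × ℝ => lumpedSol a lam α γ δ w.1 w.2 t)
      ((comap (fun w : ℝ × ℝ => w.1 ^ 2 + w.2 ^ 2) atTop) ⊓ 𝓟 (Ioi (0 : ℝ) ×ˢ Ioi (0 : ℝ)))
      (𝓝 0) := by
  obtain ⟨C₁, hC₁, h₁⟩ := exists_lumpedSol_le_div ha hlam hγ hδ0 hδ1 α
  obtain ⟨C₂, hC₂, h₂⟩ := exists_lumpedSol_le_div_level ha hlam hα hγ hδ0 hδ1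
  have htd := rpow_pos_of_pos ht δ
  set B : ℝ → ℝ := fun R => C₁ * t ^ δ / √(R / 2) +
    C₂ * t ^ δ * (2 * a ^ 2 / √(R / 2) ^ 2 + lam / √(R / 2)) with hB
  have hr : Tendsto (fun R : ℝ => √(R / 2)) atTop atTop :=
    Real.tendsto_sqrt_atTop.comp (tendsto_id.atTop_div_const two_pos)
  have hB0 : Tendsto B atTop (𝓝 0) := by
    have e1 := hr.const_div_atTop (C₁ * t ^ δ)
    have e2 := ((tendsto_pow_atTop two_ne_zero).comp hr).const_div_atTop (2 * a ^ 2)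
    have e3 := hr.const_div_atTop lam
    have := e1.add ((e2.add e3).const_mul (C₂ * t ^ δ))
    simp only [add_zero, mul_zero] at this
    exact this
  refine squeeze_zero_norm' ?_ ((hB0.comp tendsto_comap).mono_left inf_le_left)
  have hev : ∀ᶠ w : ℝ × ℝ in comap (fun w : ℝ × ℝ => w.1 ^ 2 + w.2 ^ 2) atTop ⊓
      𝓟 (Ioi (0 : ℝ) ×ˢ Ioi (0 : ℝ)), w ∈ Ioi (0 : ℝ) ×ˢ Ioi (0 : ℝ) :=
    mem_inf_of_right (mem_principal_self _)
  filter_upwards [hev] with w hw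
  have hx : 0 < w.1 := hw.1
  have hz : 0 < w.2 := hw.2
  have hR : 0 < w.1 ^ 2 + w.2 ^ 2 := by positivity
  have hr0 : 0 < √((w.1 ^ 2 + w.2 ^ 2) / 2) := Real.sqrt_pos.2 (by positivity)
  simp only [Function.comp, norm_eq_abs, hB]
  rcases le_total w.2 w.1 with hle | hle
  · have hm : √((w.1 ^ 2 + w.2 ^ 2) / 2) ≤ w.1 := by
      rw [Real.sqrt_le_left hx.le]; nlinarith
    refine (h₁ w.1 w.2 t hx ht).trans (le_add_of_le_of_nonneg ?_ (by positivity))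
    gcongr
  · have hm : √((w.1 ^ 2 + w.2 ^ 2) / 2) ≤ w.2 := by
      rw [Real.sqrt_le_left hz.le]; nlinarith
    refine (h₂ w.1 w.2 t hx hz ht).trans (le_add_of_nonneg_of_le (by positivity) ?_)
    gcongr

/-! ### Derivatives in `x` -/

theorem integrable_one_add_sq_inv_halfLine (C : ℝ) :
    Integrable (fun τ : ℝ => C * ((1 + τ) ^ 2)⁻¹) halfLine := by
  refine integrableOn_Ioi_of_abs_le (C := |C|) (by fun_prop) fun τ hτ => ?_
  rw [abs_mul, abs_of_pos (show 0 < ((1 + τ) ^ 2)⁻¹ by positivity)]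

theorem hasDerivAt_integral_igDensity {a lam α δ z t x₀ ε C : ℝ} (ha : 0 < a) (hlam : 0 < lam)
    (hδ0 : 0 < δ) (hδ1 : δ < 1) (hε : 0 < ε) {H H' : ℝ → ℝ → ℝ}
    (hH : ∀ x, Measurable (H x)) (hH' : ∀ x, Measurable (H' x))
    (hHb : ∀ τ, 0 < τ → |H x₀ τ| ≤ C * ((1 + τ) ^ 2)⁻¹)
    (hH'b : ∀ x ∈ Metric.ball x₀ ε, ∀ τ, 0 < τ → |H' x τ| ≤ C * ((1 + τ) ^ 2)⁻¹)
    (hd : ∀ x ∈ Metric.ball x₀ ε, ∀ τ, 0 < τ → HasDerivAt (fun x => H x τ) (H' x τ) x) :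
    HasDerivAt (fun x => ∫ p, H x p.1 * igDensity a lam (z + α * p.1) p.2 *
        wrightKernel δ 0 (p.1 + p.2) t ∂quadrant)
      (∫ p, H' x₀ p.1 * igDensity a lam (z + α * p.1) p.2 *
        wrightKernel δ 0 (p.1 + p.2) t ∂quadrant) x₀ := by
  obtain ⟨C₀, hC₀0, hC₀⟩ := exists_abs_wrightKernel_zero_le hδ0 hδ1
  have hm : ∀ G : ℝ → ℝ, Measurable G → AEStronglyMeasurable (fun p : ℝ × ℝ =>
      G p.1 * igDensity a lam (z + α * p.1) p.2 * wrightKernel δ 0 (p.1 + p.2) t) quadrant := by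
    intro G hG
    exact (((hG.comp measurable_fst).mul ((measurable_igDensity a lam).comp
      ((measurable_const.add (measurable_const.mul measurable_fst)).prodMk measurable_snd))).mul
      (measurable_wrightKernel_zero_add hδ0 hδ1 t)).aestronglyMeasurable
  have hb : Integrable (fun p : ℝ × ℝ => |C * ((1 + p.1) ^ 2)⁻¹ *
      igDensity a lam (z + α * p.1) p.2| * C₀) quadrant :=
    (integrable_mul_igDensity_prod (Z := fun τ => z + α * τ) ha hlam
      (integrable_one_add_sq_inv_halfLine C) (by fun_prop)).1.abs.mul_const C₀
  have hle : ∀ G : ℝ → ℝ, (∀ τ, 0 < τ → |G τ| ≤ C * ((1 + τ) ^ 2)⁻¹) → ∀ p : ℝ × ℝ,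
      0 < p.1 ∧ 0 < p.2 → ‖G p.1 * igDensity a lam (z + α * p.1) p.2 *
        wrightKernel δ 0 (p.1 + p.2) t‖ ≤ |C * ((1 + p.1) ^ 2)⁻¹ *
      igDensity a lam (z + α * p.1) p.2| * C₀ := by
    intro G hG p hp
    rw [norm_mul, norm_eq_abs, norm_eq_abs, abs_mul, abs_mul]
    have h1 := (hG p.1 hp.1).trans (le_abs_self _)
    have h2 := hC₀ (p.1 + p.2) t (add_pos hp.1 hp.2).le
    gcongr
  refine (hasDerivAt_integral_of_dominated_loc_of_deriv_le (Metric.ball_mem_nhds x₀ hε)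
    (bound := fun p : ℝ × ℝ => |C * ((1 + p.1) ^ 2)⁻¹ *
      igDensity a lam (z + α * p.1) p.2| * C₀)
    (F' := fun x p => H' x p.1 * igDensity a lam (z + α * p.1) p.2 *
        wrightKernel δ 0 (p.1 + p.2) t)
    (Eventually.of_forall fun x => hm _ (hH x)) ?_ (hm _ (hH' x₀)) ?_ hb ?_).2
  · exact hb.mono' (hm _ (hH x₀)) (ae_quadrant.mono (hle _ hHb))
  · exact ae_quadrant.mono fun p hp x hx => hle _ (hH'b x hx) p hp
  · exact ae_quadrant.mono fun p hp x hx => ((hd x hx p.1 hp.1).mul_const _).mul_const _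

theorem exists_weight_bound {γ x₀ : ℝ} (hγ : 0 < γ) (hx₀ : 0 < x₀) :
    ∃ C, 0 < C ∧ ∀ x ∈ Metric.ball x₀ (x₀ / 2), ∀ τ, 0 < τ →
      |robinKernel γ x τ| ≤ C * ((1 + τ) ^ 2)⁻¹ ∧
      |igDensity 1 (2 * γ) x τ| ≤ C * ((1 + τ) ^ 2)⁻¹ ∧
      |igDensityZ 1 (2 * γ) x τ| ≤ C * ((1 + τ) ^ 2)⁻¹ := by
  have hl : 0 < 2 * γ := by positivity
  obtain ⟨C₁, hC₁, h₁⟩ := exists_robinKernel_le hγ (half_pos hx₀) le_rfl 2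
  obtain ⟨C₂, hC₂, h₂⟩ := exists_igDensity_le one_pos hl (half_pos hx₀) le_rfl 2
  obtain ⟨C₃, hC₃, h₃⟩ := exists_igDensityZ_le one_pos hl (half_pos hx₀) le_rfl 2
  set X := 1 + 2 * x₀
  have hX : 1 ≤ X := by simp only [X]; linarith
  refine ⟨(C₁ + C₂ + C₃) * X ^ (2 + 3), by positivity, fun x hx τ hτ => ?_⟩
  rw [Metric.mem_ball, Real.dist_eq, abs_lt] at hx
  have hx1 : x₀ / 2 ≤ x := by linarith [hx.1]
  have hx0 : 0 < x := by linarith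
  have hx2 : 1 + x ≤ X := by simp only [X]; linarith [hx.2]
  have e1 : (1 + x) ^ (2 + 3) ≤ X ^ (2 + 3) := by gcongr
  have e2 : (1 + x) ^ 2 ≤ (1 + x) ^ (2 + 3) := pow_le_pow_right₀ (by linarith) (by norm_num)
  have g1 := h₁ x τ hx1 hτ
  have g2 := h₂ x τ hx1 hτ
  have g3 := h₃ x τ hx1 hτ
  simp only [neg_zero, rpow_zero, one_mul] at g1 g2 g3
  have hXp : 0 < X ^ (2 + 3) := by positivity
  refine ⟨?_, ?_, ?_⟩ <;> rw [le_mul_inv_iff₀ (by positivity), mul_comm]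
  · refine g1.trans ?_
    calc _ ≤ C₁ * X ^ (2 + 3) := by gcongr; exact e2.trans e1
      _ ≤ _ := by gcongr; linarith
  · refine g2.trans ?_
    calc _ ≤ C₂ * X ^ (2 + 3) := by gcongr
      _ ≤ _ := by gcongr; linarith
  · refine g3.trans ?_
    calc _ ≤ C₃ * X ^ (2 + 3) := by gcongr
      _ ≤ _ := by gcongr; linarith

/-- The flux `2γu - ∂u/∂x` of the solution, up to the factor `2γA`. -/
noncomputable def lumpedFlux (a lam α γ δ x z t : ℝ) : ℝ :=
  ∫ p, igDensity 1 (2 * γ) x p.1 * igDensity a lam (z + α * p.1) p.2 *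
    wrightKernel δ 0 (p.1 + p.2) t ∂quadrant

theorem measurable_igDensity_right (b l Z : ℝ) : Measurable (igDensity b l Z) :=
  (measurable_igDensity b l).comp measurable_prodMk_left

theorem measurable_robinKernel_right (γ x : ℝ) : Measurable (robinKernel γ x) :=
  (measurable_robinKernel γ).comp measurable_prodMk_left

theorem integrable_igDensity_mul_igDensity {a lam γ x : ℝ} (ha : 0 < a) (hlam : 0 < lam)
    (hγ : 0 < γ) (hx : 0 < x) (α z : ℝ) :
    Integrable (fun p : ℝ × ℝ => igDensity 1 (2 * γ) x p.1 * igDensity a lam (z + α * p.1) p.2)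
      quadrant :=
  (integrable_mul_igDensity_prod (Z := fun τ => z + α * τ) ha hlam
    (integrableOn_igDensity one_pos (by positivity) hx) (by fun_prop)).1

theorem hasDerivAt_lumpedSol_left {a lam γ δ x : ℝ} (ha : 0 < a) (hlam : 0 < lam) (hγ : 0 < γ)
    (hδ0 : 0 < δ) (hδ1 : δ < 1) (hx : 0 < x) (α z t : ℝ) :
    HasDerivAt (fun x => lumpedSol a lam α γ δ x z t)
      (2 * γ * lumpedSol a lam α γ δ x z t - lumpedFlux a lam α γ δ x z t) x := by
  obtain ⟨C, hC, h⟩ := exists_weight_bound hγ hx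
  have hmem : x ∈ Metric.ball x (x / 2) := Metric.mem_ball_self (half_pos hx)
  have := hasDerivAt_integral_igDensity (a := a) (lam := lam) (α := α) (δ := δ) (z := z) (t := t)
    (C := 2 * γ * C + C) (H := robinKernel γ)
    (H' := fun x τ => 2 * γ * robinKernel γ x τ - igDensity 1 (2 * γ) x τ) ha hlam hδ0 hδ1
    (half_pos hx) (measurable_robinKernel_right γ)
    (fun x => ((measurable_robinKernel_right γ x).const_mul _).sub
      (measurable_igDensity_right 1 (2 * γ) x))
    (fun τ hτ => (h x hmem τ hτ).1.trans (by gcongr; nlinarith))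
    (fun y hy τ hτ => ?_) (fun y _ τ hτ => hasDerivAt_robinKernel_left hτ)
  · refine this.congr_deriv ?_
    unfold lumpedSol lumpedFlux
    have i1 := integrable_mul_wrightKernel_zero (t := t) hδ0 hδ1
      (integrable_robinKernel_mul_igDensity ha hlam hγ hx α z)
    have i2 := integrable_mul_wrightKernel_zero (t := t) hδ0 hδ1
      (integrable_igDensity_mul_igDensity ha hlam hγ hx α z)
    rw [← integral_const_mul, ← integral_sub (i1.const_mul _) i2]
    refine integral_congr_ae (Eventually.of_forall fun p => ?_)
    simp only
    ring
  · refine (abs_sub _ _).trans ?_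
    rw [abs_mul, abs_of_pos (show 0 < 2 * γ by positivity), add_mul, mul_assoc (2 * γ)]
    exact add_le_add (mul_le_mul_of_nonneg_left (h y hy τ hτ).1 (by positivity)) (h y hy τ hτ).2.1

theorem measurable_igDensityZ_right (b l Z : ℝ) : Measurable (igDensityZ b l Z) := by
  have h1 : Measurable fun v : ℝ => v ^ (-(3 / 2) : ℝ) := measurable_id.pow_const _
  have h2 : Measurable fun v : ℝ => v ^ (-(5 / 2) : ℝ) := measurable_id.pow_const _
  have h3 : Measurable fun v : ℝ => igExp b l Z v := by unfold igExp; fun_prop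
  unfold igDensityZ
  fun_prop

theorem hasDerivAt_lumpedFlux_left {a lam γ δ x : ℝ} (ha : 0 < a) (hlam : 0 < lam) (hγ : 0 < γ)
    (hδ0 : 0 < δ) (hδ1 : δ < 1) (hx : 0 < x) (α z t : ℝ) :
    HasDerivAt (fun x => lumpedFlux a lam α γ δ x z t)
      (∫ p, igDensityZ 1 (2 * γ) x p.1 * igDensity a lam (z + α * p.1) p.2 *
        wrightKernel δ 0 (p.1 + p.2) t ∂quadrant) x := by
  obtain ⟨C, hC, h⟩ := exists_weight_bound hγ hx
  have hmem : x ∈ Metric.ball x (x / 2) := Metric.mem_ball_self (half_pos hx)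
  have h1 : ∀ τ, 0 < τ → |igDensity 1 (2 * γ) x τ| ≤ C * ((1 + τ) ^ 2)⁻¹ :=
    fun τ hτ => (h x hmem τ hτ).2.1
  have h2 : ∀ y ∈ Metric.ball x (x / 2), ∀ τ, 0 < τ →
      |igDensityZ 1 (2 * γ) y τ| ≤ C * ((1 + τ) ^ 2)⁻¹ := fun y hy τ hτ => (h y hy τ hτ).2.2
  have h3 : ∀ y ∈ Metric.ball x (x / 2), ∀ τ, 0 < τ → HasDerivAt
      (fun y => igDensity 1 (2 * γ) y τ) (igDensityZ 1 (2 * γ) y τ) y :=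
    fun y _ τ hτ => hasDerivAt_igDensity one_pos hτ
  have := hasDerivAt_integral_igDensity (a := a) (lam := lam) (α := α) (δ := δ) (z := z) (t := t)
    ha hlam hδ0 hδ1 (half_pos hx) (measurable_igDensity_right 1 (2 * γ))
    (measurable_igDensityZ_right 1 (2 * γ)) h1 h2 h3
  exact this

theorem iteratedDeriv_lumpedSol_left {a lam γ δ x : ℝ} (ha : 0 < a) (hlam : 0 < lam) (hγ : 0 < γ)
    (hδ0 : 0 < δ) (hδ1 : δ < 1) (hx : 0 < x) (α z t : ℝ) :
    iteratedDeriv 2 (fun x => lumpedSol a lam α γ δ x z t) x -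
        2 * γ * deriv (fun x => lumpedSol a lam α γ δ x z t) x =
      -∫ p, igDensityZ 1 (2 * γ) x p.1 * igDensity a lam (z + α * p.1) p.2 *
        wrightKernel δ 0 (p.1 + p.2) t ∂quadrant := by
  have h1 := hasDerivAt_lumpedSol_left ha hlam hγ hδ0 hδ1 hx α z t
  have h2 := (h1.const_mul (2 * γ)).fun_sub (hasDerivAt_lumpedFlux_left ha hlam hγ hδ0 hδ1 hx α z t)
  have hev : deriv (fun x => lumpedSol a lam α γ δ x z t) =ᶠ[𝓝 x]
      fun x => 2 * γ * lumpedSol a lam α γ δ x z t - lumpedFlux a lam α γ δ x z t := by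
    filter_upwards [lt_mem_nhds hx] with y hy
    exact (hasDerivAt_lumpedSol_left ha hlam hγ hδ0 hδ1 hy α z t).deriv
  rw [iteratedDeriv_succ, iteratedDeriv_one, hev.deriv_eq, h2.deriv, h1.deriv]
  ring

theorem tendsto_lumpedFlux {a lam α γ δ t : ℝ} (ha : 0 < a) (hlam : 0 < lam) (hα : 0 < α)
    (hγ : 0 < γ) (hδ0 : 0 < δ) (hδ1 : δ < 1) (ht : 0 < t) :
    Tendsto (fun x => lumpedFlux a lam α γ δ x 0 t) (𝓝[>] 0) (𝓝 1) := by
  obtain ⟨C, hC, h⟩ := exists_abs_wrightKernel_zero_sub_one_le hδ0 hδ1 ht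
  obtain ⟨C₀, hC₀0, hC₀⟩ := exists_abs_wrightKernel_zero_le hδ0 hδ1
  have hl : 0 < 2 * γ := by positivity
  set D := C * (1 + α / lam)
  have inner : ∀ τ, 0 < τ → |(∫ v, igDensity a lam (0 + α * τ) v * wrightKernel δ 0 (τ + v) t
      ∂halfLine) - 1| ≤ D * τ := fun τ hτ => by
    have hZ : 0 < 0 + α * τ := by positivity
    have i0 := integrableOn_igDensity ha hlam hZ
    have i1 := integrableOn_mul_igDensity ha hlam hZ
    have i2 : IntegrableOn (fun v => igDensity a lam (0 + α * τ) v * wrightKernel δ 0 (τ + v) t)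
        (Ioi 0) := by
      refine i0.mul_bdd (c := C₀) ((measurable_wrightKernel hδ0 hδ1 le_rfl).comp
        ((measurable_const.add measurable_id).prodMk measurable_const)).aestronglyMeasurable ?_
      exact (ae_restrict_mem measurableSet_Ioi).mono fun v (hv : 0 < v) => hC₀ _ _ (by positivity)
    rw [← integral_igDensity ha hlam hZ, ← integral_sub i2 i0]
    calc _ ≤ ∫ v, (C * τ * igDensity a lam (0 + α * τ) v +
          C * (v * igDensity a lam (0 + α * τ) v)) ∂halfLine := by
          refine abs_integral_le_of_abs_le ((i0.const_mul _).add (i1.const_mul _)) ?_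
          refine (ae_restrict_mem measurableSet_Ioi).mono fun v (hv : 0 < v) => ?_
          have h1 := h (τ + v) (by positivity)
          have h3 := igDensity_nonneg (l := lam) ha hZ.le hv
          rw [← mul_sub_one, abs_mul, abs_of_nonneg h3]
          calc _ ≤ igDensity a lam (0 + α * τ) v * (C * (τ + v)) := by gcongr
            _ = _ := by ring
      _ = _ := by
        rw [integral_add (i0.const_mul _) (i1.const_mul _), integral_const_mul, integral_const_mul,
          integral_igDensity ha hlam hZ, integral_mul_igDensity ha hlam hZ]
        simp only [D]
        ring
  have hbound : ∀ x, 0 < x → |lumpedFlux a lam α γ δ x 0 t - 1| ≤ D / (2 * γ) * x := fun x hx => by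
    have j0 := integrableOn_igDensity one_pos hl hx
    have j1 := integrableOn_mul_igDensity one_pos hl hx
    have j2 := integrable_mul_wrightKernel_zero (t := t) hδ0 hδ1
      (integrable_igDensity_mul_igDensity ha hlam hγ hx α 0)
    have e : lumpedFlux a lam α γ δ x 0 t = ∫ τ, igDensity 1 (2 * γ) x τ *
        ∫ v, igDensity a lam (0 + α * τ) v * wrightKernel δ 0 (τ + v) t ∂halfLine ∂halfLine := by
      unfold lumpedFlux
      rw [integral_prod _ j2]
      refine integral_congr_ae (Eventually.of_forall fun τ => ?_)
      simp only
      rw [← integral_const_mul]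
      simp only [mul_assoc]
    have j3 : Integrable (fun τ => igDensity 1 (2 * γ) x τ *
        ∫ v, igDensity a lam (0 + α * τ) v * wrightKernel δ 0 (τ + v) t ∂halfLine) halfLine := by
      refine j2.integral_prod_left.congr (Eventually.of_forall fun τ => ?_)
      simp only
      rw [← integral_const_mul]
      simp only [mul_assoc]
    have hone := integral_igDensity one_pos hl hx
    have hsub : lumpedFlux a lam α γ δ x 0 t - 1 = ∫ τ, (igDensity 1 (2 * γ) x τ *
        (∫ v, igDensity a lam (0 + α * τ) v * wrightKernel δ 0 (τ + v) t ∂halfLine) -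
          igDensity 1 (2 * γ) x τ) ∂halfLine := by
      rw [integral_sub j3 j0, e, hone]
    rw [hsub]
    calc _ ≤ ∫ τ, D * (τ * igDensity 1 (2 * γ) x τ) ∂halfLine := by
          refine abs_integral_le_of_abs_le (j1.const_mul _) ?_
          refine (ae_restrict_mem measurableSet_Ioi).mono fun τ (hτ : 0 < τ) => ?_
          have h3 := igDensity_nonneg (l := 2 * γ) one_pos hx.le hτ
          rw [← mul_sub_one, abs_mul, abs_of_nonneg h3]
          calc _ ≤ igDensity 1 (2 * γ) x τ * (D * τ) := by gcongr; exact inner τ hτ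
            _ = _ := by ring
      _ = _ := by
        rw [integral_const_mul, integral_mul_igDensity one_pos hl hx]
        ring
  rw [tendsto_iff_norm_sub_tendsto_zero]
  have h0 : Tendsto (fun x : ℝ => D / (2 * γ) * x) (𝓝[>] 0) (𝓝 0) := by
    have : Tendsto (fun x : ℝ => D / (2 * γ) * x) (𝓝 0) (𝓝 (D / (2 * γ) * 0)) :=
      tendsto_id.const_mul _
    rw [mul_zero] at this
    exact this.mono_left nhdsWithin_le_nhds
  refine squeeze_zero' (Eventually.of_forall fun x => norm_nonneg _) ?_ h0
  filter_upwards [self_mem_nhdsWithin] with x hx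
  exact hbound x hx

/-! ### Derivatives in `z` at interior points -/

theorem exists_robinKernel_mul_le {α γ z x : ℝ} (hα : 0 < α) (hγ : 0 < γ) (hx : 0 < x)
    (hz : 0 < z) (C : ℝ) (hC : 0 < C) : ∃ D, 0 < D ∧ ∀ R : ℝ → ℝ → ℝ,
      (∀ Z v, z / 2 ≤ Z → 0 < v → (1 + v) ^ 2 * |R Z v| ≤ C * (1 + Z) ^ 5) →
      ∀ z' ∈ Metric.ball z (z / 2), ∀ τ v, 0 < τ → 0 < v →
        |robinKernel γ x τ * R (z' + α * τ) v| ≤ D * (((1 + τ) ^ 2)⁻¹ * ((1 + v) ^ 2)⁻¹) := by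
  obtain ⟨C₁, hC₁, h₁⟩ := exists_robinKernel_le hγ hx le_rfl 7
  set E := 1 + 2 * z + α with hE
  have hE0 : 0 < E := by positivity
  refine ⟨C₁ * (1 + x) ^ 7 * (C * E ^ 5), by positivity, fun R hR z' hz' τ v hτ hv => ?_⟩
  rw [Metric.mem_ball, Real.dist_eq, abs_lt] at hz'
  have hατ : 0 < α * τ := by positivity
  have g1 := h₁ x τ le_rfl hτ
  have g2 := hR (z' + α * τ) v (by linarith [hz'.1]) hv
  simp only [neg_zero, rpow_zero, one_mul] at g1
  have g3 : (1 + (z' + α * τ)) ^ 5 ≤ (E * (1 + τ)) ^ 5 := by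
    have h0 : 0 ≤ 1 + (z' + α * τ) := by linarith [hz'.1]
    refine pow_le_pow_left₀ h0 ?_ 5
    have : E * (1 + τ) = 1 + 2 * z + α + (1 + 2 * z) * τ + α * τ := by rw [hE]; ring
    rw [this]
    have : 0 < (1 + 2 * z) * τ := by positivity
    linarith [hz'.2]
  have e1 : |robinKernel γ x τ| ≤ C₁ * (1 + x) ^ 7 * ((1 + τ) ^ 7)⁻¹ := by
    rw [le_mul_inv_iff₀ (by positivity), mul_comm]; exact g1
  have e2 : |R (z' + α * τ) v| ≤ C * (E * (1 + τ)) ^ 5 * ((1 + v) ^ 2)⁻¹ := by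
    rw [le_mul_inv_iff₀ (by positivity), mul_comm]
    exact g2.trans (by gcongr)
  rw [abs_mul]
  calc _ ≤ C₁ * (1 + x) ^ 7 * ((1 + τ) ^ 7)⁻¹ * (C * (E * (1 + τ)) ^ 5 * ((1 + v) ^ 2)⁻¹) := by
        gcongr
    _ = _ := by field_simp

theorem integrable_quadrant_bound (D : ℝ) :
    Integrable (fun p : ℝ × ℝ => D * (((1 + p.1) ^ 2)⁻¹ * ((1 + p.2) ^ 2)⁻¹)) quadrant := by
  have h := integrable_one_add_sq_inv_halfLine 1
  simp only [one_mul] at h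
  exact (h.mul_prod h).const_mul D

theorem measurable_level {R : ℝ → ℝ → ℝ} (hR : Measurable fun p : ℝ × ℝ => R p.1 p.2) (z α : ℝ) :
    Measurable fun p : ℝ × ℝ => R (z + α * p.1) p.2 :=
  hR.comp ((measurable_const.add (measurable_const.mul measurable_fst)).prodMk measurable_snd)

theorem hasDerivAt_integral_level {α γ δ x z t C : ℝ} (hα : 0 < α) (hγ : 0 < γ)
    (hδ0 : 0 < δ) (hδ1 : δ < 1) (hx : 0 < x) (hz : 0 < z) {R R' : ℝ → ℝ → ℝ} (hC : 0 < C)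
    (hRm : Measurable fun p : ℝ × ℝ => R p.1 p.2) (hRm' : Measurable fun p : ℝ × ℝ => R' p.1 p.2)
    (hR : ∀ Z v, z / 2 ≤ Z → 0 < v → (1 + v) ^ 2 * |R Z v| ≤ C * (1 + Z) ^ 5)
    (hR' : ∀ Z v, z / 2 ≤ Z → 0 < v → (1 + v) ^ 2 * |R' Z v| ≤ C * (1 + Z) ^ 5)
    (hd : ∀ Z v, 0 < v → HasDerivAt (fun Z => R Z v) (R' Z v) Z) :
    Integrable (fun p : ℝ × ℝ => robinKernel γ x p.1 * R' (z + α * p.1) p.2 *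
        wrightKernel δ 0 (p.1 + p.2) t) quadrant ∧
    HasDerivAt (fun z => ∫ p, robinKernel γ x p.1 * R (z + α * p.1) p.2 *
        wrightKernel δ 0 (p.1 + p.2) t ∂quadrant)
      (∫ p, robinKernel γ x p.1 * R' (z + α * p.1) p.2 *
        wrightKernel δ 0 (p.1 + p.2) t ∂quadrant) z := by
  obtain ⟨C₀, hC₀0, hC₀⟩ := exists_abs_wrightKernel_zero_le hδ0 hδ1
  obtain ⟨D, hD0, hD⟩ := exists_robinKernel_mul_le hα hγ hx hz C hC
  have hm : ∀ {S : ℝ → ℝ → ℝ}, (Measurable fun p : ℝ × ℝ => S p.1 p.2) → ∀ z' : ℝ,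
      AEStronglyMeasurable (fun p : ℝ × ℝ => robinKernel γ x p.1 * S (z' + α * p.1) p.2 *
        wrightKernel δ 0 (p.1 + p.2) t) quadrant := by
    intro S hS z'
    exact ((((measurable_robinKernel_right γ x).comp measurable_fst).mul
      (measurable_level hS z' α)).mul
      (measurable_wrightKernel_zero_add hδ0 hδ1 t)).aestronglyMeasurable
  have hb := integrable_quadrant_bound (D * C₀)
  have hle : ∀ {S : ℝ → ℝ → ℝ}, (∀ Z v, z / 2 ≤ Z → 0 < v → (1 + v) ^ 2 * |S Z v| ≤
      C * (1 + Z) ^ 5) → ∀ p : ℝ × ℝ, 0 < p.1 ∧ 0 < p.2 → ∀ z' ∈ Metric.ball z (z / 2),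
      ‖robinKernel γ x p.1 * S (z' + α * p.1) p.2 * wrightKernel δ 0 (p.1 + p.2) t‖ ≤
        D * C₀ * (((1 + p.1) ^ 2)⁻¹ * ((1 + p.2) ^ 2)⁻¹) := by
    intro S hS p hp z' hz'
    rw [norm_mul, norm_eq_abs, norm_eq_abs]
    have h1 := hD S hS z' hz' p.1 p.2 hp.1 hp.2
    have h2 := hC₀ (p.1 + p.2) t (add_pos hp.1 hp.2).le
    calc _ ≤ D * (((1 + p.1) ^ 2)⁻¹ * ((1 + p.2) ^ 2)⁻¹) * C₀ := by gcongr
      _ = _ := by ring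
  have hmem : z ∈ Metric.ball z (z / 2) := Metric.mem_ball_self (half_pos hz)
  refine hasDerivAt_integral_of_dominated_loc_of_deriv_le (Metric.ball_mem_nhds z (half_pos hz))
    (bound := fun p : ℝ × ℝ => D * C₀ * (((1 + p.1) ^ 2)⁻¹ * ((1 + p.2) ^ 2)⁻¹))
    (F' := fun z p => robinKernel γ x p.1 * R' (z + α * p.1) p.2 *
        wrightKernel δ 0 (p.1 + p.2) t)
    (Eventually.of_forall fun z' => hm hRm z') ?_ (hm hRm' z) ?_ hb ?_
  · exact hb.mono' (hm hRm z) (ae_quadrant.mono fun p hp => hle hR p hp z hmem)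
  · exact ae_quadrant.mono fun p hp z' hz' => hle hR' p hp z' hz'
  · refine ae_quadrant.mono fun p hp z' hz' => ?_
    have := (hd (z' + α * p.1) p.2 hp.2).comp_add_const z' (α * p.1)
    exact (this.const_mul _).mul_const _

theorem exists_igDensity_bounds {a lam Z₀ : ℝ} (ha : 0 < a) (hlam : 0 < lam) (hZ₀ : 0 < Z₀) :
    ∃ C, 0 < C ∧
      (∀ Z v, Z₀ ≤ Z → 0 < v → (1 + v) ^ 2 * |igDensity a lam Z v| ≤ C * (1 + Z) ^ 5) ∧
      (∀ Z v, Z₀ ≤ Z → 0 < v → (1 + v) ^ 2 * |igDensityZ a lam Z v| ≤ C * (1 + Z) ^ 5) ∧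
      (∀ Z v, Z₀ ≤ Z → 0 < v → (1 + v) ^ 2 * |igDensityZZ a lam Z v| ≤ C * (1 + Z) ^ 5) := by
  obtain ⟨C₁, hC₁, h₁⟩ := exists_igDensity_le ha hlam hZ₀ le_rfl 2
  obtain ⟨C₂, hC₂, h₂⟩ := exists_igDensityZ_le ha hlam hZ₀ le_rfl 2
  obtain ⟨C₃, hC₃, h₃⟩ := exists_igDensityZZ_le ha hlam hZ₀ le_rfl 2
  simp only [neg_zero, rpow_zero, one_mul] at h₁ h₂ h₃
  refine ⟨C₁ + C₂ + C₃, by positivity, fun Z v hZ hv => (h₁ Z v hZ hv).trans ?_,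
    fun Z v hZ hv => (h₂ Z v hZ hv).trans ?_, fun Z v hZ hv => (h₃ Z v hZ hv).trans ?_⟩ <;>
  · have : 0 < 1 + Z := by linarith
    gcongr
    linarith

theorem integral_deriv_igDensity_mul_wrightKernel {a lam Z δ τ t : ℝ} (ha : 0 < a)
    (hlam : 0 < lam) (hδ0 : 0 < δ) (hδ1 : δ < 1) (hZ : 0 < Z) (hτ : 0 < τ) (ht : 0 < t) :
    ∫ v, (a ^ 2 * igDensityZZ a lam Z v - lam * igDensityZ a lam Z v) *
        wrightKernel δ 0 (τ + v) t ∂halfLine =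
      ∫ v, igDensity a lam Z v * wrightKernel δ δ (τ + v) t ∂halfLine := by
  obtain ⟨C₀, hC₀0, hC₀⟩ := exists_abs_wrightKernel_zero_le hδ0 hδ1
  obtain ⟨C₁, hC₁0, hC₁⟩ := exists_abs_wrightKernel_self_le hδ0 hδ1 ht
  obtain ⟨C, hC, -, h₁, h₂⟩ := exists_igDensity_bounds ha hlam hZ
  have hm0 : Measurable fun v => wrightKernel δ 0 (τ + v) t :=
    (measurable_wrightKernel hδ0 hδ1 le_rfl).comp
      ((measurable_const.add measurable_id).prodMk measurable_const)
  have hm1 : Measurable fun v => wrightKernel δ δ (τ + v) t :=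
    (measurable_wrightKernel hδ0 hδ1 hδ0.le).comp
      ((measurable_const.add measurable_id).prodMk measurable_const)
  have iZ : Integrable (igDensityZ a lam Z) halfLine := by
    refine integrableOn_Ioi_of_abs_le (C := C * (1 + Z) ^ 5) (measurable_igDensityZ_right a lam Z)
      fun v hv => ?_
    rw [le_mul_inv_iff₀ (by positivity), mul_comm]
    exact h₁ Z v le_rfl hv
  have iZZ : Integrable (igDensityZZ a lam Z) halfLine := by
    refine integrableOn_Ioi_of_abs_le (C := C * (1 + Z) ^ 5)
      ((measurable_igDensityZZ a lam).of_uncurry_left (f := igDensityZZ a lam)) fun v hv => ?_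
    rw [le_mul_inv_iff₀ (by positivity), mul_comm]
    exact h₂ Z v le_rfl hv
  have i1 : Integrable (fun v => (a ^ 2 * igDensityZZ a lam Z v - lam * igDensityZ a lam Z v) *
        wrightKernel δ 0 (τ + v) t) halfLine := by
    refine ((iZZ.const_mul _).sub (iZ.const_mul _)).mul_bdd (c := C₀) hm0.aestronglyMeasurable ?_
    exact (ae_restrict_mem measurableSet_Ioi).mono fun v (hv : 0 < v) => hC₀ _ _ (by positivity)
  have i2 : Integrable (fun v => igDensity a lam Z v * wrightKernel δ δ (τ + v) t) halfLine := by
    refine (integrableOn_igDensity ha hlam hZ).mul_bdd (c := C₁) hm1.aestronglyMeasurable ?_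
    exact (ae_restrict_mem measurableSet_Ioi).mono fun v (hv : 0 < v) => hC₁ _ (by positivity)
  have hlim : ∀ l : Filter ℝ, l ≤ 𝓟 (Ioi 0) →
      Tendsto (fun v => v ^ (-(3 / 2) : ℝ) * igExp a lam Z v) l (𝓝 0) →
      Tendsto (igDensity a lam Z * fun v => wrightKernel δ 0 (τ + v) t) l (𝓝 0) := by
    intro l hl h
    have h' : Tendsto (igDensity a lam Z) l (𝓝 0) := by
      have := h.const_mul (Z / (2 * a * √π))
      rw [mul_zero] at this
      refine this.congr fun v => ?_
      rw [igDensity]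
      ring
    refine h'.zero_mul_isBoundedUnder_le ⟨C₀, ?_⟩
    rw [eventually_map]
    filter_upwards [le_principal_iff.1 hl] with v hv
    exact hC₀ _ _ (add_pos hτ hv).le
  have key := integral_Ioi_deriv_mul_eq_sub (a := 0) (u := igDensity a lam Z)
    (u' := fun v => a ^ 2 * igDensityZZ a lam Z v - lam * igDensityZ a lam Z v)
    (v := fun v => wrightKernel δ 0 (τ + v) t) (v' := fun v => -wrightKernel δ δ (τ + v) t)
    (fun v hv => hasDerivAt_igDensity_right ha hv)
    (fun v _ => (hasDerivAt_wrightKernel_zero_left hδ0 hδ1 ht).comp_const_add τ v)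
    (by
      refine (i1.sub i2).congr (Eventually.of_forall fun v => ?_)
      simp only [Pi.sub_apply, Pi.add_apply, Pi.mul_apply]
      ring)
    (hlim _ inf_le_right (tendsto_rpow_mul_igExp_nhdsGT ha hlam hZ (by norm_num)))
    (hlim _ (le_principal_iff.2 (Ioi_mem_atTop 0))
      (tendsto_rpow_mul_igExp_atTop ha hlam hZ (by norm_num)))
  rw [sub_zero] at key
  refine sub_eq_zero.1 ?_
  rw [← integral_sub i1 i2]
  refine Eq.trans ?_ key
  refine integral_congr_ae (Eventually.of_forall fun v => ?_)
  simp only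
  ring

theorem lumpedSol_diffusion {a lam α γ δ x z t : ℝ} (ha : 0 < a) (hlam : 0 < lam) (hα : 0 < α)
    (hγ : 0 < γ) (hδ0 : 0 < δ) (hδ1 : δ < 1) (hx : 0 < x) (hz : 0 < z) (ht : 0 < t) :
    caputo δ (fun t' => lumpedSol a lam α γ δ x z t') t =
      a ^ 2 * iteratedDeriv 2 (fun z' => lumpedSol a lam α γ δ x z' t) z -
        lam * deriv (fun z' => lumpedSol a lam α γ δ x z' t) z := by
  have hd1 : ∀ z, 0 < z → Integrable (fun p : ℝ × ℝ => robinKernel γ x p.1 *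
        igDensityZ a lam (z + α * p.1) p.2 * wrightKernel δ 0 (p.1 + p.2) t) quadrant ∧
      HasDerivAt (fun z' => lumpedSol a lam α γ δ x z' t)
      (∫ p, robinKernel γ x p.1 * igDensityZ a lam (z + α * p.1) p.2 *
        wrightKernel δ 0 (p.1 + p.2) t ∂quadrant) z := fun z hz => by
    obtain ⟨C, hC, h₀, h₁, h₂⟩ := exists_igDensity_bounds ha hlam (half_pos hz)
    exact hasDerivAt_integral_level hα hγ hδ0 hδ1 hx hz hC (measurable_igDensity a lam)
      (measurable_igDensityZ a lam) h₀ h₁ fun Z v hv => hasDerivAt_igDensity ha hv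
  obtain ⟨C, hC, h₀, h₁, h₂⟩ := exists_igDensity_bounds ha hlam (half_pos hz)
  obtain ⟨i2, hd2⟩ := hasDerivAt_integral_level (t := t) hα hγ hδ0 hδ1 hx hz hC
    (measurable_igDensityZ a lam) (measurable_igDensityZZ a lam) h₁ h₂
    fun Z v hv => hasDerivAt_igDensityZ ha hv
  obtain ⟨i1, hd1z⟩ := hd1 z hz
  have hev : deriv (fun z' => lumpedSol a lam α γ δ x z' t) =ᶠ[𝓝 z] fun z =>
      ∫ p, robinKernel γ x p.1 * igDensityZ a lam (z + α * p.1) p.2 *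
        wrightKernel δ 0 (p.1 + p.2) t ∂quadrant := by
    filter_upwards [lt_mem_nhds hz] with y hy
    exact (hd1 y hy).2.deriv
  rw [caputo_lumpedSol ha hlam hγ hδ0 hδ1 hx ht z, iteratedDeriv_succ, iteratedDeriv_one,
    hev.deriv_eq, hd2.deriv, hd1z.deriv, ← integral_const_mul, ← integral_const_mul,
    ← integral_sub (i2.const_mul _) (i1.const_mul _)]
  obtain ⟨C₁, hC₁0, hC₁⟩ := exists_abs_wrightKernel_self_le hδ0 hδ1 ht
  have hm : Measurable fun p : ℝ × ℝ => wrightKernel δ δ (p.1 + p.2) t :=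
    (measurable_wrightKernel hδ0 hδ1 hδ0.le).comp
      ((measurable_fst.add measurable_snd).prodMk measurable_const)
  have i3 : Integrable (fun p : ℝ × ℝ => robinKernel γ x p.1 *
      igDensity a lam (z + α * p.1) p.2 * wrightKernel δ δ (p.1 + p.2) t) quadrant := by
    refine (integrable_robinKernel_mul_igDensity ha hlam hγ hx α z).mul_bdd (c := C₁)
      hm.aestronglyMeasurable ?_
    exact ae_quadrant.mono fun p hp => hC₁ _ (add_pos hp.1 hp.2).le
  rw [integral_prod _ i3]
  refine Eq.trans ?_ (integral_prod _ ((i2.const_mul (a ^ 2)).sub (i1.const_mul lam))).symm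
  refine setIntegral_congr_fun measurableSet_Ioi fun τ (hτ : 0 < τ) => ?_
  have := congrArg (robinKernel γ x τ * ·) (integral_deriv_igDensity_mul_wrightKernel
    (Z := z + α * τ) ha hlam hδ0 hδ1 (by positivity) hτ ht)
  simp only [← integral_const_mul] at this
  refine Eq.trans ?_ (this.symm.trans ?_)
  · exact integral_congr_ae (Eventually.of_forall fun v => by simp only; ring)
  · exact integral_congr_ae (Eventually.of_forall fun v => by simp only [Pi.sub_apply]; ring)

/-! ### The derivative in `z` at `z = 0` -/

/-- Lebesgue measure on the half-plane of points with positive second coordinate. -/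
noncomputable abbrev halfPlane : Measure (ℝ × ℝ) := (volume : Measure ℝ).prod halfLine

theorem ae_halfPlane : ∀ᵐ p ∂halfPlane, 0 < p.2 := by
  have h : ∀ᵐ v ∂halfLine, 0 < v := ae_restrict_mem measurableSet_Ioi
  exact Measure.quasiMeasurePreserving_snd.ae h

theorem integral_quadrant_eq (F : ℝ → ℝ → ℝ) :
    ∫ p, F p.1 p.2 ∂quadrant = ∫ p, (if 0 < p.1 then F p.1 p.2 else 0) ∂halfPlane := by
  have h : quadrant = halfPlane.restrict (Ioi 0 ×ˢ univ) := by
    rw [halfPlane, ← Measure.prod_restrict, Measure.restrict_univ]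
  rw [h, ← integral_indicator (measurableSet_Ioi.prod MeasurableSet.univ)]
  refine integral_congr_ae (Eventually.of_forall fun p => ?_)
  simp [indicator_apply]

theorem integral_halfPlane_sub (F : ℝ × ℝ → ℝ) (c : ℝ) :
    ∫ p, F (p.1 - c, p.2) ∂halfPlane = ∫ p, F p ∂halfPlane := by
  have h : MeasurePreserving ((MeasurableEquiv.subRight c).prodCongr (MeasurableEquiv.refl ℝ))
      halfPlane halfPlane :=
    (measurePreserving_sub_right volume c).prod (MeasurePreserving.id _)
  exact h.integral_comp' F

/-- The integrand weighting the inverse Gaussian density in `lumpedSol`, extended by `0`. -/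
noncomputable def shiftWeight (γ δ x t v σ : ℝ) : ℝ :=
  if 0 < σ then robinKernel γ x σ * wrightKernel δ 0 (σ + v) t else 0

/-- The derivative of `shiftWeight` in its last argument. -/
noncomputable def shiftWeightDeriv (γ δ x t v σ : ℝ) : ℝ :=
  if 0 < σ then -(igDensityZ 1 (2 * γ) x σ * wrightKernel δ 0 (σ + v) t +
    robinKernel γ x σ * wrightKernel δ δ (σ + v) t) else 0

theorem hasDerivAt_shiftWeight {γ δ x t v : ℝ} (hγ : 0 < γ) (hδ0 : 0 < δ) (hδ1 : δ < 1)
    (hx : 0 < x) (ht : 0 < t) (hv : 0 < v) (σ : ℝ) :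
    HasDerivAt (shiftWeight γ δ x t v) (shiftWeightDeriv γ δ x t v σ) σ := by
  rcases lt_trichotomy σ 0 with hσ | rfl | hσ
  · rw [shiftWeightDeriv, if_neg hσ.not_gt]
    refine (hasDerivAt_const σ (0 : ℝ)).congr_of_eventuallyEq ?_
    filter_upwards [gt_mem_nhds hσ] with s hs
    rw [shiftWeight, if_neg (not_lt.2 (le_of_lt hs))]
  · obtain ⟨C₀, hC₀0, hC₀⟩ := exists_abs_wrightKernel_zero_le hδ0 hδ1
    obtain ⟨C, hC, h⟩ := exists_robinKernel_le hγ hx (k := 2) (by norm_num) 0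
    rw [shiftWeightDeriv, if_neg (lt_irrefl _)]
    have hO : shiftWeight γ δ x t v =O[𝓝 0] fun s => ‖s - 0‖ ^ 2 := by
      refine Asymptotics.IsBigO.of_bound (C * C₀) (Eventually.of_forall fun s => ?_)
      rw [shiftWeight]
      split_ifs with hs
      · have h1 := h x s le_rfl hs
        rw [pow_zero, pow_zero, mul_one, mul_one, rpow_neg hs.le, inv_mul_le_iff₀ (by positivity),
          rpow_two] at h1
        have h2 := hC₀ (s + v) t (by positivity)
        rw [norm_mul, norm_eq_abs, norm_eq_abs, sub_zero, norm_eq_abs s, sq_abs,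
          Real.norm_of_nonneg (sq_nonneg s)]
        calc _ ≤ s ^ 2 * C * C₀ := by gcongr
          _ = _ := by ring
      · rw [norm_zero]; positivity
    have := hO.hasFDerivAt (𝕜 := ℝ) one_lt_two
    simpa using this.hasDerivAt
  · rw [shiftWeightDeriv, if_pos hσ]
    have h1 := (hasDerivAt_robinKernel_right (γ := γ) (x := x) hσ).fun_mul
      ((hasDerivAt_wrightKernel_zero_left (w := σ + v) hδ0 hδ1 ht).comp_add_const σ v)
    refine (h1.congr_deriv ?_).congr_of_eventuallyEq ?_
    · ring
    · filter_upwards [lt_mem_nhds hσ] with s hs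
      rw [shiftWeight, if_pos hs]

theorem exists_shiftWeight_le {γ δ x t : ℝ} (hγ : 0 < γ) (hδ0 : 0 < δ) (hδ1 : δ < 1)
    (hx : 0 < x) (ht : 0 < t) : ∃ D, 0 < D ∧ ∀ v σ, 0 < v →
      |shiftWeight γ δ x t v σ| ≤ D * ((1 + |σ|) ^ 2)⁻¹ ∧
      |shiftWeightDeriv γ δ x t v σ| ≤ D * ((1 + |σ|) ^ 2)⁻¹ := by
  obtain ⟨C₀, hC₀0, hC₀⟩ := exists_abs_wrightKernel_zero_le hδ0 hδ1
  obtain ⟨C₁, hC₁0, hC₁⟩ := exists_abs_wrightKernel_self_le hδ0 hδ1 ht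
  obtain ⟨C, hC, h⟩ := exists_weight_bound hγ hx
  refine ⟨C * (C₀ + C₁), by positivity, fun v σ hv => ?_⟩
  rw [shiftWeight, shiftWeightDeriv]
  split_ifs with hσ
  · obtain ⟨h1, -, h2⟩ := h x (Metric.mem_ball_self (half_pos hx)) σ hσ
    have e0 := hC₀ (σ + v) t (by positivity)
    have e1 := hC₁ (σ + v) (by positivity)
    rw [abs_of_pos hσ]
    have h0 : 0 ≤ C * ((1 + σ) ^ 2)⁻¹ := by positivity
    constructor
    · rw [abs_mul]
      calc _ ≤ C * ((1 + σ) ^ 2)⁻¹ * C₀ := by gcongr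
        _ ≤ C * ((1 + σ) ^ 2)⁻¹ * (C₀ + C₁) := by gcongr; linarith
        _ = _ := by ring
    · rw [abs_neg]
      refine (abs_add_le _ _).trans ?_
      rw [abs_mul, abs_mul]
      calc _ ≤ C * ((1 + σ) ^ 2)⁻¹ * C₀ + C * ((1 + σ) ^ 2)⁻¹ * C₁ := by gcongr
        _ = _ := by ring
  · rw [abs_zero]
    constructor <;> positivity

theorem measurable_shiftWeight {δ : ℝ} (hδ0 : 0 < δ) (hδ1 : δ < 1) (γ x t : ℝ) :
    Measurable fun p : ℝ × ℝ => shiftWeight γ δ x t p.2 p.1 :=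
  Measurable.ite (measurableSet_lt measurable_const measurable_fst)
    (((measurable_robinKernel_right γ x).comp measurable_fst).mul
      (measurable_wrightKernel_zero_add hδ0 hδ1 t)) measurable_const

theorem measurable_shiftWeightDeriv {δ : ℝ} (hδ0 : 0 < δ) (hδ1 : δ < 1) (γ x t : ℝ) :
    Measurable fun p : ℝ × ℝ => shiftWeightDeriv γ δ x t p.2 p.1 := by
  have hm : Measurable fun p : ℝ × ℝ => wrightKernel δ δ (p.1 + p.2) t :=
    (measurable_wrightKernel hδ0 hδ1 hδ0.le).comp
      ((measurable_fst.add measurable_snd).prodMk measurable_const)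
  exact Measurable.ite (measurableSet_lt measurable_const measurable_fst)
    ((((measurable_igDensityZ_right 1 (2 * γ) x).comp measurable_fst).mul
      (measurable_wrightKernel_zero_add hδ0 hδ1 t)).add
      (((measurable_robinKernel_right γ x).comp measurable_fst).mul hm)).neg measurable_const

theorem lumpedSol_eq_shift {a lam α γ δ x : ℝ} (hα : 0 < α) (z t : ℝ) :
    lumpedSol a lam α γ δ x z t = ∫ p, igDensity a lam (α * p.1) p.2 *
      shiftWeight γ δ x t p.2 (p.1 - z / α) ∂halfPlane := by
  unfold lumpedSol
  rw [integral_quadrant_eq fun σ v => robinKernel γ x σ * igDensity a lam (z + α * σ) v *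
    wrightKernel δ 0 (σ + v) t]
  refine (integral_halfPlane_sub _ (z / α)).symm.trans ?_
  refine integral_congr_ae (Eventually.of_forall fun p => ?_)
  have : z + α * (p.1 - z / α) = α * p.1 := by field_simp; ring
  simp only [this, shiftWeight]
  split_ifs <;> ring

theorem inv_one_add_abs_sub_sq_le {c : ℝ} (hc : |c| ≤ 1) (s : ℝ) :
    ((1 + |s - c|) ^ 2)⁻¹ ≤ 4 * ((1 + |s|) ^ 2)⁻¹ := by
  have h : |s| ≤ |s - c| + |c| := by simpa using abs_add_le (s - c) c
  rw [inv_le_iff_one_le_mul₀ (by positivity), mul_assoc, ← div_eq_inv_mul, ← mul_div_assoc,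
    one_le_div (by positivity)]
  nlinarith [abs_nonneg s, abs_nonneg (s - c)]

theorem hasDerivAt_lumpedSol_zero {a lam α γ δ x t : ℝ} (ha : 0 < a) (hlam : 0 < lam)
    (hα : 0 < α) (hγ : 0 < γ) (hδ0 : 0 < δ) (hδ1 : δ < 1) (hx : 0 < x) (ht : 0 < t) :
    HasDerivAt (fun z => lumpedSol a lam α γ δ x z t)
      (α⁻¹ * ∫ p, igDensity a lam (0 + α * p.1) p.2 *
        (igDensityZ 1 (2 * γ) x p.1 * wrightKernel δ 0 (p.1 + p.2) t +
          robinKernel γ x p.1 * wrightKernel δ δ (p.1 + p.2) t) ∂quadrant) 0 := by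
  obtain ⟨D, hD0, hD⟩ := exists_shiftWeight_le hγ hδ0 hδ1 hx ht
  have hρ : Measurable fun p : ℝ × ℝ => igDensity a lam (α * p.1) p.2 := by
    simpa using measurable_level (measurable_igDensity a lam) 0 α
  have hsub : ∀ z : ℝ, Measurable fun p : ℝ × ℝ => (p.1 - z / α, p.2) := fun z => by fun_prop
  have hm : ∀ z, AEStronglyMeasurable (fun p : ℝ × ℝ => igDensity a lam (α * p.1) p.2 *
      shiftWeight γ δ x t p.2 (p.1 - z / α)) halfPlane := fun z =>
    (hρ.mul ((measurable_shiftWeight hδ0 hδ1 γ x t).comp (hsub z))).aestronglyMeasurable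
  have hm' : ∀ z, AEStronglyMeasurable (fun p : ℝ × ℝ => igDensity a lam (α * p.1) p.2 *
      (shiftWeightDeriv γ δ x t p.2 (p.1 - z / α) * -α⁻¹)) halfPlane := fun z =>
    (hρ.mul (((measurable_shiftWeightDeriv hδ0 hδ1 γ x t).comp (hsub z)).mul_const
      _)).aestronglyMeasurable
  have hb : ∀ E : ℝ, Integrable (fun p : ℝ × ℝ => |E * ((1 + |p.1|) ^ 2)⁻¹ *
      igDensity a lam (α * p.1) p.2|) halfPlane := fun E =>
    (integrable_mul_igDensity_prod (Z := fun τ => α * τ) ha hlam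
      (integrable_one_add_abs_sq_inv.const_mul E) (by fun_prop)).1.abs
  have hderiv : HasDerivAt (fun z => ∫ p, igDensity a lam (α * p.1) p.2 *
      shiftWeight γ δ x t p.2 (p.1 - z / α) ∂halfPlane)
      (∫ p, igDensity a lam (α * p.1) p.2 *
        (shiftWeightDeriv γ δ x t p.2 (p.1 - 0 / α) * -α⁻¹) ∂halfPlane) 0 := by
    refine (hasDerivAt_integral_of_dominated_loc_of_deriv_le (Metric.ball_mem_nhds 0 hα)
      (bound := fun p : ℝ × ℝ => |(D * α⁻¹ * 4) * ((1 + |p.1|) ^ 2)⁻¹ *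
        igDensity a lam (α * p.1) p.2|)
      (F' := fun z p => igDensity a lam (α * p.1) p.2 *
        (shiftWeightDeriv γ δ x t p.2 (p.1 - z / α) * -α⁻¹))
      (Eventually.of_forall hm) ?_ (hm' 0) ?_ (hb _) ?_).2
    · refine (hb D).mono' (hm 0) (ae_halfPlane.mono fun p hp => ?_)
      have := (hD p.2 (p.1 - 0 / α) hp).1
      rw [zero_div, sub_zero] at this ⊢
      rw [norm_mul, norm_eq_abs, norm_eq_abs, abs_mul, mul_comm]
      exact mul_le_mul_of_nonneg_right (this.trans (le_abs_self _)) (abs_nonneg _)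
    · refine ae_halfPlane.mono fun p hp z hz => ?_
      rw [Metric.mem_ball, dist_zero_right, norm_eq_abs] at hz
      have hc : |z / α| ≤ 1 := by
        rw [abs_div, abs_of_pos hα]; exact (div_le_one hα).2 hz.le
      have h1 := (hD p.2 (p.1 - z / α) hp).2
      have h2 := inv_one_add_abs_sub_sq_le hc p.1
      rw [norm_mul, norm_eq_abs, norm_eq_abs, abs_mul (_ * _) (igDensity _ _ _ _), mul_comm]
      refine mul_le_mul_of_nonneg_right (le_trans ?_ (le_abs_self _)) (abs_nonneg _)
      rw [abs_mul, abs_neg, abs_of_pos (inv_pos.2 hα)]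
      calc _ ≤ D * (4 * ((1 + |p.1|) ^ 2)⁻¹) * α⁻¹ := by
            gcongr
            exact h1.trans (by gcongr)
        _ = _ := by ring
    · refine ae_halfPlane.mono fun p hp z _ => ?_
      have h1 : HasDerivAt (fun z => p.1 - z / α) (-α⁻¹) z := by
        have := ((hasDerivAt_id z).div_const α).const_sub p.1
        simpa using this
      exact ((hasDerivAt_shiftWeight hγ hδ0 hδ1 hx ht hp _).comp z h1).const_mul _
  simp only [lumpedSol_eq_shift hα]
  refine hderiv.congr_deriv ?_
  rw [integral_quadrant_eq fun σ v => igDensity a lam (0 + α * σ) v *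
    (igDensityZ 1 (2 * γ) x σ * wrightKernel δ 0 (σ + v) t +
      robinKernel γ x σ * wrightKernel δ δ (σ + v) t), ← integral_const_mul]
  refine integral_congr_ae (Eventually.of_forall fun p => ?_)
  simp only [zero_div, sub_zero, zero_add, shiftWeightDeriv]
  split_ifs <;> ring

theorem lumpedSol_boundary {a lam α γ δ x t : ℝ} (ha : 0 < a) (hlam : 0 < lam)
    (hα : 0 < α) (hγ : 0 < γ) (hδ0 : 0 < δ) (hδ1 : δ < 1) (hx : 0 < x) (ht : 0 < t) :
    caputo δ (fun t' => lumpedSol a lam α γ δ x 0 t') t =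
      iteratedDeriv 2 (fun x' => lumpedSol a lam α γ δ x' 0 t) x -
        2 * γ * deriv (fun x' => lumpedSol a lam α γ δ x' 0 t) x +
        α * deriv (fun z' => lumpedSol a lam α γ δ x z' t) 0 := by
  obtain ⟨C₁, hC₁0, hC₁⟩ := exists_abs_wrightKernel_self_le hδ0 hδ1 ht
  obtain ⟨C, hC, h⟩ := exists_weight_bound hγ hx
  have hm : Measurable fun p : ℝ × ℝ => wrightKernel δ δ (p.1 + p.2) t :=
    (measurable_wrightKernel hδ0 hδ1 hδ0.le).comp
      ((measurable_fst.add measurable_snd).prodMk measurable_const)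
  have i1 : Integrable (fun p : ℝ × ℝ => robinKernel γ x p.1 *
      igDensity a lam (0 + α * p.1) p.2 * wrightKernel δ δ (p.1 + p.2) t) quadrant := by
    refine (integrable_robinKernel_mul_igDensity ha hlam hγ hx α 0).mul_bdd (c := C₁)
      hm.aestronglyMeasurable ?_
    exact ae_quadrant.mono fun p hp => hC₁ _ (add_pos hp.1 hp.2).le
  have iZ : Integrable (igDensityZ 1 (2 * γ) x) halfLine :=
    integrableOn_Ioi_of_abs_le (measurable_igDensityZ_right 1 (2 * γ) x)
      fun τ hτ => (h x (Metric.mem_ball_self (half_pos hx)) τ hτ).2.2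
  have i2 := integrable_mul_wrightKernel_zero (t := t) hδ0 hδ1
    (integrable_mul_igDensity_prod (Z := fun τ => 0 + α * τ) ha hlam iZ (by fun_prop)).1
  rw [iteratedDeriv_lumpedSol_left ha hlam hγ hδ0 hδ1 hx, caputo_lumpedSol ha hlam hγ hδ0 hδ1 hx ht,
    (hasDerivAt_lumpedSol_zero ha hlam hα hγ hδ0 hδ1 hx ht).deriv, mul_inv_cancel_left₀ hα.ne',
    eq_neg_add_iff_add_eq, ← integral_add i2 i1]
  refine integral_congr_ae (Eventually.of_forall fun p => ?_)
  simp only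
  ring

theorem caputo_congr {δ t : ℝ} (ht : 0 < t) {f g : ℝ → ℝ} (h : ∀ s, 0 < s → f s = g s) :
    caputo δ f t = caputo δ g t := by
  unfold caputo
  congr 1
  rw [intervalIntegral.integral_of_le ht.le, intervalIntegral.integral_of_le ht.le]
  refine setIntegral_congr_fun measurableSet_Ioc fun s hs => ?_
  have : f =ᶠ[𝓝 s] g := by
    filter_upwards [lt_mem_nhds hs.1] with r hr
    exact h r hr
  simp only [this.deriv_eq]

theorem caputo_const_mul (δ t c : ℝ) (f : ℝ → ℝ) :
    caputo δ (fun s => c * f s) t = c * caputo δ f t := by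
  unfold caputo
  simp only [deriv_const_mul_field, mul_assoc]
  rw [intervalIntegral.integral_const_mul, mul_left_comm]

/-- Theorem 2: the fractional lumped formulation in the linear case.
The function
`u(x,z,t) = 2γA e^{γx} ∫_0^∞ [ (1/√(πτ)) e^{−x²/(4τ)−γ²τ}
  − γ e^{γx} erfc(x/(2√τ) + γ√τ) ] e^{λ(z+ατ)/(2a²)} g₂(t,τ,z) dτ`
solves the boundary value problem (1.5), (1.6), (1.7)(b),(c) and (1.8). -/
theorem fractional_lumped_linear
    (a lam α γ A β : ℝ) (ha : 0 < a) (hlam : 0 < lam) (hα : 0 < α) (hγ : 0 < γ)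
    (hA : 0 < A) (hβ₁ : 0 < β) (hβ₂ : β < 1 / 2)
    (f₂ : ℝ → ℝ → ℝ → ℝ)
    (hf₂ : ∀ τ z s : ℝ, f₂ τ z s =
      (β * (z + α * τ) / (a * Real.sqrt π * s ^ (2 * β + 1))) *
        ∫ w in Ioi (0 : ℝ), w ^ (-(1 / 2 : ℝ)) *
          Real.exp (-(z + α * τ) ^ 2 / (4 * a ^ 2 * w) - lam ^ 2 * w / (4 * a ^ 2)) *
          Mwr (w / s ^ (2 * β)) (2 * β))
    (g₂ : ℝ → ℝ → ℝ → ℝ)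
    (hg₂ : ∀ t τ z : ℝ, g₂ t τ z =
      ∫ s in (0 : ℝ)..t, Nwr (τ / (t - s) ^ (2 * β)) β * f₂ τ z s)
    (u : ℝ → ℝ → ℝ → ℝ)
    (hu : ∀ x z t : ℝ, u x z t =
      2 * γ * A * Real.exp (γ * x) *
        ∫ τ in Ioi (0 : ℝ),
          ((1 / Real.sqrt (π * τ)) * Real.exp (-x ^ 2 / (4 * τ) - γ ^ 2 * τ) -
            γ * Real.exp (γ * x) * erfc (x / (2 * Real.sqrt τ) + γ * Real.sqrt τ)) *
          Real.exp (lam * (z + α * τ) / (2 * a ^ 2)) * g₂ t τ z) :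
    -- (i) the fractional heat equation for `x, z, t > 0`
    (∀ x z t : ℝ, 0 < x → 0 < z → 0 < t →
      caputo (2 * β) (fun t' => u x z t') t =
        a ^ 2 * iteratedDeriv 2 (fun z' => u x z' t) z -
          lam * deriv (fun z' => u x z' t) z) ∧
    -- (ii) the boundary condition at `z = 0`
    (∀ x t : ℝ, 0 < x → 0 < t →
      caputo (2 * β) (fun t' => u x 0 t') t =
        iteratedDeriv 2 (fun x' => u x' 0 t) x -
          2 * γ * deriv (fun x' => u x' 0 t) x +
          α * deriv (fun z' => u x z' t) 0) ∧
    -- (iii) `∂u/∂x − 2γu → −2γA` as `x → 0⁺` at `z = 0`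
    (∀ t : ℝ, 0 < t →
      Tendsto (fun x => deriv (fun x' => u x' 0 t) x - 2 * γ * u x 0 t)
        (nhdsWithin 0 (Ioi 0)) (nhds (-(2 * γ * A)))) ∧
    -- (iv) `u → 0` as `x² + z² → ∞`
    (∀ t : ℝ, 0 < t →
      Tendsto (fun w : ℝ × ℝ => u w.1 w.2 t)
        ((comap (fun w : ℝ × ℝ => w.1 ^ 2 + w.2 ^ 2) atTop) ⊓
          𝓟 (Ioi (0 : ℝ) ×ˢ Ioi (0 : ℝ))) (nhds 0)) ∧
    -- (v) `u → 0` as `t → 0⁺`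
    (∀ x z : ℝ, 0 < x → 0 < z →
      Tendsto (fun t => u x z t) (nhdsWithin 0 (Ioi 0)) (nhds 0)) := by
  have hδ0 : 0 < 2 * β := by linarith
  have hδ1 : 2 * β < 1 := by linarith
  have hsol : ∀ x z t, 0 < x → 0 < t →
      u x z t = 2 * γ * A * lumpedSol a lam α γ (2 * β) x z t := by
    intro x z t hx ht
    rw [hu, lumpedSol_eq ha hlam hγ hβ₁ hβ₂ hx ht, mul_assoc (2 * γ * A), ← integral_const_mul]
    congr 1
    refine setIntegral_congr_fun measurableSet_Ioi fun τ _ => ?_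
    have hg : Real.exp (lam * (z + α * τ) / (2 * a ^ 2)) * g₂ t τ z =
        ∫ s in (0 : ℝ)..t, Nwr (τ / (t - s) ^ (2 * β)) β *
          ∫ w in Ioi (0 : ℝ), igDensity a lam (z + α * τ) w * wrightKernel (2 * β) 1 w s := by
      rw [hg₂, ← intervalIntegral.integral_const_mul, intervalIntegral.integral_of_le ht.le,
        intervalIntegral.integral_of_le ht.le]
      refine setIntegral_congr_fun measurableSet_Ioc fun s hs => ?_
      rw [← exp_mul_setIntegral_Mwr ha hβ₁ hβ₂ hs.1, hf₂]
      ring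
    rw [← hg, robinKernel]
    ring
  have hx_ev : ∀ x t, 0 < x → 0 < t → (fun x' => u x' 0 t) =ᶠ[𝓝 x]
      fun x' => 2 * γ * A * lumpedSol a lam α γ (2 * β) x' 0 t := fun x t hx ht => by
    filter_upwards [lt_mem_nhds hx] with y hy
    exact hsol y 0 t hy ht
  have hcap : ∀ x z t, 0 < x → 0 < t → caputo (2 * β) (fun t' => u x z t') t =
      2 * γ * A * caputo (2 * β) (fun t' => lumpedSol a lam α γ (2 * β) x z t') t :=
    fun x z t hx ht => by
      rw [← caputo_const_mul]
      exact caputo_congr ht fun s hs => hsol x z s hx hs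
  have hz_fun : ∀ x t, 0 < x → 0 < t → (fun z' => u x z' t) =
      fun z' => 2 * γ * A * lumpedSol a lam α γ (2 * β) x z' t :=
    fun x t hx ht => funext fun z' => hsol x z' t hx ht
  refine ⟨fun x z t hx hz ht => ?_, fun x t hx ht => ?_, fun t ht => ?_, fun t ht => ?_,
    fun x z hx hz => ?_⟩
  · rw [hcap x z t hx ht, hz_fun x t hx ht, iteratedDeriv_const_mul_field, deriv_const_mul_field,
      lumpedSol_diffusion ha hlam hα hγ hδ0 hδ1 hx hz ht]
    ring
  · rw [hcap x 0 t hx ht, hz_fun x t hx ht, deriv_const_mul_field,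
      (hx_ev x t hx ht).iteratedDeriv_eq, (hx_ev x t hx ht).deriv_eq,
      iteratedDeriv_const_mul_field, deriv_const_mul_field,
      lumpedSol_boundary ha hlam hα hγ hδ0 hδ1 hx ht]
    ring
  · have h := (tendsto_lumpedFlux ha hlam hα hγ hδ0 hδ1 ht).const_mul (-(2 * γ * A))
    rw [mul_one] at h
    refine h.congr' ?_
    filter_upwards [self_mem_nhdsWithin] with x (hx : 0 < x)
    rw [(hx_ev x t hx ht).deriv_eq, deriv_const_mul_field, hsol x 0 t hx ht,
      (hasDerivAt_lumpedSol_left ha hlam hγ hδ0 hδ1 hx α 0 t).deriv]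
    ring
  · have h := (tendsto_lumpedSol_space ha hlam hα hγ hδ0 hδ1 ht).const_mul (2 * γ * A)
    rw [mul_zero] at h
    refine h.congr' ?_
    filter_upwards [mem_inf_of_right (mem_principal_self _)] with w hw
    exact (hsol w.1 w.2 t hw.1 ht).symm
  · have h := (tendsto_lumpedSol_time ha hlam hγ hδ0 hδ1 hx α z).const_mul (2 * γ * A)
    rw [mul_zero] at h
    refine h.congr' ?_
    filter_upwards [self_mem_nhdsWithin] with t (ht : 0 < t)
    exact (hsol x z t hx ht).symm
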